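/- Under Conditions (C1)–(C6), for every integer m ≥ 1 and every choice of pairs (u_1,v_1), …, (u_m,v_m) with 0 < u_i < v_i < 1 for each i, there exists a positive semidefinite 2m×2m matrix C with unit diagonal, whose cross-block between the first m coordinates and the last m coordinates is zero, such that the joint random vector (Z_w^π(⌊n·u_1⌋,⌊n·v_1⌋), …, Z_w^π(⌊n·u_m⌋,⌊n·v_m⌋), Z_diff^π(⌊n·u_1⌋,⌊n·v_1⌋), …, Z_diff^π(⌊n·u_m⌋,⌊n·v_m⌋)) under the permutation null distribution converges in distribution, as n → ∞, to a centered 2m-dimensional Gaussian random vector with covariance matrix C; in particular the limiting two-dimensional random fields Z_w*(u,v) and Z_diff*(u,v) are independent Gaussian fields. -/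

import Mathlib

open Finset Filter Asymptotics MeasureTheory ProbabilityTheory Topology

namespace RING

/-- `U1^π(t1,t2)`: sum of `R (π i) (π j)` over indices (1-based `i,j ∈ {1,…,n}`,
represented by `Fin n` with `i` standing for index `i+1`) with `t1 < i ≤ t2` and
`t1 < j ≤ t2`. -/
noncomputable def U1 (n : ℕ) (R : Fin n → Fin n → ℝ) (π : Equiv.Perm (Fin n))
    (t1 t2 : ℕ) : ℝ :=
  ∑ i : Fin n, ∑ j : Fin n,
    if t1 ≤ (i : ℕ) ∧ (i : ℕ) < t2 ∧ t1 ≤ (j : ℕ) ∧ (j : ℕ) < t2 then R (π i) (π j) else 0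

/-- `U2^π(t1,t2)`: sum of `R (π i) (π j)` over indices with `i ≤ t1` or `i > t2`,
and `j ≤ t1` or `j > t2`. -/
noncomputable def U2 (n : ℕ) (R : Fin n → Fin n → ℝ) (π : Equiv.Perm (Fin n))
    (t1 t2 : ℕ) : ℝ :=
  ∑ i : Fin n, ∑ j : Fin n,
    if ((i : ℕ) < t1 ∨ t2 ≤ (i : ℕ)) ∧ ((j : ℕ) < t1 ∨ t2 ≤ (j : ℕ)) then R (π i) (π j) else 0

/-- Expectation under the permutation null distribution (uniform over all `n!`
permutations). -/
noncomputable def pexp (n : ℕ) (f : Equiv.Perm (Fin n) → ℝ) : ℝ :=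
  (∑ π : Equiv.Perm (Fin n), f π) / (Nat.factorial n)

/-- Variance under the permutation null distribution. -/
noncomputable def pvar (n : ℕ) (f : Equiv.Perm (Fin n) → ℝ) : ℝ :=
  pexp n (fun π => (f π - pexp n f) ^ 2)

/-- Covariance under the permutation null distribution. -/
noncomputable def pcov (n : ℕ) (f g : Equiv.Perm (Fin n) → ℝ) : ℝ :=
  pexp n (fun π => (f π - pexp n f) * (g π - pexp n g))

/-- `R̄_{i·} = (Σ_j R_{ij})/(n-1)`. -/
noncomputable def Rbar (n : ℕ) (R : Fin n → Fin n → ℝ) (i : Fin n) : ℝ :=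
  (∑ j : Fin n, R i j) / ((n : ℝ) - 1)

/-- `r0 = (1/n) Σ_i R̄_{i·}`. -/
noncomputable def r0 (n : ℕ) (R : Fin n → Fin n → ℝ) : ℝ :=
  (∑ i : Fin n, Rbar n R i) / n

/-- `r1² = (1/n) Σ_i R̄_{i·}²`. -/
noncomputable def r1sq (n : ℕ) (R : Fin n → Fin n → ℝ) : ℝ :=
  (∑ i : Fin n, (Rbar n R i) ^ 2) / n

/-- `r_d² = (1/(n(n-1))) Σ_i Σ_j R_{ij}²`. -/
noncomputable def rdsq (n : ℕ) (R : Fin n → Fin n → ℝ) : ℝ :=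
  (∑ i : Fin n, ∑ j : Fin n, (R i j) ^ 2) / ((n : ℝ) * ((n : ℝ) - 1))

/-- `U_diff^π = U1^π − U2^π`. -/
noncomputable def Udiff (n : ℕ) (R : Fin n → Fin n → ℝ) (π : Equiv.Perm (Fin n))
    (t1 t2 : ℕ) : ℝ :=
  U1 n R π t1 t2 - U2 n R π t1 t2

/-- `U_w^π = ((n−t2+t1−1)·U1^π + (t2−t1−1)·U2^π)/(n−2)`. -/
noncomputable def Uw (n : ℕ) (R : Fin n → Fin n → ℝ) (π : Equiv.Perm (Fin n))
    (t1 t2 : ℕ) : ℝ :=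
  (((n : ℝ) - t2 + t1 - 1) * U1 n R π t1 t2 + ((t2 : ℝ) - t1 - 1) * U2 n R π t1 t2) /
    ((n : ℝ) - 2)

/-- Standardized `Z_w^π(t1,t2)`. -/
noncomputable def Zw (n : ℕ) (R : Fin n → Fin n → ℝ) (π : Equiv.Perm (Fin n))
    (t1 t2 : ℕ) : ℝ :=
  (Uw n R π t1 t2 - pexp n (fun σ => Uw n R σ t1 t2)) /
    Real.sqrt (pvar n (fun σ => Uw n R σ t1 t2))

/-- Standardized `Z_diff^π(t1,t2)`. -/
noncomputable def Zdiff (n : ℕ) (R : Fin n → Fin n → ℝ) (π : Equiv.Perm (Fin n))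
    (t1 t2 : ℕ) : ℝ :=
  (Udiff n R π t1 t2 - pexp n (fun σ => Udiff n R σ t1 t2)) /
    Real.sqrt (pvar n (fun σ => Udiff n R σ t1 t2))

/-- Discrete σ-algebra on the finite permutation group. -/
instance (n : ℕ) : MeasurableSpace (Equiv.Perm (Fin n)) := ⊤

/-- The permutation null distribution: the uniform probability measure on the
`n!` permutations of `{1,…,n}`. -/
noncomputable def permP (n : ℕ) : ProbabilityMeasure (Equiv.Perm (Fin n)) :=
  ⟨(PMF.uniformOfFintype (Equiv.Perm (Fin n))).toMeasure,
    PMF.toMeasure.isProbabilityMeasure _⟩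

/-- The distribution of a real-valued statistic under the permutation null
distribution. -/
noncomputable def permDist (n : ℕ) (f : Equiv.Perm (Fin n) → ℝ) : ProbabilityMeasure ℝ :=
  (permP n).map (f := f) (Measurable.aemeasurable (fun _ _ => trivial))

/-- The centered Gaussian distribution on `ℝ` with variance `v` (for `v ≥ 0`). -/
noncomputable def gaussLimit (v : ℝ) : ProbabilityMeasure ℝ :=
  ⟨gaussianReal 0 (Real.toNNReal v), inferInstance⟩

/-- `ρ_w*(u,v) = (u∧v)(1−(u∨v))/((u∨v)(1−(u∧v)))`. -/
noncomputable def rhoW (u v : ℝ) : ℝ :=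
  (min u v * (1 - max u v)) / (max u v * (1 - min u v))

/-- `ρ_diff*(u,v) = (u∧v)(1−(u∨v))/√((u∧v)(1−(u∧v))·(u∨v)(1−(u∨v)))`. -/
noncomputable def rhoDiff (u v : ℝ) : ℝ :=
  (min u v * (1 - max u v)) /
    Real.sqrt (min u v * (1 - min u v) * (max u v * (1 - max u v)))

/-- Condition (C1): `Σ_i (Σ_j R_{ij}²)² = O(n³ r_d⁴)`. -/
def Cond1 (R : (n : ℕ) → Fin n → Fin n → ℝ) : Prop :=
  (fun n => ∑ i : Fin n, (∑ j : Fin n, (R n i j) ^ 2) ^ 2)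
    =O[atTop] fun n => (n : ℝ) ^ 3 * (rdsq n (R n)) ^ 2

/-- Condition (C2): `Σ_i |R̄_{i·} − r0|³ = o((n(r1² − r0²))^{3/2})`. -/
def Cond2 (R : (n : ℕ) → Fin n → Fin n → ℝ) : Prop :=
  (fun n => ∑ i : Fin n, |Rbar n (R n) i - r0 n (R n)| ^ 3)
    =o[atTop] fun n => ((n : ℝ) * (r1sq n (R n) - (r0 n (R n)) ^ 2)) ^ ((3 : ℝ) / 2)

/-- Condition (C3): `Σ_i (R̄_{i·} − r0)³ = o(n·r_d·(r1² − r0²))`. -/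
def Cond3 (R : (n : ℕ) → Fin n → Fin n → ℝ) : Prop :=
  (fun n => ∑ i : Fin n, (Rbar n (R n) i - r0 n (R n)) ^ 3)
    =o[atTop] fun n =>
      (n : ℝ) * Real.sqrt (rdsq n (R n)) * (r1sq n (R n) - (r0 n (R n)) ^ 2)

/-- Condition (C4): `|Σ_{i≠j≠k} R_{ji} R_{ik} (R̄_{j·} − r0)(R̄_{k·} − r0)| =
o(n³ r_d² (r1² − r0²))`. -/
def Cond4 (R : (n : ℕ) → Fin n → Fin n → ℝ) : Prop :=
  (fun n =>
      |∑ i : Fin n, ∑ j : Fin n, ∑ k : Fin n,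
        if i ≠ j ∧ i ≠ k ∧ j ≠ k then
          R n j i * R n i k * (Rbar n (R n) j - r0 n (R n)) * (Rbar n (R n) k - r0 n (R n))
        else 0|)
    =o[atTop] fun n => (n : ℝ) ^ 3 * rdsq n (R n) * (r1sq n (R n) - (r0 n (R n)) ^ 2)

/-- Condition (C5): `Σ_i Σ_j Σ_{k∉{i,j}} Σ_{l∉{i,j}} R_{ij} R_{kl}
(R_{ik} R_{jl} + R_{il} R_{jk}) = o(n⁴ r_d⁴)`. -/
def Cond5 (R : (n : ℕ) → Fin n → Fin n → ℝ) : Prop :=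
  (fun n =>
      ∑ i : Fin n, ∑ j : Fin n, ∑ k : Fin n, ∑ l : Fin n,
        if k ≠ i ∧ k ≠ j ∧ l ≠ i ∧ l ≠ j then
          R n i j * R n k l * (R n i k * R n j l + R n i l * R n j k)
        else 0)
    =o[atTop] fun n => (n : ℝ) ^ 4 * (rdsq n (R n)) ^ 2

/-- Condition (C6): `r1 = o(r_d)`. -/
def Cond6 (R : (n : ℕ) → Fin n → Fin n → ℝ) : Prop :=
  (fun n => Real.sqrt (r1sq n (R n))) =o[atTop] fun n => Real.sqrt (rdsq n (R n))

end RING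

open RING

namespace RING

open scoped BigOperators

set_option linter.unusedSectionVars false

section ProductSpace

open Function

/-- A sum over coordinates in `s` is insensitive to coordinates outside `s`. -/
theorem sum_update_of_notMem {ι κ E : Type*} [DecidableEq ι] [AddCommMonoid E] {s : Finset ι}
    {a : ι} (ha : a ∉ s) (f : ι → κ → E) (c : ι → κ) (x : κ) :
    ∑ b ∈ s, f b (update c a x b) = ∑ b ∈ s, f b (c b) :=
  sum_congr rfl fun b hb => by rw [update_of_ne (ne_of_mem_of_not_mem hb ha)]

variable {ι κ : Type*} [Fintype ι] [DecidableEq ι] [Fintype κ] [Nonempty κ]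

/-- Resampling one coordinate of a uniform random function does not change expectations. -/
theorem expect_resample {E : Type*} [AddCommGroup E] [Module ℚ≥0 E] (a : ι)
    (F : (ι → κ) → E) : 𝔼 c, 𝔼 x, F (update c a x) = 𝔼 c, F c := by
  have h1 : 𝔼 c : ι → κ, 𝔼 x : κ, F (update c a x)
      = 𝔼 p : (ι → κ) × κ, F (update p.1 a p.2) := by
    rw [← univ_product_univ, expect_product]
  have h2 : 𝔼 c : ι → κ, F c = 𝔼 p : (ι → κ) × κ, F p.1 := by
    rw [← univ_product_univ, expect_product]
    simp
  rw [h1, h2]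
  refine Fintype.expect_bijective (fun p : (ι → κ) × κ => (update p.1 a p.2, p.1 a))
    (Function.Involutive.bijective ?_) _ _ (fun p => rfl)
  rintro ⟨c, x⟩
  simp

theorem expect_mul_resample {𝕜 : Type*} [Field 𝕜] [CharZero 𝕜] (a : ι) (G F : (ι → κ) → 𝕜)
    (hG : ∀ c x, G (update c a x) = G c) :
    𝔼 c, G c * F c = 𝔼 c, G c * 𝔼 x, F (update c a x) := by
  rw [← expect_resample a]
  refine expect_congr rfl fun c _ => ?_
  simp only [hG, mul_expect]

theorem expect_mul_eq_zero {𝕜 : Type*} [Field 𝕜] [CharZero 𝕜] (a : ι) (G F : (ι → κ) → 𝕜)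
    (hG : ∀ c x, G (update c a x) = G c) (hF : ∀ c, 𝔼 x, F (update c a x) = 0) :
    𝔼 c, G c * F c = 0 := by
  rw [expect_mul_resample a G F hG]
  simp [hF]

theorem expect_eval (a : ι) (f : κ → ℝ) : 𝔼 c : ι → κ, f (c a) = 𝔼 x, f x := by
  rw [← expect_resample a]
  simp

theorem expect_sum_sq (s : Finset ι) (m : ι → ℝ) {f : κ → ℝ} (hf : 𝔼 x, f x = 0) :
    𝔼 c : ι → κ, (∑ b ∈ s, m b * f (c b)) ^ 2 = (∑ b ∈ s, m b ^ 2) * 𝔼 x, f x ^ 2 := by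
  induction s using Finset.induction_on with
  | empty => simp
  | insert a s ha ih =>
    have h0 : 𝔼 c : ι → κ, (∑ b ∈ s, m b * f (c b)) * (m a * f (c a)) = 0 := by
      refine expect_mul_eq_zero a (fun c => ∑ b ∈ s, m b * f (c b)) (fun c => m a * f (c a)) ?_ ?_
      · exact fun c x => sum_update_of_notMem ha (fun b y => m b * f y) c x
      · intro c
        simp [← mul_expect, hf]
    have h1 : 𝔼 c : ι → κ, f (c a) ^ 2 = 𝔼 x, f x ^ 2 := expect_eval a (fun x => f x ^ 2)
    rw [sum_insert ha, add_mul, ← ih, ← h1, mul_expect, ← expect_add_distrib]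
    have : ∀ c : ι → κ, (∑ b ∈ insert a s, m b * f (c b)) ^ 2
        = (m a ^ 2 * f (c a) ^ 2 + (∑ b ∈ s, m b * f (c b)) ^ 2)
          + 2 * ((∑ b ∈ s, m b * f (c b)) * (m a * f (c a))) := by
      intro c
      rw [sum_insert ha]
      ring
    simp_rw [this]
    rw [expect_add_distrib, ← mul_expect, h0]
    simp

theorem expect_sq_le {f : κ → ℝ} {K : ℝ} (hK : ∀ x, |f x| ≤ K) :
    𝔼 x, f x ^ 2 ≤ K ^ 2 := by
  refine expect_le univ_nonempty fun x _ => ?_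
  rw [← sq_abs]
  exact pow_le_pow_left₀ (abs_nonneg _) (hK x) 2

theorem expect_sum_sq_le (s : Finset ι) (m : ι → ℝ) {f : κ → ℝ} {K : ℝ} (hf : 𝔼 x, f x = 0)
    (hK : ∀ x, |f x| ≤ K) :
    𝔼 c : ι → κ, (∑ b ∈ s, m b * f (c b)) ^ 2 ≤ K ^ 2 * ∑ b ∈ s, m b ^ 2 := by
  rw [expect_sum_sq s m hf, mul_comm]
  exact mul_le_mul_of_nonneg_right (expect_sq_le hK) (sum_nonneg fun _ _ => sq_nonneg _)

/-- Fourth moment bound for a weighted sum of bounded centered independent variables. -/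
theorem expect_sum_pow_four_le (s : Finset ι) (m : ι → ℝ) {f : κ → ℝ} {K : ℝ}
    (hf : 𝔼 x, f x = 0) (hK : ∀ x, |f x| ≤ K) :
    𝔼 c : ι → κ, (∑ b ∈ s, m b * f (c b)) ^ 4 ≤ 4 * K ^ 4 * (∑ b ∈ s, m b ^ 2) ^ 2 := by
  induction s using Finset.induction_on with
  | empty => simp
  | insert a s ha ih =>
    have h0 : 𝔼 c : ι → κ, (∑ b ∈ s, m b * f (c b)) ^ 3 * (m a * f (c a)) = 0 := by
      refine expect_mul_eq_zero a (fun c => (∑ b ∈ s, m b * f (c b)) ^ 3)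
        (fun c => m a * f (c a)) ?_ ?_
      · exact fun c x => by rw [sum_update_of_notMem ha (fun b y => m b * f y) c x]
      · intro c
        simp [← mul_expect, hf]
    have h2 := expect_sum_sq_le s m hf hK
    rw [sum_insert ha]
    set σ := ∑ b ∈ s, m b ^ 2
    have hpt : ∀ c : ι → κ, (∑ b ∈ insert a s, m b * f (c b)) ^ 4
        ≤ ((∑ b ∈ s, m b * f (c b)) ^ 4 + 8 * K ^ 2 * m a ^ 2 * (∑ b ∈ s, m b * f (c b)) ^ 2
          + 3 * K ^ 4 * m a ^ 4) + 4 * ((∑ b ∈ s, m b * f (c b)) ^ 3 * (m a * f (c a))) := by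
      intro c
      rw [sum_insert ha]
      set S := ∑ b ∈ s, m b * f (c b)
      have hf2 : f (c a) ^ 2 ≤ K ^ 2 := by
        rw [← sq_abs]
        exact pow_le_pow_left₀ (abs_nonneg _) (hK _) 2
      have hX : (m a * f (c a)) ^ 2 ≤ K ^ 2 * m a ^ 2 := by
        rw [mul_pow, mul_comm]
        exact mul_le_mul_of_nonneg_right hf2 (sq_nonneg _)
      have hX4 : (m a * f (c a)) ^ 4 ≤ K ^ 4 * m a ^ 4 := by
        have := pow_le_pow_left₀ (sq_nonneg _) hX 2
        calc _ = ((m a * f (c a)) ^ 2) ^ 2 := by ring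
          _ ≤ _ := this
          _ = _ := by ring
      generalize m a * f (c a) = X at *
      have h8 : S ^ 2 * X ^ 2 ≤ S ^ 2 * (K ^ 2 * m a ^ 2) :=
        mul_le_mul_of_nonneg_left hX (sq_nonneg _)
      nlinarith [sq_nonneg (S * X - X ^ 2)]
    calc 𝔼 c : ι → κ, (∑ b ∈ insert a s, m b * f (c b)) ^ 4
        ≤ _ := expect_le_expect fun c _ => hpt c
      _ = 𝔼 c : ι → κ, (∑ b ∈ s, m b * f (c b)) ^ 4
          + 8 * K ^ 2 * m a ^ 2 * 𝔼 c : ι → κ, (∑ b ∈ s, m b * f (c b)) ^ 2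
          + 3 * K ^ 4 * m a ^ 4 := by
        rw [expect_add_distrib, ← mul_expect, h0, expect_add_distrib, expect_add_distrib,
          ← mul_expect, Fintype.expect_const]
        ring
      _ ≤ 4 * K ^ 4 * σ ^ 2 + 8 * K ^ 2 * m a ^ 2 * (K ^ 2 * σ) + 3 * K ^ 4 * m a ^ 4 := by
        gcongr
      _ ≤ _ := by
        have : 0 ≤ K ^ 4 * m a ^ 4 := by positivity
        nlinarith

end ProductSpace

section QuadraticForms

open Function

variable {ι κ : Type*} [Fintype ι]

/-- The quadratic form `∑ M a b * w (c a) (c b)` in the colours `c`. -/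
noncomputable def quad (M : ι → ι → ℝ) (w : κ → κ → ℝ) (c : ι → κ) : ℝ :=
  ∑ a, ∑ b, M a b * w (c a) (c b)

/-- The linear form `∑ β a * γ (c a)` in the colours `c`. -/
noncomputable def lin (β : ι → ℝ) (γ : κ → ℝ) (c : ι → κ) : ℝ :=
  ∑ a, β a * γ (c a)

/-- The part of `quad M w` involving the item `a`, in the role of the row index. -/
noncomputable def row (M : ι → ι → ℝ) (w : κ → κ → ℝ) (a : ι) (c : ι → κ) : ℝ :=
  ∑ b, M a b * w (c a) (c b)

theorem sum_row (M : ι → ι → ℝ) (w : κ → κ → ℝ) (c : ι → κ) : ∑ a, row M w a c = quad M w c :=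
  rfl

variable [DecidableEq ι]

theorem row_update {M : ι → ι → ℝ} (hd : ∀ a, M a a = 0) (w : κ → κ → ℝ) (a : ι) (c : ι → κ)
    (x : κ) : row M w a (update c a x) = ∑ b, M a b * w x (c b) := by
  refine sum_congr rfl fun b _ => ?_
  by_cases h : b = a
  · subst h
    simp [hd]
  · simp [h]

theorem quad_update {M : ι → ι → ℝ} (hs : ∀ a b, M a b = M b a) (hd : ∀ a, M a a = 0)
    {w : κ → κ → ℝ} (hw : ∀ x y, w x y = w y x) (a : ι) (c : ι → κ) (x : κ) :
    quad M w (update c a x) - 2 * row M w a (update c a x) = quad M w c - 2 * row M w a c := by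
  have key : ∀ c : ι → κ, quad M w c - 2 * row M w a c
      = ∑ b, ∑ b', if b = a ∨ b' = a then 0 else M b b' * w (c b) (c b') := by
    intro c
    have h1 : ∑ b, ∑ b', (if b = a then M b b' * w (c b) (c b') else 0) = row M w a c := by
      rw [sum_eq_single a (fun b _ hb => by simp [hb]) (by simp)]
      simp [row]
    have h2 : ∑ b, ∑ b', (if b' = a then M b b' * w (c b) (c b') else 0) = row M w a c := by
      refine sum_congr rfl fun b _ => ?_
      rw [sum_ite_eq' univ a, if_pos (mem_univ _), hs b a, hw]
    rw [two_mul, ← sub_sub, sub_eq_iff_eq_add, sub_eq_iff_eq_add]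
    nth_rewrite 1 [← h1]
    rw [← h2, quad, ← sum_add_distrib, ← sum_add_distrib]
    refine sum_congr rfl fun b _ => ?_
    rw [← sum_add_distrib, ← sum_add_distrib]
    refine sum_congr rfl fun b' _ => ?_
    by_cases hb : b = a <;> by_cases hb' : b' = a <;> simp [hb, hb', hd]
  rw [key, key]
  refine sum_congr rfl fun b _ => sum_congr rfl fun b' _ => ?_
  split_ifs with h
  · rfl
  · push Not at h
    rw [update_of_ne h.1, update_of_ne h.2]

theorem lin_update (β : ι → ℝ) (γ : κ → ℝ) (a : ι) (c : ι → κ) (x : κ) :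
    lin β γ (update c a x) - β a * γ (update c a x a) = lin β γ c - β a * γ (c a) := by
  rw [lin, lin, ← add_sum_erase _ _ (mem_univ a), ← add_sum_erase univ _ (mem_univ a)]
  simp only [add_sub_cancel_left]
  exact sum_update_of_notMem (notMem_erase a univ) (fun b y => β b * γ y) c x

variable [Fintype κ]

theorem expect_row_update {M : ι → ι → ℝ} (hd : ∀ a, M a a = 0) {w : κ → κ → ℝ}
    (hw : ∀ x y, w x y = w y x) (hw0 : ∀ x, 𝔼 y, w x y = 0) (a : ι) (c : ι → κ) :
    𝔼 x, row M w a (update c a x) = 0 := by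
  simp_rw [row_update hd]
  rw [expect_sum_comm]
  refine sum_eq_zero fun b _ => ?_
  simp_rw [hw _ (c b)]
  rw [← mul_expect, hw0, mul_zero]

variable [Nonempty κ]

theorem expect_row_sq {M : ι → ι → ℝ} (hd : ∀ a, M a a = 0) {w : κ → κ → ℝ}
    (hw0 : ∀ x, 𝔼 y, w x y = 0) (a : ι) :
    𝔼 c : ι → κ, row M w a c ^ 2 = (∑ b, M a b ^ 2) * 𝔼 x, 𝔼 y, w x y ^ 2 := by
  rw [← expect_resample a]
  simp_rw [row_update hd]
  rw [expect_comm, mul_expect]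
  exact expect_congr rfl fun x _ => expect_sum_sq univ (M a) (hw0 x)

theorem expect_row_sq_le {M : ι → ι → ℝ} (hd : ∀ a, M a a = 0) {w : κ → κ → ℝ} {K : ℝ}
    (hw0 : ∀ x, 𝔼 y, w x y = 0) (hK : ∀ x y, |w x y| ≤ K) (a : ι) :
    𝔼 c : ι → κ, row M w a c ^ 2 ≤ K ^ 2 * ∑ b, M a b ^ 2 := by
  rw [expect_row_sq hd hw0, mul_comm]
  refine mul_le_mul_of_nonneg_right ?_ (sum_nonneg fun _ _ => sq_nonneg _)
  exact expect_le univ_nonempty fun x _ => expect_sq_le (hK x)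

theorem expect_row_pow_four_le {M : ι → ι → ℝ} (hd : ∀ a, M a a = 0) {w : κ → κ → ℝ} {K : ℝ}
    (hw0 : ∀ x, 𝔼 y, w x y = 0) (hK : ∀ x y, |w x y| ≤ K) (a : ι) :
    𝔼 c : ι → κ, row M w a c ^ 4 ≤ 4 * K ^ 4 * (∑ b, M a b ^ 2) ^ 2 := by
  rw [← expect_resample a]
  simp_rw [row_update hd]
  rw [expect_comm]
  exact expect_le univ_nonempty fun x _ => expect_sum_pow_four_le univ (M a) (hw0 x) (hK x)

theorem expect_quad_sq {M : ι → ι → ℝ} (hs : ∀ a b, M a b = M b a) (hd : ∀ a, M a a = 0)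
    {w : κ → κ → ℝ} (hw : ∀ x y, w x y = w y x) (hw0 : ∀ x, 𝔼 y, w x y = 0) :
    𝔼 c : ι → κ, quad M w c ^ 2 = 2 * (∑ a, ∑ b, M a b ^ 2) * 𝔼 x, 𝔼 y, w x y ^ 2 := by
  have h : ∀ a, 𝔼 c : ι → κ, (quad M w c - 2 * row M w a c) * row M w a c = 0 := fun a =>
    expect_mul_eq_zero a _ (row M w a) (fun c x => quad_update hs hd hw a c x)
      (expect_row_update hd hw hw0 a)
  have h2 : ∀ c : ι → κ, quad M w c ^ 2
      = ∑ a, ((quad M w c - 2 * row M w a c) * row M w a c + 2 * row M w a c ^ 2) := by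
    intro c
    have : ∀ a, (quad M w c - 2 * row M w a c) * row M w a c + 2 * row M w a c ^ 2
      = quad M w c * row M w a c := fun a => by ring
    simp_rw [this]
    rw [← mul_sum, sum_row, sq]
  simp_rw [h2]
  rw [expect_sum_comm, mul_sum, sum_mul]
  refine sum_congr rfl fun a _ => ?_
  rw [expect_add_distrib, h, zero_add, ← mul_expect, expect_row_sq hd hw0, mul_assoc]

end QuadraticForms

section Stein

open Function

theorem norm_exp_mul_I_sub_one_sub_le (x : ℝ) :
    ‖Complex.exp (x * Complex.I) - 1 - x * Complex.I‖ ≤ 3 * x ^ 2 := by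
  have hn : ‖(x : ℂ) * Complex.I‖ = |x| := by simp
  rcases le_or_gt |x| 1 with h | h
  · have := Complex.norm_exp_sub_one_sub_id_le (x := x * Complex.I) (by rw [hn]; exact h)
    rw [hn, sq_abs] at this
    nlinarith [sq_nonneg x]
  · calc ‖Complex.exp (x * Complex.I) - 1 - x * Complex.I‖
        ≤ ‖Complex.exp (x * Complex.I)‖ + ‖(1 : ℂ)‖ + ‖(x : ℂ) * Complex.I‖ :=
          (norm_sub_le _ _).trans (add_le_add_left (norm_sub_le _ _) _)
      _ = 2 + |x| := by rw [Complex.norm_exp_ofReal_mul_I, hn, norm_one]; norm_num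
      _ ≤ 3 * |x| ^ 2 := by nlinarith
      _ = 3 * x ^ 2 := by rw [sq_abs]

theorem norm_exp_mul_I_sub_one_le (x : ℝ) : ‖Complex.exp (x * Complex.I) - 1‖ ≤ |x| := by
  have := Real.norm_exp_I_mul_ofReal_sub_one_le (x := x)
  rwa [mul_comm] at this

/-- Quantitative smallness assumptions on a degenerate quadratic form plus a linear form in
independent uniform colours. -/
structure SmallForm {ι κ : Type*} [Fintype ι] [Fintype κ] (M : ι → ι → ℝ) (w : κ → κ → ℝ)
    (β : ι → ℝ) (γ : κ → ℝ) (K δ : ℝ) : Prop where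
  symm : ∀ a b, M a b = M b a
  diag : ∀ a, M a a = 0
  symm_ker : ∀ x y, w x y = w y x
  expect_ker : ∀ x, 𝔼 y, w x y = 0
  expect_fun : 𝔼 x, γ x = 0
  ker_le : ∀ x y, |w x y| ≤ K
  fun_le : ∀ x, |γ x| ≤ K
  sum_sq_le : ∑ a, β a ^ 2 ≤ 1
  sum_sum_sq_le : ∑ a, ∑ b, M a b ^ 2 ≤ 1
  abs_le : ∀ a, |β a| ≤ δ
  gram_le : ∑ b, ∑ b', (∑ a, M a b * M a b') ^ 2 ≤ δ ^ 4
  pos : 0 < δ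
  le_one : δ ≤ 1

variable {ι κ : Type*} [Fintype ι] [DecidableEq ι] [Fintype κ] [Nonempty κ]
variable {M : ι → ι → ℝ} {w : κ → κ → ℝ} {β : ι → ℝ} {γ : κ → ℝ} {K δ t : ℝ}

theorem SmallForm.sum_sq_row_le (H : SmallForm M w β γ K δ) (a : ι) :
    ∑ b, M a b ^ 2 ≤ δ ^ 2 := by
  have h1 : (∑ b, M a b ^ 2) ^ 2 ≤ ∑ b, ∑ b', (∑ a, M a b * M a b') ^ 2 := by
    calc (∑ b, M a b ^ 2) ^ 2 = (∑ b, M b a * M b a) ^ 2 := by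
          congr 1
          exact sum_congr rfl fun b _ => by rw [H.symm a b, sq]
      _ ≤ ∑ b', (∑ b, M b a * M b b') ^ 2 :=
          single_le_sum (f := fun b' => (∑ b, M b a * M b b') ^ 2) (fun _ _ => sq_nonneg _)
            (mem_univ a)
      _ ≤ _ := single_le_sum (f := fun b' => ∑ b'', (∑ b, M b b' * M b b'') ^ 2)
            (fun _ _ => sum_nonneg fun _ _ => sq_nonneg _) (mem_univ a)
  refine abs_le_of_sq_le_sq' ?_ (sq_nonneg δ) |>.2
  calc _ ≤ _ := h1
    _ ≤ _ := H.gram_le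
    _ = _ := by ring

/-- The summand of `quad M w + lin β γ` at the item `a`. -/
noncomputable def stat (M : ι → ι → ℝ) (w : κ → κ → ℝ) (β : ι → ℝ) (γ : κ → ℝ) (a : ι)
    (c : ι → κ) : ℝ :=
  β a * γ (c a) + row M w a c

/-- The part of `quad M w + lin β γ` that depends on the colour of the item `a`. -/
noncomputable def dpart (M : ι → ι → ℝ) (w : κ → κ → ℝ) (β : ι → ℝ) (γ : κ → ℝ) (a : ι)
    (c : ι → κ) : ℝ :=
  β a * γ (c a) + 2 * row M w a c

theorem sum_stat (c : ι → κ) : ∑ a, stat M w β γ a c = quad M w c + lin β γ c := by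
  simp only [stat, sum_add_distrib, sum_row]
  rw [add_comm, lin]

theorem SmallForm.sub_dpart_update (H : SmallForm M w β γ K δ) (a : ι) (c : ι → κ) (x : κ) :
    quad M w (update c a x) + lin β γ (update c a x) - dpart M w β γ a (update c a x)
      = quad M w c + lin β γ c - dpart M w β γ a c := by
  have h1 := quad_update H.symm H.diag H.symm_ker a c x
  have h2 := lin_update β γ a c x
  simp only [dpart]
  linarith

theorem SmallForm.expect_stat_update (H : SmallForm M w β γ K δ) (a : ι) (c : ι → κ) :
    𝔼 x, stat M w β γ a (update c a x) = 0 := by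
  simp only [stat, update_self]
  rw [expect_add_distrib, ← mul_expect, H.expect_fun,
    expect_row_update H.diag H.symm_ker H.expect_ker, mul_zero, zero_add]

theorem SmallForm.nonneg (H : SmallForm M w β γ K δ) : 0 ≤ K :=
  (abs_nonneg _).trans (H.fun_le (Classical.arbitrary κ))

theorem SmallForm.expect_fun_sq_le (H : SmallForm M w β γ K δ) (a : ι) :
    𝔼 c : ι → κ, (β a * γ (c a)) ^ 2 ≤ K ^ 2 * β a ^ 2 := by
  refine expect_le univ_nonempty fun c _ => ?_
  rw [mul_pow, mul_comm, ← sq_abs (γ _)]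
  exact mul_le_mul_of_nonneg_right (pow_le_pow_left₀ (abs_nonneg _) (H.fun_le _) 2) (sq_nonneg _)

theorem SmallForm.expect_fun_pow_four_le (H : SmallForm M w β γ K δ) (a : ι) :
    𝔼 c : ι → κ, (β a * γ (c a)) ^ 4 ≤ K ^ 4 * (δ ^ 2 * β a ^ 2) := by
  refine expect_le univ_nonempty fun c _ => ?_
  have h1 : β a ^ 2 ≤ δ ^ 2 := by
    rw [← sq_abs]
    exact pow_le_pow_left₀ (abs_nonneg _) (H.abs_le a) 2
  have h2 : γ (c a) ^ 4 ≤ K ^ 4 := by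
    rw [← Even.pow_abs (by decide : Even 4)]
    exact pow_le_pow_left₀ (abs_nonneg _) (H.fun_le _) 4
  calc (β a * γ (c a)) ^ 4 = γ (c a) ^ 4 * (β a ^ 2 * β a ^ 2) := by ring
    _ ≤ K ^ 4 * (δ ^ 2 * β a ^ 2) := by gcongr

theorem SmallForm.expect_dpart_sq_le (H : SmallForm M w β γ K δ) (a : ι) :
    𝔼 c, dpart M w β γ a c ^ 2 ≤ 8 * K ^ 2 * (β a ^ 2 + ∑ b, M a b ^ 2) := by
  calc 𝔼 c, dpart M w β γ a c ^ 2
      ≤ 𝔼 c, (8 * (β a * γ (c a)) ^ 2 + 8 * row M w a c ^ 2) := by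
        refine expect_le_expect fun c _ => ?_
        simp only [dpart]
        nlinarith [sq_nonneg (β a * γ (c a) - 2 * row M w a c), sq_nonneg (β a * γ (c a))]
    _ ≤ 8 * (K ^ 2 * β a ^ 2) + 8 * (K ^ 2 * ∑ b, M a b ^ 2) := by
        rw [expect_add_distrib, ← mul_expect, ← mul_expect]
        have h1 := H.expect_fun_sq_le a
        have h2 := expect_row_sq_le H.diag H.expect_ker H.ker_le a
        linarith
    _ = _ := by ring

theorem SmallForm.expect_mul_sq_le (H : SmallForm M w β γ K δ) (a : ι) :
    𝔼 c, (stat M w β γ a c * dpart M w β γ a c) ^ 2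
      ≤ 128 * K ^ 4 * δ ^ 2 * (β a ^ 2 + ∑ b, M a b ^ 2) := by
  have hm : (∑ b, M a b ^ 2) ^ 2 ≤ δ ^ 2 * ∑ b, M a b ^ 2 := by
    rw [sq]
    exact mul_le_mul_of_nonneg_right (H.sum_sq_row_le a) (sum_nonneg fun _ _ => sq_nonneg _)
  calc 𝔼 c, (stat M w β γ a c * dpart M w β γ a c) ^ 2
      ≤ 𝔼 c, (32 * (β a * γ (c a)) ^ 4 + 32 * row M w a c ^ 4) := by
        refine expect_le_expect fun c _ => ?_
        simp only [dpart, stat]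
        generalize β a * γ (c a) = L
        generalize row M w a c = S
        have h1 : (L + S) ^ 2 ≤ 2 * (L ^ 2 + S ^ 2) := by nlinarith [sq_nonneg (L - S)]
        have h2 : (L + 2 * S) ^ 2 ≤ 8 * (L ^ 2 + S ^ 2) := by
          nlinarith [sq_nonneg (L - 2 * S), sq_nonneg L]
        calc ((L + S) * (L + 2 * S)) ^ 2 = (L + S) ^ 2 * (L + 2 * S) ^ 2 := by ring
          _ ≤ (2 * (L ^ 2 + S ^ 2)) * (8 * (L ^ 2 + S ^ 2)) := by gcongr
          _ ≤ _ := by nlinarith [sq_nonneg (L ^ 2 - S ^ 2)]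
    _ ≤ 32 * (K ^ 4 * (δ ^ 2 * β a ^ 2)) + 32 * (4 * K ^ 4 * (∑ b, M a b ^ 2) ^ 2) := by
        rw [expect_add_distrib, ← mul_expect, ← mul_expect]
        have h1 := H.expect_fun_pow_four_le a
        have h2 := expect_row_pow_four_le H.diag H.expect_ker H.ker_le a
        linarith
    _ ≤ 32 * (4 * K ^ 4 * (δ ^ 2 * β a ^ 2)) + 32 * (4 * K ^ 4 * (δ ^ 2 * ∑ b, M a b ^ 2)) := by
        have : 0 ≤ K ^ 4 * (δ ^ 2 * β a ^ 2) := by positivity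
        have : 0 ≤ K ^ 4 * ((∑ b, M a b ^ 2) ^ 2) := by positivity
        have := mul_le_mul_of_nonneg_left hm (by positivity : 0 ≤ K ^ 4)
        linarith
    _ = _ := by ring

/-- The conditional covariance of `stat` and `dpart` over the colour of the item `a`. -/
noncomputable def condCov (M : ι → ι → ℝ) (w : κ → κ → ℝ) (β : ι → ℝ) (γ : κ → ℝ) (a : ι)
    (c : ι → κ) : ℝ :=
  𝔼 x, stat M w β γ a (update c a x) * dpart M w β γ a (update c a x)

theorem SmallForm.expect_condCov_sq_le (H : SmallForm M w β γ K δ) (a : ι) :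
    𝔼 c, condCov M w β γ a c ^ 2 ≤ 128 * K ^ 4 * δ ^ 2 * (β a ^ 2 + ∑ b, M a b ^ 2) := by
  refine le_trans ?_ (H.expect_mul_sq_le a)
  rw [← expect_resample a (fun c => (stat M w β γ a c * dpart M w β γ a c) ^ 2)]
  refine expect_le_expect fun c _ => ?_
  have := expect_mul_sq_le_sq_mul_sq univ (fun _ : κ => (1 : ℝ))
    (fun x => stat M w β γ a (update c a x) * dpart M w β γ a (update c a x))
  simpa [condCov, Fintype.expect_const] using this

/-- If `F` and `D` have small second moments then so does `|F| * |D|` have a small mean. -/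
theorem expect_abs_mul_abs_le {Ω : Type*} [Fintype Ω] (F D : Ω → ℝ) {A B τ : ℝ} (hδ : 0 < δ)
    (hD : 𝔼 c, D c ^ 2 ≤ A * τ) (hF : 𝔼 c, F c ^ 2 ≤ B * δ ^ 2 * τ) :
    𝔼 c, |F c| * |D c| ≤ (A + B) / 2 * (δ * τ) := by
  calc 𝔼 c, |F c| * |D c| ≤ 𝔼 c, (δ / 2 * D c ^ 2 + 1 / (2 * δ) * F c ^ 2) := by
        refine expect_le_expect fun c _ => ?_
        have : δ / 2 * D c ^ 2 + 1 / (2 * δ) * F c ^ 2 - |F c| * |D c|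
            = (δ * |D c| - |F c|) ^ 2 / (2 * δ) := by
          rw [← sq_abs (D c), ← sq_abs (F c)]
          field_simp
          ring
        have h2 : 0 ≤ (δ * |D c| - |F c|) ^ 2 / (2 * δ) := by positivity
        linarith
    _ = δ / 2 * 𝔼 c, D c ^ 2 + 1 / (2 * δ) * 𝔼 c, F c ^ 2 := by
        rw [expect_add_distrib, ← mul_expect, ← mul_expect]
    _ ≤ δ / 2 * (A * τ) + 1 / (2 * δ) * (B * δ ^ 2 * τ) := by gcongr
    _ = _ := by
        field_simp

theorem SmallForm.norm_expect_stat_sub_le (H : SmallForm M w β γ K δ) (a : ι) (t : ℝ) :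
    ‖𝔼 c : ι → κ, (stat M w β γ a c : ℂ)
          * Complex.exp ((t * (quad M w c + lin β γ c) : ℝ) * Complex.I)
        - t * Complex.I * 𝔼 c : ι → κ, (condCov M w β γ a c : ℂ)
          * Complex.exp ((t * (quad M w c + lin β γ c) : ℝ) * Complex.I)‖
      ≤ t ^ 2 * (4 * (4 * K ^ 2 + 64 * K ^ 4) * (δ * (β a ^ 2 + ∑ b, M a b ^ 2))) := by
  set T : (ι → κ) → ℝ := fun c => quad M w c + lin β γ c with hT
  set Y := stat M w β γ a with hY
  set D := dpart M w β γ a with hD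
  set V := condCov M w β γ a with hV
  set e : (ι → κ) → ℂ := fun c => Complex.exp ((t * (T c - D c) : ℝ) * Complex.I) with he
  have hinv : ∀ c x, e (update c a x) = e c := fun c x => by
    simp only [he, hT, hD, H.sub_dpart_update a c x]
  have hfac : ∀ c, Complex.exp ((t * T c : ℝ) * Complex.I)
      = e c * Complex.exp ((t * D c : ℝ) * Complex.I) := by
    intro c
    rw [he, ← Complex.exp_add]
    congr 1
    push_cast
    ring
  have hnorm : ∀ c, ‖e c‖ = 1 := fun c => Complex.norm_exp_ofReal_mul_I _
  have hY0 : 𝔼 c, e c * (Y c : ℂ) = 0 := by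
    refine expect_mul_eq_zero a e (fun c => (Y c : ℂ)) hinv fun c => ?_
    have := H.expect_stat_update a c
    rw [← Complex.ofReal_expect, this, Complex.ofReal_zero]
  have hYD : 𝔼 c, e c * ((Y c * D c : ℝ) : ℂ) = 𝔼 c, e c * (V c : ℂ) := by
    rw [expect_mul_resample a e _ hinv]
    refine expect_congr rfl fun c _ => ?_
    rw [← Complex.ofReal_expect]
    rfl
  have hdec : 𝔼 c, (Y c : ℂ) * Complex.exp ((t * T c : ℝ) * Complex.I)
        - t * Complex.I * 𝔼 c, (V c : ℂ) * Complex.exp ((t * T c : ℝ) * Complex.I)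
      = 𝔼 c, (e c * Y c * (Complex.exp ((t * D c : ℝ) * Complex.I) - 1
            - (t * D c : ℝ) * Complex.I)
          - t * Complex.I * (e c * V c * (Complex.exp ((t * D c : ℝ) * Complex.I) - 1))) := by
    have h1 : 𝔼 c, (e c * Y c * (Complex.exp ((t * D c : ℝ) * Complex.I) - 1
            - (t * D c : ℝ) * Complex.I)
          - t * Complex.I * (e c * V c * (Complex.exp ((t * D c : ℝ) * Complex.I) - 1)))
        = 𝔼 c, ((Y c : ℂ) * Complex.exp ((t * T c : ℝ) * Complex.I)
          - t * Complex.I * ((V c : ℂ) * Complex.exp ((t * T c : ℝ) * Complex.I))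
          - e c * Y c - t * Complex.I * (e c * ((Y c * D c : ℝ) : ℂ))
          + t * Complex.I * (e c * (V c : ℂ))) := by
      refine expect_congr rfl fun c _ => ?_
      rw [hfac]
      push_cast
      ring
    rw [h1, expect_add_distrib, expect_sub_distrib, expect_sub_distrib, expect_sub_distrib,
      ← mul_expect, ← mul_expect, ← mul_expect, hY0, hYD]
    ring
  have hb1 := expect_abs_mul_abs_le (fun c => Y c * D c) D H.pos (H.expect_dpart_sq_le a)
    (H.expect_mul_sq_le a)
  have hb2 := expect_abs_mul_abs_le V D H.pos (H.expect_dpart_sq_le a)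
    (H.expect_condCov_sq_le a)
  rw [hdec]
  refine (RCLike.norm_expect_le (K := ℂ)).trans ?_
  calc _ ≤ 𝔼 c, (3 * t ^ 2 * (|Y c * D c| * |D c|) + t ^ 2 * (|V c| * |D c|)) := by
        refine expect_le_expect fun c _ => (norm_sub_le _ _).trans (add_le_add ?_ ?_)
        · rw [norm_mul, norm_mul, hnorm, one_mul, Complex.norm_real, Real.norm_eq_abs]
          calc |Y c| * _ ≤ |Y c| * (3 * (t * D c) ^ 2) :=
                mul_le_mul_of_nonneg_left (norm_exp_mul_I_sub_one_sub_le _) (abs_nonneg _)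
            _ = 3 * t ^ 2 * (|Y c * D c| * |D c|) := by
                rw [abs_mul, mul_pow, ← sq_abs (D c)]
                ring
        · rw [norm_mul, norm_mul, norm_mul, norm_mul, hnorm, one_mul, Complex.norm_real,
            Complex.norm_real, Complex.norm_I, mul_one, Real.norm_eq_abs, Real.norm_eq_abs]
          calc |t| * (|V c| * _) ≤ |t| * (|V c| * |t * D c|) := by
                gcongr
                exact norm_exp_mul_I_sub_one_le _
            _ = t ^ 2 * (|V c| * |D c|) := by
                rw [abs_mul, ← sq_abs t]
                ring
    _ = 3 * t ^ 2 * 𝔼 c, |Y c * D c| * |D c| + t ^ 2 * 𝔼 c, |V c| * |D c| := by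
        rw [expect_add_distrib, ← mul_expect, ← mul_expect]
    _ ≤ 3 * t ^ 2 * ((8 * K ^ 2 + 128 * K ^ 4) / 2 * (δ * (β a ^ 2 + ∑ b, M a b ^ 2)))
        + t ^ 2 * ((8 * K ^ 2 + 128 * K ^ 4) / 2 * (δ * (β a ^ 2 + ∑ b, M a b ^ 2))) := by
        gcongr
    _ = _ := by ring

/-- The variance of `quad M w + lin β γ`. -/
noncomputable def formVar (M : ι → ι → ℝ) (w : κ → κ → ℝ) (β : ι → ℝ) (γ : κ → ℝ) : ℝ :=
  (∑ a, β a ^ 2) * 𝔼 x, γ x ^ 2 + 2 * (∑ a, ∑ b, M a b ^ 2) * 𝔼 x, 𝔼 y, w x y ^ 2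

/-- The composition of the kernel `w` with itself. -/
noncomputable def kerSq (w : κ → κ → ℝ) (y z : κ) : ℝ := 𝔼 x, w x y * w x z

/-- The Gram matrix of the columns of `M`. -/
def gram (M : ι → ι → ℝ) (b b' : ι) : ℝ := ∑ a, M a b * M a b'

/-- The off-diagonal part of a matrix. -/
def offDiagPart (N : ι → ι → ℝ) (b b' : ι) : ℝ := if b = b' then 0 else N b b'

theorem quad_eq_offDiagPart_add (N : ι → ι → ℝ) (v : κ → κ → ℝ) (c : ι → κ) :
    quad N v c = quad (offDiagPart N) v c + lin (fun b => N b b) (fun y => v y y) c := by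
  rw [quad, quad, lin, ← sum_add_distrib]
  refine sum_congr rfl fun b _ => ?_
  have : N b b * v (c b) (c b) = ∑ b', if b = b' then N b b' * v (c b) (c b') else 0 := by
    simp
  rw [this, ← sum_add_distrib]
  refine sum_congr rfl fun b' _ => ?_
  by_cases h : b = b' <;> simp [offDiagPart, h]

theorem SmallForm.condCov_eq (H : SmallForm M w β γ K δ) (a : ι) (c : ι → κ) :
    condCov M w β γ a c = β a ^ 2 * 𝔼 x, γ x ^ 2
      + 3 * ∑ b, β a * M a b * 𝔼 x, γ x * w x (c b)
      + 2 * ∑ b, ∑ b', M a b * M a b' * kerSq w (c b) (c b') := by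
  have h : ∀ x, stat M w β γ a (update c a x) * dpart M w β γ a (update c a x)
      = β a ^ 2 * γ x ^ 2 + 3 * ∑ b, β a * M a b * (γ x * w x (c b))
        + 2 * ∑ b, ∑ b', M a b * M a b' * (w x (c b) * w x (c b')) := by
    intro x
    have h1 : ∑ b, ∑ b', M a b * M a b' * (w x (c b) * w x (c b'))
        = (∑ b, M a b * w x (c b)) ^ 2 := by
      rw [sq, sum_mul_sum]
      exact sum_congr rfl fun b _ => sum_congr rfl fun b' _ => by ring
    have h2 : ∑ b, β a * M a b * (γ x * w x (c b)) = β a * γ x * ∑ b, M a b * w x (c b) := by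
      rw [mul_sum]
      exact sum_congr rfl fun b _ => by ring
    rw [h1, h2, stat, dpart, row_update H.diag, update_self]
    ring
  simp only [condCov, h, kerSq]
  rw [expect_add_distrib, expect_add_distrib, ← mul_expect, ← mul_expect, ← mul_expect,
    expect_sum_comm, expect_sum_comm]
  simp only [expect_sum_comm, mul_expect]

theorem expect_expect_sq_eq (w : κ → κ → ℝ) :
    𝔼 y, kerSq w y y = 𝔼 x, 𝔼 y, w x y ^ 2 := by
  simp only [kerSq, ← sq]
  exact expect_comm _ _ _

theorem sum_gram_diag (M : ι → ι → ℝ) : ∑ b, gram M b b = ∑ a, ∑ b, M a b ^ 2 := by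
  simp only [gram, ← sq]
  exact sum_comm

theorem SmallForm.sum_condCov_sub (H : SmallForm M w β γ K δ) (c : ι → κ) :
    ∑ a, condCov M w β γ a c - formVar M w β γ
      = 3 * lin (fun b => ∑ a, β a * M a b) (fun y => 𝔼 x, γ x * w x y) c
        + 2 * lin (fun b => gram M b b) (fun y => kerSq w y y - 𝔼 z, kerSq w z z) c
        + 2 * quad (offDiagPart (gram M)) (kerSq w) c := by
  have h1 : ∑ a, ∑ b, β a * M a b * 𝔼 x, γ x * w x (c b)
      = lin (fun b => ∑ a, β a * M a b) (fun y => 𝔼 x, γ x * w x y) c := by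
    rw [sum_comm, lin]
    exact sum_congr rfl fun b _ => by rw [sum_mul]
  have h2 : ∑ a, ∑ b, ∑ b', M a b * M a b' * kerSq w (c b) (c b')
      = quad (gram M) (kerSq w) c := by
    rw [sum_comm, quad]
    refine sum_congr rfl fun b _ => ?_
    rw [sum_comm]
    exact sum_congr rfl fun b' _ => by rw [gram, sum_mul]
  have h3 : lin (fun b => gram M b b) (fun y => kerSq w y y - 𝔼 z, kerSq w z z) c
      = lin (fun b => gram M b b) (fun y => kerSq w y y) c
        - (∑ a, ∑ b, M a b ^ 2) * 𝔼 x, 𝔼 y, w x y ^ 2 := by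
    simp only [lin, mul_sub, sum_sub_distrib]
    rw [← sum_mul, sum_gram_diag, expect_expect_sq_eq]
  simp only [H.condCov_eq, sum_add_distrib, ← mul_sum]
  rw [h1, h2, h3, quad_eq_offDiagPart_add, formVar, ← sum_mul]
  ring

theorem abs_expect_mul_le {f g : κ → ℝ} (hf : ∀ x, |f x| ≤ K) (hg : ∀ x, |g x| ≤ K) :
    |𝔼 x, f x * g x| ≤ K ^ 2 := by
  refine (abs_expect_le _ _).trans (expect_le univ_nonempty fun x _ => ?_)
  rw [abs_mul, sq]
  exact mul_le_mul (hf x) (hg x) (abs_nonneg _) ((abs_nonneg _).trans (hf x))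

theorem gram_comm (M : ι → ι → ℝ) (b b' : ι) : gram M b b' = gram M b' b :=
  sum_congr rfl fun _ _ => mul_comm _ _

theorem SmallForm.sum_sq_sum_mul_le (H : SmallForm M w β γ K δ) :
    ∑ b, (∑ a, β a * M a b) ^ 2 ≤ δ ^ 2 := by
  have h1 : ∑ b, (∑ a, β a * M a b) ^ 2 = ∑ a, ∑ a', β a * β a' * gram M a a' := by
    calc ∑ b, (∑ a, β a * M a b) ^ 2 = ∑ b, ∑ a, ∑ a', β a * β a' * (M b a * M b a') := by
          refine sum_congr rfl fun b _ => ?_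
          rw [sq, sum_mul_sum]
          refine sum_congr rfl fun a _ => sum_congr rfl fun a' _ => ?_
          rw [H.symm b a, H.symm b a']
          ring
      _ = _ := by
          rw [sum_comm]
          refine sum_congr rfl fun a _ => ?_
          rw [sum_comm]
          exact sum_congr rfl fun a' _ => by rw [gram, mul_sum]
  have h2 : (∑ a, ∑ a', β a * β a' * gram M a a') ^ 2 ≤ δ ^ 4 := by
    calc (∑ a, ∑ a', β a * β a' * gram M a a') ^ 2
        = (∑ p : ι × ι, β p.1 * β p.2 * gram M p.1 p.2) ^ 2 := by rw [Fintype.sum_prod_type]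
      _ ≤ (∑ p : ι × ι, (β p.1 * β p.2) ^ 2) * ∑ p : ι × ι, gram M p.1 p.2 ^ 2 :=
          sum_mul_sq_le_sq_mul_sq _ _ _
      _ = (∑ a, β a ^ 2) ^ 2 * ∑ b, ∑ b', gram M b b' ^ 2 := by
          congr 1
          · rw [Fintype.sum_prod_type, sq (∑ a, β a ^ 2), sum_mul_sum]
            simp only [mul_pow]
          · rw [Fintype.sum_prod_type]
      _ ≤ 1 ^ 2 * δ ^ 4 := by
          have h3 := H.sum_sq_le
          have h4 := H.gram_le
          have h5 : 0 ≤ ∑ a, β a ^ 2 := sum_nonneg fun _ _ => sq_nonneg _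
          exact mul_le_mul (pow_le_pow_left₀ h5 h3 2) h4
            (sum_nonneg fun _ _ => sum_nonneg fun _ _ => sq_nonneg _) (by norm_num)
      _ = δ ^ 4 := by ring
  rw [h1]
  refine abs_le_of_sq_le_sq' ?_ (sq_nonneg δ) |>.2
  calc _ ≤ _ := h2
    _ = _ := by ring

theorem SmallForm.expect_sum_condCov_sub_sq_le (H : SmallForm M w β γ K δ) :
    𝔼 c : ι → κ, (∑ a, condCov M w β γ a c - formVar M w β γ) ^ 2 ≤ 100 * K ^ 4 * δ ^ 2 := by
  have hK := H.nonneg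
  have hδ := H.pos
  have hδ4 : δ ^ 4 ≤ δ ^ 2 := pow_le_pow_of_le_one hδ.le H.le_one (by norm_num)
  have hker : ∀ y z, |kerSq w y z| ≤ K ^ 2 := fun y z =>
    abs_expect_mul_le (fun x => H.ker_le x y) (fun x => H.ker_le x z)
  have hsum : ∑ b, ∑ b', gram M b b' ^ 2 ≤ δ ^ 4 := H.gram_le
  have hker0 : ∀ y, 𝔼 z, kerSq w y z = 0 := by
    intro y
    simp only [kerSq]
    rw [expect_comm]
    simp only [← mul_expect, H.expect_ker, mul_zero, expect_const_zero]
  have e1 : 𝔼 c : ι → κ, lin (fun b => ∑ a, β a * M a b) (fun y => 𝔼 x, γ x * w x y) c ^ 2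
      ≤ K ^ 4 * δ ^ 2 := by
    have h0 : 𝔼 y, 𝔼 x, γ x * w x y = 0 := by
      rw [expect_comm]
      simp only [← mul_expect, H.expect_ker, mul_zero, expect_const_zero]
    refine (expect_sum_sq_le univ _ h0 (K := K ^ 2)
      fun y => abs_expect_mul_le H.fun_le (fun x => H.ker_le x y)).trans ?_
    calc (K ^ 2) ^ 2 * ∑ b, (∑ a, β a * M a b) ^ 2 ≤ (K ^ 2) ^ 2 * δ ^ 2 := by
          gcongr
          exact H.sum_sq_sum_mul_le
      _ = _ := by ring
  have e2 : 𝔼 c : ι → κ, lin (fun b => gram M b b) (fun y => kerSq w y y - 𝔼 z, kerSq w z z) c ^ 2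
      ≤ 4 * K ^ 4 * δ ^ 2 := by
    have h0 : 𝔼 y, (kerSq w y y - 𝔼 z, kerSq w z z) = 0 := by
      rw [expect_sub_distrib, Fintype.expect_const, sub_self]
    refine (expect_sum_sq_le univ _ h0 (K := 2 * K ^ 2) fun y => ?_).trans ?_
    · have h1 := hker y y
      have h2 : |𝔼 z, kerSq w z z| ≤ K ^ 2 :=
        (abs_expect_le _ _).trans (expect_le univ_nonempty fun z _ => hker z z)
      exact (abs_sub _ _).trans (by linarith)
    · have h3 : ∑ b, gram M b b ^ 2 ≤ δ ^ 2 := by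
        refine le_trans (sum_le_sum fun b _ => ?_) (hsum.trans hδ4)
        exact single_le_sum (f := fun b' => gram M b b' ^ 2) (fun _ _ => sq_nonneg _) (mem_univ b)
      calc (2 * K ^ 2) ^ 2 * ∑ b, gram M b b ^ 2 ≤ (2 * K ^ 2) ^ 2 * δ ^ 2 := by gcongr
        _ = _ := by ring
  have e3 : 𝔼 c : ι → κ, quad (offDiagPart (gram M)) (kerSq w) c ^ 2 ≤ 2 * K ^ 4 * δ ^ 2 := by
    rw [expect_quad_sq (fun a b => by simp only [offDiagPart, eq_comm (a := a), gram_comm M a b])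
      (fun a => by simp [offDiagPart])
      (fun x y => by simp only [kerSq, mul_comm]) hker0]
    have h1 : ∑ a, ∑ b, offDiagPart (gram M) a b ^ 2 ≤ δ ^ 2 := by
      refine le_trans (sum_le_sum fun a _ => sum_le_sum fun b _ => ?_) (hsum.trans hδ4)
      by_cases h : a = b <;> simp [offDiagPart, h, sq_nonneg]
    have h2 : 𝔼 x, 𝔼 y, kerSq w x y ^ 2 ≤ (K ^ 2) ^ 2 :=
      expect_le univ_nonempty fun x _ => expect_sq_le (hker x)
    have h3 : 0 ≤ 𝔼 x, 𝔼 y, kerSq w x y ^ 2 := by positivity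
    calc _ ≤ 2 * δ ^ 2 * (K ^ 2) ^ 2 := by gcongr
      _ = _ := by ring
  calc 𝔼 c : ι → κ, (∑ a, condCov M w β γ a c - formVar M w β γ) ^ 2
      ≤ 𝔼 c : ι → κ,
        (27 * lin (fun b => ∑ a, β a * M a b) (fun y => 𝔼 x, γ x * w x y) c ^ 2
          + 12 * lin (fun b => gram M b b) (fun y => kerSq w y y - 𝔼 z, kerSq w z z) c ^ 2
          + 12 * quad (offDiagPart (gram M)) (kerSq w) c ^ 2) := by
        refine expect_le_expect fun c _ => ?_
        rw [H.sum_condCov_sub]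
        generalize lin (fun b => ∑ a, β a * M a b) (fun y => 𝔼 x, γ x * w x y) c = A
        generalize lin (fun b => gram M b b) (fun y => kerSq w y y - 𝔼 z, kerSq w z z) c = B
        generalize quad (offDiagPart (gram M)) (kerSq w) c = C
        nlinarith [sq_nonneg (3 * A - 2 * B), sq_nonneg (3 * A - 2 * C), sq_nonneg (2 * B - 2 * C)]
    _ ≤ 27 * (K ^ 4 * δ ^ 2) + 12 * (4 * K ^ 4 * δ ^ 2) + 12 * (2 * K ^ 4 * δ ^ 2) := by
        rw [expect_add_distrib, expect_add_distrib, ← mul_expect, ← mul_expect, ← mul_expect]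
        gcongr
    _ ≤ _ := by
        have : 0 ≤ K ^ 4 * δ ^ 2 := by positivity
        linarith

/-- Approximate differential equation for the characteristic function. -/
theorem SmallForm.norm_deriv_charFun_le (H : SmallForm M w β γ K δ) (t : ℝ) :
    ‖𝔼 c : ι → κ, ((quad M w c + lin β γ c : ℝ) : ℂ)
          * Complex.exp ((t * (quad M w c + lin β γ c) : ℝ) * Complex.I)
        - t * Complex.I * (formVar M w β γ *
          𝔼 c : ι → κ, Complex.exp ((t * (quad M w c + lin β γ c) : ℝ) * Complex.I))‖
      ≤ (1 + 50 * K ^ 2 + 600 * K ^ 4) * (|t| + t ^ 2) * δ := by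
  set e : (ι → κ) → ℂ := fun c =>
    Complex.exp ((t * (quad M w c + lin β γ c) : ℝ) * Complex.I) with he
  have hnorm : ∀ c, ‖e c‖ = 1 := fun c => Complex.norm_exp_ofReal_mul_I _
  have hT : 𝔼 c : ι → κ, ((quad M w c + lin β γ c : ℝ) : ℂ) * e c
      = ∑ a, 𝔼 c : ι → κ, (stat M w β γ a c : ℂ) * e c := by
    rw [← expect_sum_comm]
    refine expect_congr rfl fun c _ => ?_
    rw [← sum_stat, ← sum_mul, Complex.ofReal_sum]
  have hV : 𝔼 c : ι → κ, ((∑ a, condCov M w β γ a c - formVar M w β γ : ℝ) : ℂ) * e c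
      = ∑ a, 𝔼 c : ι → κ, (condCov M w β γ a c : ℂ) * e c
        - formVar M w β γ * 𝔼 c : ι → κ, e c := by
    rw [← expect_sum_comm, mul_expect, ← expect_sub_distrib]
    refine expect_congr rfl fun c _ => ?_
    push_cast
    rw [sub_mul, sum_mul]
  have hVb : ‖𝔼 c : ι → κ, ((∑ a, condCov M w β γ a c - formVar M w β γ : ℝ) : ℂ) * e c‖
      ≤ (1 + 100 * K ^ 4) / 2 * δ := by
    refine (RCLike.norm_expect_le (K := ℂ)).trans ?_
    have h := expect_abs_mul_abs_le
      (fun c : ι → κ => ∑ a, condCov M w β γ a c - formVar M w β γ) (fun _ => 1)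
      (A := 1) (B := 100 * K ^ 4) (τ := 1) H.pos (by simp)
      (by simpa using H.expect_sum_condCov_sub_sq_le)
    rw [mul_one] at h
    refine le_trans (le_of_eq (expect_congr rfl fun c _ => ?_)) h
    rw [norm_mul, hnorm, Complex.norm_real, Real.norm_eq_abs, abs_one]
  have hS : ‖∑ a, (𝔼 c : ι → κ, (stat M w β γ a c : ℂ) * e c
      - t * Complex.I * 𝔼 c : ι → κ, (condCov M w β γ a c : ℂ) * e c)‖
      ≤ t ^ 2 * (4 * (4 * K ^ 2 + 64 * K ^ 4) * (δ * 2)) := by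
    refine (norm_sum_le _ _).trans ((sum_le_sum fun a _ => H.norm_expect_stat_sub_le a t).trans ?_)
    rw [← mul_sum, ← mul_sum, ← mul_sum, sum_add_distrib]
    have h1 := H.sum_sq_le
    have h2 := H.sum_sum_sq_le
    have := H.pos
    gcongr
    linarith
  have hfin : 𝔼 c : ι → κ, ((quad M w c + lin β γ c : ℝ) : ℂ) * e c
        - t * Complex.I * (formVar M w β γ * 𝔼 c : ι → κ, e c)
      = ∑ a, (𝔼 c : ι → κ, (stat M w β γ a c : ℂ) * e c
          - t * Complex.I * 𝔼 c : ι → κ, (condCov M w β γ a c : ℂ) * e c)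
        + t * Complex.I *
          𝔼 c : ι → κ, ((∑ a, condCov M w β γ a c - formVar M w β γ : ℝ) : ℂ) * e c := by
    rw [hT, hV, sum_sub_distrib, ← mul_sum]
    ring
  rw [hfin]
  refine (norm_add_le _ _).trans ?_
  rw [norm_mul, norm_mul, Complex.norm_I, Complex.norm_real, Real.norm_eq_abs, mul_one]
  have hδ := H.pos
  have h3 : 0 ≤ |t| * δ := by positivity
  have h4 : 0 ≤ t ^ 2 * δ := by positivity
  have h5 := mul_le_mul_of_nonneg_left hVb (abs_nonneg t)
  have h6 : 0 ≤ |t| * δ * K ^ 2 := by positivity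
  have h7 : 0 ≤ |t| * δ * K ^ 4 := by positivity
  have h8 : 0 ≤ t ^ 2 * δ * K ^ 2 := by positivity
  have h9 : 0 ≤ t ^ 2 * δ * K ^ 4 := by positivity
  nlinarith

/-- A quantitative central limit theorem for `quad M w + lin β γ`. -/
theorem SmallForm.norm_charFun_sub_le (H : SmallForm M w β γ K δ) (t : ℝ) :
    ‖𝔼 c : ι → κ, Complex.exp ((t * (quad M w c + lin β γ c) : ℝ) * Complex.I)
        - Complex.exp (-(formVar M w β γ * t ^ 2 / 2 : ℝ))‖
      ≤ (1 + 50 * K ^ 2 + 600 * K ^ 4) * (|t| + t ^ 2) * δ * |t| := by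
  set T : (ι → κ) → ℝ := fun c => quad M w c + lin β γ c with hT
  set s := formVar M w β γ with hs
  have hs0 : 0 ≤ s := by
    rw [hs, formVar]
    positivity
  set φ : ℝ → ℂ := fun r => 𝔼 c : ι → κ, Complex.exp ((r * T c : ℝ) * Complex.I) with hφ
  set g : ℝ → ℂ := fun r => φ r * Complex.exp ((s * r ^ 2 / 2 : ℝ)) with hg
  have hφ' : ∀ r, HasDerivAt φ
      (Complex.I * 𝔼 c : ι → κ, (T c : ℂ) * Complex.exp ((r * T c : ℝ) * Complex.I)) r := by
    intro r
    have h1 : ∀ c, HasDerivAt (fun r : ℝ => Complex.exp ((r * T c : ℝ) * Complex.I))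
        (Complex.I * ((T c : ℂ) * Complex.exp ((r * T c : ℝ) * Complex.I))) r := by
      intro c
      have h2 : HasDerivAt (fun r : ℝ => ((r * T c : ℝ) : ℂ) * Complex.I)
          (((1 * T c : ℝ) : ℂ) * Complex.I) r :=
        (((hasDerivAt_id r).mul_const (T c)).ofReal_comp).mul_const Complex.I
      convert h2.cexp using 1
      push_cast
      ring
    have h3 := HasDerivAt.fun_sum (u := (univ : Finset (ι → κ))) (fun c _ => h1 c)
    have h4 := h3.div_const (Fintype.card (ι → κ) : ℂ)
    simp only [hφ, Fintype.expect_eq_sum_div_card]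
    rw [← mul_sum, mul_div_assoc] at h4
    exact h4
  have hg' : ∀ r, HasDerivAt g (Complex.I * (𝔼 c : ι → κ, (T c : ℂ)
        * Complex.exp ((r * T c : ℝ) * Complex.I) - r * Complex.I * (s * φ r))
        * Complex.exp ((s * r ^ 2 / 2 : ℝ))) r := by
    intro r
    have h1 : HasDerivAt (fun r : ℝ => ((s * r ^ 2 / 2 : ℝ) : ℂ)) ((s * r : ℝ) : ℂ) r := by
      apply HasDerivAt.ofReal_comp
      exact (((hasDerivAt_pow 2 r).const_mul s).div_const 2).congr_deriv (by norm_num; ring)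
    refine ((hφ' r).mul h1.cexp).congr_deriv ?_
    push_cast
    linear_combination ((r : ℂ) * (s * φ r) * Complex.exp (s * r ^ 2 / 2)) * Complex.I_sq
  have hb : ∀ r ∈ Set.uIcc 0 t, ‖Complex.I * (𝔼 c : ι → κ, (T c : ℂ)
        * Complex.exp ((r * T c : ℝ) * Complex.I) - r * Complex.I * (s * φ r))
        * Complex.exp ((s * r ^ 2 / 2 : ℝ))‖
      ≤ (1 + 50 * K ^ 2 + 600 * K ^ 4) * (|t| + t ^ 2) * δ * Real.exp (s * t ^ 2 / 2) := by
    intro r hr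
    have hrt : |r| ≤ |t| := by
      have := Set.abs_sub_left_of_mem_uIcc hr
      simpa using this
    have hrt2 : r ^ 2 ≤ t ^ 2 := sq_le_sq.mpr hrt
    have h0 := H.pos
    rw [norm_mul, norm_mul, Complex.norm_I, one_mul, Complex.norm_exp, Complex.ofReal_re]
    refine mul_le_mul ((H.norm_deriv_charFun_le r).trans ?_) ?_ (Real.exp_nonneg _) (by positivity)
    · gcongr
    · gcongr
  have hmv := Convex.norm_image_sub_le_of_norm_hasDerivWithin_le
    (fun r _ => (hg' r).hasDerivWithinAt) hb (convex_uIcc 0 t) Set.left_mem_uIcc Set.right_mem_uIcc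
  have hg0 : g 0 = 1 := by simp [hg, hφ]
  have hfin : φ t - Complex.exp (-(s * t ^ 2 / 2 : ℝ))
      = (g t - g 0) * Complex.exp (-(s * t ^ 2 / 2 : ℝ)) := by
    rw [hg0, hg, sub_mul, mul_assoc, ← Complex.exp_add]
    simp
  rw [hfin, norm_mul, ← Complex.ofReal_neg, Complex.norm_exp, Complex.ofReal_re]
  calc _ ≤ (1 + 50 * K ^ 2 + 600 * K ^ 4) * (|t| + t ^ 2) * δ * Real.exp (s * t ^ 2 / 2)
        * ‖t - 0‖ * Real.exp (-(s * t ^ 2 / 2)) := by gcongr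
    _ = (1 + 50 * K ^ 2 + 600 * K ^ 4) * (|t| + t ^ 2) * δ * |t|
        * (Real.exp (s * t ^ 2 / 2) * Real.exp (-(s * t ^ 2 / 2))) := by
        rw [sub_zero, Real.norm_eq_abs]
        ring
    _ = _ := by rw [← Real.exp_add, add_neg_cancel, Real.exp_zero, mul_one]

end Stein

section PermutationMoments

variable {ι : Type*} [Fintype ι] [DecidableEq ι] {M h : ι → ι → ℝ} {β d : ι → ℝ}

theorem card_sub_mul_eq_neg_sum {f : ι → ℝ} (hf : ∑ i, f i = 0) (S : Finset ι) {l : ι}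
    (hS : ∀ k ∉ S, f k = f l) :
    ((Fintype.card ι : ℝ) - #S) * f l = -∑ k ∈ S, f k := by
  have h1 : ∑ k ∈ Sᶜ, f k = ((Fintype.card ι : ℝ) - #S) * f l := by
    rw [sum_congr rfl fun k hk => hS k (by simpa using hk), sum_const, card_compl, nsmul_eq_mul,
      Nat.cast_sub (card_le_univ S)]
  have h2 := sum_add_sum_compl S f
  linarith

/-- Second moments of a function under a uniform relabelling. -/
noncomputable def permCov (β : ι → ℝ) (i j : ι) : ℝ :=
  𝔼 π : Equiv.Perm ι, β (π i) * β (π j)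

theorem permCov_perm (β : ι → ℝ) (σ : Equiv.Perm ι) (i j : ι) :
    permCov β (σ i) (σ j) = permCov β i j :=
  Fintype.expect_equiv (Equiv.mulRight σ) _ _ fun _ => rfl

theorem permCov_self (β : ι → ℝ) (i : ι) :
    Fintype.card ι * permCov β i i = ∑ j, β j ^ 2 := by
  have h1 : ∀ j, permCov β j j = permCov β i i := fun j => by
    simpa using permCov_perm β (Equiv.swap i j) i i
  have h2 : ∑ j, permCov β j j = ∑ j, β j ^ 2 := by
    have : Nonempty (Equiv.Perm ι) := ⟨1⟩
    simp only [permCov]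
    rw [← expect_sum_comm, expect_congr rfl (t := univ) fun π _ =>
      Equiv.sum_comp π fun j => β j * β j, Fintype.expect_const]
    simp only [sq]
  rw [← h2, sum_congr rfl fun j _ => h1 j]
  simp

theorem sum_permCov (hβ : ∑ i, β i = 0) (i : ι) : ∑ j, permCov β i j = 0 := by
  simp only [permCov]
  rw [← expect_sum_comm]
  simp only [← mul_sum, Equiv.sum_comp, hβ, mul_zero, expect_const_zero]

theorem permCov_of_ne (hβ : ∑ i, β i = 0) {i j : ι} (hij : i ≠ j) :
    ((Fintype.card ι : ℝ) - 1) * permCov β i j = -permCov β i i := by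
  have h1 := card_sub_mul_eq_neg_sum (sum_permCov hβ i) {i} (l := j) fun k hk => by
    have h := permCov_perm β (Equiv.swap j k) i j
    rwa [Equiv.swap_apply_left, Equiv.swap_apply_of_ne_of_ne hij
      (by simpa [eq_comm] using hk)] at h
  simpa using h1

/-- Variance bound for linear permutation statistics. -/
theorem expect_perm_sum_sq_le (hι : 2 ≤ Fintype.card ι) (hβ : ∑ i, β i = 0) (d : ι → ℝ) :
    𝔼 π : Equiv.Perm ι, (∑ i, β (π i) * d i) ^ 2
      ≤ (∑ i, β i ^ 2) * (∑ i, d i ^ 2) / ((Fintype.card ι : ℝ) - 1) := by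
  have hN : (2 : ℝ) ≤ Fintype.card ι := by exact_mod_cast hι
  set N : ℝ := (Fintype.card ι : ℝ)
  set s := (∑ i, β i ^ 2) / N with hs
  have hs0 : 0 ≤ s := by positivity
  have hcov : ∀ i j, permCov β i j
      = s * (N / (N - 1) * (if i = j then 1 else 0) - 1 / (N - 1)) := by
    intro i j
    have h1 : permCov β i i = s := by
      rw [hs, eq_div_iff (by linarith), mul_comm]
      exact permCov_self β i
    have h3 : N - 1 ≠ 0 := by linarith
    by_cases hij : i = j
    · subst hij
      rw [h1, if_pos rfl]
      field_simp
    · have h2 : (N - 1) * permCov β i j = -permCov β i i := permCov_of_ne hβ hij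
      rw [if_neg hij]
      rw [h1] at h2
      field_simp
      linarith
  have e1 : 𝔼 π : Equiv.Perm ι, (∑ i, β (π i) * d i) ^ 2
      = ∑ i, ∑ j, d i * d j * permCov β i j := by
    simp only [permCov, mul_expect]
    simp only [← expect_sum_comm]
    refine expect_congr rfl fun π _ => ?_
    rw [sq, sum_mul_sum]
    refine sum_congr rfl fun i _ => sum_congr rfl fun j _ => by ring
  have e2 : ∑ i, ∑ j, d i * d j * permCov β i j
      = s * (N / (N - 1) * ∑ i, d i ^ 2 - 1 / (N - 1) * (∑ i, d i) ^ 2) := by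
    have : ∀ i j, d i * d j * permCov β i j = s * (N / (N - 1)) * (if i = j then d i * d j else 0)
        - s * (1 / (N - 1)) * (d i * d j) := by
      intro i j
      rw [hcov]
      split_ifs <;> ring
    simp only [this, sum_sub_distrib, ← mul_sum, sum_ite_eq, mem_univ, if_true, ← sum_mul]
    simp only [sq]
    ring
  rw [e1, e2]
  have h1 : 0 ≤ 1 / (N - 1) * (∑ i, d i) ^ 2 :=
    mul_nonneg (one_div_nonneg.2 (by linarith)) (sq_nonneg _)
  calc _ ≤ s * (N / (N - 1) * ∑ i, d i ^ 2) := by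
        gcongr
        linarith
    _ = _ := by
        have : N - 1 ≠ 0 := by linarith
        rw [hs]
        field_simp

/-- Second moments of a matrix under a uniform simultaneous relabelling. -/
noncomputable def permCov₂ (M : ι → ι → ℝ) (i j k l : ι) : ℝ :=
  𝔼 π : Equiv.Perm ι, M (π i) (π j) * M (π k) (π l)

theorem permCov₂_perm (M : ι → ι → ℝ) (σ : Equiv.Perm ι) (i j k l : ι) :
    permCov₂ M (σ i) (σ j) (σ k) (σ l) = permCov₂ M i j k l :=
  Fintype.expect_equiv (Equiv.mulRight σ) _ _ fun _ => rfl

theorem permCov₂_symm_left (hs : ∀ a b, M a b = M b a) (i j k l : ι) :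
    permCov₂ M i j k l = permCov₂ M j i k l := by
  simp only [permCov₂, fun π : Equiv.Perm ι => hs (π i) (π j)]

theorem permCov₂_symm_right (hs : ∀ a b, M a b = M b a) (i j k l : ι) :
    permCov₂ M i j k l = permCov₂ M i j l k := by
  simp only [permCov₂, fun π : Equiv.Perm ι => hs (π k) (π l)]

theorem permCov₂_diag_right (hd : ∀ a, M a a = 0) (i j k : ι) : permCov₂ M i j k k = 0 := by
  simp [permCov₂, hd]

theorem permCov₂_diag_left (hd : ∀ a, M a a = 0) (i k l : ι) : permCov₂ M i i k l = 0 := by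
  simp [permCov₂, hd]

theorem sum_permCov₂ (h0 : ∀ a, ∑ b, M a b = 0) (i j k : ι) : ∑ l, permCov₂ M i j k l = 0 := by
  simp only [permCov₂]
  rw [← expect_sum_comm]
  simp only [← mul_sum, Equiv.sum_comp _ (M _), h0, mul_zero, expect_const_zero]

theorem permCov₂_self (hd : ∀ a, M a a = 0) {i j : ι} (hij : i ≠ j) :
    Fintype.card ι * ((Fintype.card ι : ℝ) - 1) * permCov₂ M i j i j
      = ∑ a, ∑ b, M a b ^ 2 := by
  have hrow : ∀ k, k ≠ i → permCov₂ M i k i k = permCov₂ M i j i j := fun k hk => by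
    have h := permCov₂_perm M (Equiv.swap j k) i j i j
    rwa [Equiv.swap_apply_left, Equiv.swap_apply_of_ne_of_ne hij hk.symm] at h
  have hsum : ∑ k, permCov₂ M i k i k = ((Fintype.card ι : ℝ) - 1) * permCov₂ M i j i j := by
    rw [← add_sum_erase _ _ (mem_univ i), permCov₂_diag_left hd, zero_add,
      sum_congr rfl fun k hk => hrow k (ne_of_mem_erase hk), sum_const, nsmul_eq_mul,
      card_erase_of_mem (mem_univ i), card_univ, Nat.cast_sub (Fintype.card_pos_iff.2 ⟨i⟩),
      Nat.cast_one]
  have hall : ∀ k, ∑ l, permCov₂ M k l k l = ∑ l, permCov₂ M i l i l := fun k => by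
    rw [← Equiv.sum_comp (Equiv.swap i k)]
    refine sum_congr rfl fun l _ => ?_
    have h := permCov₂_perm M (Equiv.swap i k) i l i l
    rwa [Equiv.swap_apply_left] at h
  have htot : ∑ k, ∑ l, permCov₂ M k l k l = ∑ a, ∑ b, M a b ^ 2 := by
    have : Nonempty (Equiv.Perm ι) := ⟨1⟩
    simp only [permCov₂, ← expect_sum_comm, ← sq]
    rw [expect_congr rfl (t := univ) fun π _ => (sum_congr rfl fun a _ =>
      Equiv.sum_comp π fun b => M (π a) b ^ 2).trans
      (Equiv.sum_comp π fun a => ∑ b, M a b ^ 2), Fintype.expect_const]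
  rw [← htot, sum_congr rfl fun k _ => hall k, hsum]
  simp [mul_assoc]

theorem permCov₂_share (hd : ∀ a, M a a = 0) (h0 : ∀ a, ∑ b, M a b = 0)
    {i j k : ι} (hij : i ≠ j) (hik : i ≠ k) (hjk : j ≠ k) :
    ((Fintype.card ι : ℝ) - 2) * permCov₂ M i j i k = -permCov₂ M i j i j := by
  have h1 := card_sub_mul_eq_neg_sum (sum_permCov₂ h0 i j i) {i, j} (l := k) fun x hx => by
    rw [mem_insert, mem_singleton, not_or] at hx
    have h := permCov₂_perm M (Equiv.swap k x) i j i k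
    rwa [Equiv.swap_apply_left, Equiv.swap_apply_of_ne_of_ne hik (Ne.symm hx.1),
      Equiv.swap_apply_of_ne_of_ne hjk (Ne.symm hx.2)] at h
  rw [sum_pair hij, permCov₂_diag_right hd, card_pair hij] at h1
  simpa using h1

theorem permCov₂_disjoint (hs : ∀ a b, M a b = M b a) (hd : ∀ a, M a a = 0)
    (h0 : ∀ a, ∑ b, M a b = 0)
    {i j k l : ι} (hij : i ≠ j) (hik : i ≠ k) (hil : i ≠ l) (hjk : j ≠ k) (hjl : j ≠ l)
    (hkl : k ≠ l) :
    ((Fintype.card ι : ℝ) - 3) * permCov₂ M i j k l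
      = -(permCov₂ M i j i k + permCov₂ M j i j k) := by
  have h1 := card_sub_mul_eq_neg_sum (sum_permCov₂ h0 i j k) {i, j, k} (l := l) fun x hx => by
    rw [mem_insert, mem_insert, mem_singleton, not_or, not_or] at hx
    have h := permCov₂_perm M (Equiv.swap l x) i j k l
    rwa [Equiv.swap_apply_left, Equiv.swap_apply_of_ne_of_ne hil (Ne.symm hx.1),
      Equiv.swap_apply_of_ne_of_ne hjl (Ne.symm hx.2.1),
      Equiv.swap_apply_of_ne_of_ne hkl (Ne.symm hx.2.2)] at h
  rw [sum_insert (by simp [hij, hik]), sum_pair hjk, permCov₂_diag_right hd,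
    card_eq_three.2 ⟨i, j, k, hij, hik, hjk, rfl⟩, permCov₂_symm_right hs i j k i,
    permCov₂_symm_right hs i j k j, permCov₂_symm_left hs i j j k, add_zero] at h1
  simpa using h1

theorem permCov₂_eq (hι : 4 ≤ Fintype.card ι) (hs : ∀ a b, M a b = M b a) (hd : ∀ a, M a a = 0)
    (h0 : ∀ a, ∑ b, M a b = 0) {i j k l : ι} (hij : i ≠ j) (hkl : k ≠ l) {N : ℝ}
    (hN : N = Fintype.card ι) :
    permCov₂ M i j k l = (∑ a, ∑ b, M a b ^ 2) / (N * (N - 1) * ((N - 2) * (N - 3))) *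
      ((N - 1) * (N - 2) * ((if k = i then 1 else 0) * (if l = j then 1 else 0)
          + (if k = j then 1 else 0) * (if l = i then 1 else 0))
        - (N - 1) * ((if k = i then 1 else 0) + (if k = j then 1 else 0)
          + (if l = i then 1 else 0) + (if l = j then 1 else 0)) + 2) := by
  have hN4 : 4 ≤ N := by rw [hN]; exact_mod_cast hι
  have n0 : N ≠ 0 := by linarith
  have n1 : N - 1 ≠ 0 := by linarith
  have n2 : N - 2 ≠ 0 := by linarith
  have n3 : N - 3 ≠ 0 := by linarith
  set s := ∑ a, ∑ b, M a b ^ 2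
  have hself : ∀ {i j}, i ≠ j → permCov₂ M i j i j = s / (N * (N - 1)) := fun {i j} h => by
    rw [eq_div_iff (mul_ne_zero n0 n1), mul_comm, hN]
    exact permCov₂_self hd h
  have hshare : ∀ {i j k}, i ≠ j → i ≠ k → j ≠ k →
      permCov₂ M i j i k = -s / (N * (N - 1) * (N - 2)) := fun {i j k} h1 h2 h3 => by
    have h := permCov₂_share hd h0 h1 h2 h3
    rw [hself h1, ← hN] at h
    field_simp at h ⊢
    linarith
  have hdisj : i ≠ k → i ≠ l → j ≠ k → j ≠ l →
      permCov₂ M i j k l = 2 * s / (N * (N - 1) * (N - 2) * (N - 3)) := fun h1 h2 h3 h4 => by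
    have h := permCov₂_disjoint hs hd h0 hij h1 h2 h3 h4 hkl
    rw [hshare hij h1 h3, hshare hij.symm h3 h1, ← hN] at h
    field_simp at h ⊢
    linarith
  by_cases hki : k = i
  · subst hki
    by_cases hlj : l = j
    · subst hlj
      rw [hself hij]
      simp [hij, hij.symm]
      field_simp
      ring
    · rw [hshare hij hkl (Ne.symm hlj)]
      simp [hij, hlj, hkl.symm]
      field_simp
      ring
  by_cases hkj : k = j
  · subst hkj
    rw [permCov₂_symm_left hs]
    by_cases hli : l = i
    · subst hli
      rw [hself hkl]
      simp [hkl, hkl.symm]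
      field_simp
      ring
    · rw [hshare hij.symm hkl (Ne.symm hli)]
      simp [hli, hkl.symm, hij.symm]
      field_simp
      ring
  by_cases hli : l = i
  · subst hli
    rw [permCov₂_symm_right hs, hshare hij (Ne.symm hki) (Ne.symm hkj)]
    simp [hki, hkj, hij]
    field_simp
    ring
  by_cases hlj : l = j
  · subst hlj
    rw [permCov₂_symm_right hs, permCov₂_symm_left hs, hshare hij.symm (Ne.symm hkj) (Ne.symm hki)]
    simp [hki, hkj, hij.symm]
    field_simp
    ring
  rw [hdisj (Ne.symm hki) (Ne.symm hli) (Ne.symm hkj) (Ne.symm hlj)]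
  simp [hki, hkj, hli, hlj]
  field_simp

/-- Variance bound for doubly indexed permutation statistics. -/
theorem expect_perm_sum_sum_sq_le (hι : 4 ≤ Fintype.card ι) (hs : ∀ a b, M a b = M b a)
    (hd : ∀ a, M a a = 0) (h0 : ∀ a, ∑ b, M a b = 0) (hh : ∀ i j, h i j = h j i)
    (hhd : ∀ i, h i i = 0) :
    𝔼 π : Equiv.Perm ι, (∑ i, ∑ j, M (π i) (π j) * h i j) ^ 2
      ≤ 2 * (∑ a, ∑ b, M a b ^ 2) * (∑ i, ∑ j, h i j ^ 2) /
        (Fintype.card ι * ((Fintype.card ι : ℝ) - 3)) := by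
  obtain ⟨N, hN⟩ : ∃ N : ℝ, N = Fintype.card ι := ⟨_, rfl⟩
  have hN4 : 4 ≤ N := by rw [hN]; exact_mod_cast hι
  have e1 : 𝔼 π : Equiv.Perm ι, (∑ i, ∑ j, M (π i) (π j) * h i j) ^ 2
      = ∑ i, ∑ j, ∑ k, ∑ l, h i j * h k l * permCov₂ M i j k l := by
    simp only [permCov₂, mul_expect]
    simp only [← expect_sum_comm]
    refine expect_congr rfl fun π _ => ?_
    rw [sq, sum_mul]
    refine sum_congr rfl fun i _ => ?_
    rw [sum_mul]
    refine sum_congr rfl fun j _ => ?_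
    rw [mul_sum]
    refine sum_congr rfl fun k _ => ?_
    rw [mul_sum]
    exact sum_congr rfl fun l _ => by ring
  set s := ∑ a, ∑ b, M a b ^ 2 with hsdef
  set D := s / (N * (N - 1) * ((N - 2) * (N - 3))) with hD
  have hs0 : 0 ≤ s := sum_nonneg fun _ _ => sum_nonneg fun _ _ => sq_nonneg _
  have hD0 : 0 ≤ D := div_nonneg hs0 (mul_nonneg (mul_nonneg (by linarith) (by linarith))
    (mul_nonneg (by linarith) (by linarith)))
  have hterm : ∀ i j k l, h i j * h k l * permCov₂ M i j k l
      = D * ((N - 1) * (N - 2)) * (if k = i then (if l = j then h i j * h k l else 0) else 0)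
        + D * ((N - 1) * (N - 2)) * (if k = j then (if l = i then h i j * h k l else 0) else 0)
        - D * (N - 1) * (if k = i then h i j * h k l else 0)
        - D * (N - 1) * (if k = j then h i j * h k l else 0)
        - D * (N - 1) * (if l = i then h i j * h k l else 0)
        - D * (N - 1) * (if l = j then h i j * h k l else 0)
        + 2 * D * (h i j * h k l) := by
    intro i j k l
    by_cases hij : i = j
    · subst hij
      simp [hhd]
    by_cases hkl : k = l
    · subst hkl
      simp [hhd]
    rw [permCov₂_eq hι hs hd h0 hij hkl hN, ← hsdef, ← hD]
    split_ifs <;> ring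
  set r : ι → ℝ := fun i => ∑ j, h i j with hr
  have hr' : ∀ i, ∑ j, h j i = r i := fun i => sum_congr rfl fun j _ => hh j i
  have e2 : ∑ i, ∑ j, ∑ k, ∑ l, h i j * h k l * permCov₂ M i j k l
      = D * ((N - 1) * (N - 2)) * (2 * ∑ i, ∑ j, h i j ^ 2) - D * (N - 1) * (4 * ∑ i, r i ^ 2)
        + 2 * D * (∑ i, r i) ^ 2 := by
    have c : ∑ i, ∑ j, h i j * r j = ∑ i, r i ^ 2 := by
      rw [sum_comm]
      simp only [← sum_mul, hr', sq]
    have c1 : ∑ i, ∑ j, h i j * r i = ∑ i, r i ^ 2 := by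
      simp only [← sum_mul, sq, hr]
    have c2 : ∑ i, ∑ j, h i j * h j i = ∑ i, ∑ j, h i j ^ 2 :=
      sum_congr rfl fun i _ => sum_congr rfl fun j _ => by rw [hh j i, sq]
    have c3 : ∑ i, ∑ j, h i j * ∑ k, ∑ l, h k l = (∑ i, r i) ^ 2 := by
      simp only [← sum_mul, sq, hr]
    simp only [hterm, sum_add_distrib, sum_sub_distrib, ← mul_sum]
    have d1 : ∀ i j, ∑ k, ∑ l, (if k = i then h i j * h k l else 0) = h i j * r i := fun i j => by
      rw [sum_comm]; simp [← mul_sum, hr]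
    have d2 : ∀ i j, ∑ k, ∑ l, (if k = j then h i j * h k l else 0) = h i j * r j := fun i j => by
      rw [sum_comm]; simp [← mul_sum, hr]
    have d3 : ∀ i j, ∑ k, ∑ l, (if l = i then h i j * h k l else 0) = h i j * r i := fun i j => by
      simp [← mul_sum, hr']
    have d4 : ∀ i j, ∑ k, ∑ l, (if l = j then h i j * h k l else 0) = h i j * r j := fun i j => by
      simp [← mul_sum, hr']
    have d5 : ∀ i j, ∑ k, ∑ l, (if k = i then (if l = j then h i j * h k l else 0) else 0)
        = h i j ^ 2 := fun i j => by
      rw [sum_comm]; simp [sq]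
    have d6 : ∀ i j, ∑ k, ∑ l, (if k = j then (if l = i then h i j * h k l else 0) else 0)
        = h i j * h j i := fun i j => by
      rw [sum_comm]; simp
    simp only [d1, d2, d3, d4, d5, d6, c, c1, c2, c3]
    ring
  have h1 : (∑ i, r i) ^ 2 ≤ N * ∑ i, r i ^ 2 := by
    rw [hN]
    exact sq_sum_le_card_mul_sum_sq
  have h2 : 0 ≤ ∑ i, r i ^ 2 := sum_nonneg fun _ _ => sq_nonneg _
  rw [e1, e2, ← hN]
  have h3 : 2 * D * (∑ i, r i) ^ 2 ≤ D * (N - 1) * (4 * ∑ i, r i ^ 2) := by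
    calc 2 * D * (∑ i, r i) ^ 2 ≤ 2 * D * (N * ∑ i, r i ^ 2) := by gcongr
      _ = D * (∑ i, r i ^ 2) * (2 * N) := by ring
      _ ≤ D * (∑ i, r i ^ 2) * (4 * (N - 1)) := by
          refine mul_le_mul_of_nonneg_left ?_ (mul_nonneg hD0 h2)
          linarith
      _ = _ := by ring
  have h4 : D * ((N - 1) * (N - 2)) * (2 * ∑ i, ∑ j, h i j ^ 2)
      = 2 * s * (∑ i, ∑ j, h i j ^ 2) / (N * (N - 3)) := by
    have n0 : N ≠ 0 := by linarith
    have n1 : N - 1 ≠ 0 := by linarith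
    have n2 : N - 2 ≠ 0 := by linarith
    have n3 : N - 3 ≠ 0 := by linarith
    rw [hD]
    field_simp
  linarith

end PermutationMoments

section Coupling

variable {n : ℕ}

/-- The increasing rearrangement of `c`. -/
def sorted (c : Fin n → Fin n) : Fin n → Fin n := c ∘ Tuple.sort c

/-- The colouring obtained by reading the increasing rearrangement of `c` along `π`. -/
def coupled (π : Equiv.Perm (Fin n)) (c : Fin n → Fin n) : Fin n → Fin n := sorted c ∘ ⇑π⁻¹

theorem expect_coupled {E : Type*} [AddCommGroup E] [Module ℚ≥0 E] (F : (Fin n → Fin n) → E) :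
    𝔼 c : Fin n → Fin n, 𝔼 π : Equiv.Perm (Fin n), F (coupled π c)
      = 𝔼 c : Fin n → Fin n, F c := by
  have h1 : ∀ c : Fin n → Fin n, 𝔼 π : Equiv.Perm (Fin n), F (coupled π c)
      = 𝔼 σ : Equiv.Perm (Fin n), F (c ∘ σ) := fun c =>
    Fintype.expect_equiv ((Equiv.inv _).trans (Equiv.mulLeft (Tuple.sort c))) _ _ fun π => rfl
  simp only [h1]
  rw [expect_comm]
  have h2 : ∀ σ : Equiv.Perm (Fin n), 𝔼 c : Fin n → Fin n, F (c ∘ σ)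
      = 𝔼 c : Fin n → Fin n, F c := fun σ =>
    Fintype.expect_equiv (Equiv.arrowCongr σ.symm (Equiv.refl _)) _ _ fun c => rfl
  have : Nonempty (Equiv.Perm (Fin n)) := ⟨1⟩
  simp only [h2, Fintype.expect_const]

theorem quad_comp_inv {κ : Type*} (M : Fin n → Fin n → ℝ) (w : κ → κ → ℝ)
    (π : Equiv.Perm (Fin n)) (s : Fin n → κ) :
    quad M w (s ∘ ⇑π⁻¹) = ∑ i, ∑ j, M (π i) (π j) * w (s i) (s j) := by
  rw [quad, ← Equiv.sum_comp π]
  refine sum_congr rfl fun i _ => ?_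
  rw [← Equiv.sum_comp π]
  simp

theorem lin_comp_inv {κ : Type*} (β : Fin n → ℝ) (γ : κ → ℝ) (π : Equiv.Perm (Fin n))
    (s : Fin n → κ) : lin β γ (s ∘ ⇑π⁻¹) = ∑ i, β (π i) * γ (s i) := by
  rw [lin, ← Equiv.sum_comp π]
  simp

/-- Indicator of the first `t` positions. -/
noncomputable def ind (t : ℕ) (x : Fin n) : ℝ := if (x : ℕ) < t then 1 else 0

theorem ind_mem (t : ℕ) (x : Fin n) : ind t x = 0 ∨ ind t x = 1 := by
  unfold ind
  split_ifs <;> simp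

theorem sum_ind_sub_sorted_sq (t : ℕ) (c : Fin n → Fin n) :
    ∑ i, (ind t i - ind t (sorted c i)) ^ 2 = |∑ i : Fin n, ind t i - ∑ a, ind t (c a)| := by
  have hs : Monotone (sorted c) := Tuple.monotone_sort c
  have h1 : ∑ a, ind t (c a) = ∑ i, ind t (sorted c i) :=
    (Equiv.sum_comp (Tuple.sort c) fun a => ind t (c a)).symm
  have hlow : IsLowerSet {i : Fin n | (i : ℕ) < t} := fun a b hba ha =>
    lt_of_le_of_lt (Fin.le_def.1 hba) ha
  have hlow' : IsLowerSet {i : Fin n | (sorted c i : ℕ) < t} := fun a b hba ha =>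
    lt_of_le_of_lt (Fin.le_def.1 (hs hba)) ha
  rw [h1, ← sum_sub_distrib]
  rcases hlow.total hlow' with h | h
  · have hle : ∀ i : Fin n, (ind t i - ind t (sorted c i)) ^ 2
        = -(ind t i - ind t (sorted c i)) := by
      intro i
      have := @h i
      simp only [Set.mem_ofPred_eq] at this
      unfold ind
      split_ifs <;> simp_all
    simp only [hle]
    rw [sum_neg_distrib, eq_comm, ← abs_neg, abs_of_nonneg]
    rw [← sum_neg_distrib]
    exact sum_nonneg fun i _ => (hle i) ▸ sq_nonneg _
  · have hle : ∀ i : Fin n, (ind t i - ind t (sorted c i)) ^ 2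
        = ind t i - ind t (sorted c i) := by
      intro i
      have := @h i
      simp only [Set.mem_ofPred_eq] at this
      unfold ind
      split_ifs <;> simp_all
    simp only [hle]
    rw [eq_comm, abs_of_nonneg]
    exact sum_nonneg fun i _ => (hle i) ▸ sq_nonneg _

theorem expect_abs_le_sqrt {α : Type*} [Fintype α] [Nonempty α] (f : α → ℝ) {B : ℝ}
    (hB : 𝔼 x, f x ^ 2 ≤ B) : 𝔼 x, |f x| ≤ Real.sqrt B := by
  refine Real.le_sqrt_of_sq_le (le_trans ?_ hB)
  have h := expect_mul_sq_le_sq_mul_sq univ (fun x => |f x|) fun _ => 1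
  simpa [Fintype.expect_const] using h

theorem expect_sum_ind_sub_sorted_sq_le [NeZero n] (t : ℕ) :
    𝔼 c : Fin n → Fin n, ∑ i, (ind t i - ind t (sorted c i)) ^ 2 ≤ Real.sqrt n := by
  simp only [sum_ind_sub_sorted_sq]
  refine expect_abs_le_sqrt _ ?_
  have h0 : 𝔼 x : Fin n, (ind t x - 𝔼 y : Fin n, ind t y) = 0 := by
    rw [expect_sub_distrib, Fintype.expect_const, sub_self]
  have hle : ∀ x : Fin n, |ind t x - 𝔼 y : Fin n, ind t y| ≤ 1 := by
    intro x
    have h1 : 0 ≤ 𝔼 y : Fin n, ind t y := expect_nonneg fun y _ => by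
      rcases ind_mem t y with h | h <;> simp [h]
    have h2 : 𝔼 y : Fin n, ind t y ≤ 1 := expect_le univ_nonempty fun y _ => by
      rcases ind_mem t y with h | h <;> simp [h]
    rw [abs_le]
    rcases ind_mem t x with h | h <;> rw [h] <;> constructor <;> linarith
  have h3 := expect_sum_sq_le (ι := Fin n) univ (fun _ => 1) h0 hle
  refine le_trans (le_of_eq (expect_congr rfl fun c _ => ?_)) (h3.trans (by simp))
  have h4 : ∑ i : Fin n, ind t i = n * 𝔼 y : Fin n, ind t y := by
    rw [Fintype.expect_eq_sum_div_card, Fintype.card_fin, mul_div_cancel₀]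
    exact NeZero.ne _
  rw [h4]
  simp only [one_mul, sum_sub_distrib, sum_const, card_univ, Fintype.card_fin, nsmul_eq_mul]
  ring

theorem expect_sum_sub_sorted_sq_le [NeZero n] {g : Fin n → ℝ} {lam κ : ℝ} {t₁ t₂ : ℕ}
    (hg : ∀ i, g i = lam * (ind t₂ i - ind t₁ i - κ)) :
    𝔼 c : Fin n → Fin n, ∑ i, (g i - g (sorted c i)) ^ 2 ≤ 4 * lam ^ 2 * Real.sqrt n := by
  calc 𝔼 c : Fin n → Fin n, ∑ i, (g i - g (sorted c i)) ^ 2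
      ≤ 𝔼 c : Fin n → Fin n, (2 * lam ^ 2 * ∑ i, (ind t₂ i - ind t₂ (sorted c i)) ^ 2
        + 2 * lam ^ 2 * ∑ i, (ind t₁ i - ind t₁ (sorted c i)) ^ 2) := by
        refine expect_le_expect fun c _ => ?_
        rw [mul_sum, mul_sum, ← sum_add_distrib]
        refine sum_le_sum fun i _ => ?_
        rw [hg, hg]
        generalize ind t₂ i = a, ind t₁ i = b, ind t₂ (sorted c i) = d, ind t₁ (sorted c i) = e
        have : 0 ≤ lam ^ 2 * (a - d + (b - e)) ^ 2 := by positivity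
        nlinarith
    _ ≤ 2 * lam ^ 2 * Real.sqrt n + 2 * lam ^ 2 * Real.sqrt n := by
        rw [expect_add_distrib, ← mul_expect, ← mul_expect]
        gcongr
        · exact expect_sum_ind_sub_sorted_sq_le t₂
        · exact expect_sum_ind_sub_sorted_sq_le t₁
    _ = _ := by ring

theorem expect_lin_sub_coupled_sq_le (hn : 2 ≤ n) {β : Fin n → ℝ} (hβ : ∑ a, β a = 0)
    (g : Fin n → ℝ) {B : ℝ}
    (hB : 𝔼 c : Fin n → Fin n, ∑ i, (g i - g (sorted c i)) ^ 2 ≤ B) :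
    𝔼 c : Fin n → Fin n, 𝔼 π : Equiv.Perm (Fin n), (lin β g ⇑π⁻¹ - lin β g (coupled π c)) ^ 2
      ≤ (∑ a, β a ^ 2) * B / ((n : ℝ) - 1) := by
  have hN : (2 : ℝ) ≤ n := by exact_mod_cast hn
  have h1 : ∀ c : Fin n → Fin n,
      𝔼 π : Equiv.Perm (Fin n), (lin β g ⇑π⁻¹ - lin β g (coupled π c)) ^ 2
      ≤ (∑ a, β a ^ 2) / ((n : ℝ) - 1) * ∑ i, (g i - g (sorted c i)) ^ 2 := by
    intro c
    have h := expect_perm_sum_sq_le (ι := Fin n) (by simpa using hn) hβ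
      fun i => g i - g (sorted c i)
    rw [Fintype.card_fin] at h
    refine le_trans (le_of_eq (expect_congr rfl fun π _ => ?_)) (h.trans (le_of_eq (by ring)))
    have e := lin_comp_inv β g π id
    rw [Function.id_comp] at e
    rw [e, coupled, lin_comp_inv, ← sum_sub_distrib]
    simp only [mul_sub, id]
  have h2 : 0 ≤ (∑ a, β a ^ 2) / ((n : ℝ) - 1) :=
    div_nonneg (sum_nonneg fun _ _ => sq_nonneg _) (by linarith)
  calc _ ≤ 𝔼 c : Fin n → Fin n, (∑ a, β a ^ 2) / ((n : ℝ) - 1)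
          * ∑ i, (g i - g (sorted c i)) ^ 2 := expect_le_expect fun c _ => h1 c
    _ ≤ (∑ a, β a ^ 2) / ((n : ℝ) - 1) * B := by
        rw [← mul_expect]
        exact mul_le_mul_of_nonneg_left hB h2
    _ = _ := by ring

theorem sum_sum_mul_sub_mul_sq_le {ι : Type*} [Fintype ι] {g g' : ι → ℝ} {K : ℝ}
    (hg : ∀ i, |g i| ≤ K) (hg' : ∀ i, |g' i| ≤ K) :
    ∑ i, ∑ j, (g i * g j - g' i * g' j) ^ 2
      ≤ 4 * K ^ 2 * Fintype.card ι * ∑ i, (g i - g' i) ^ 2 := by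
  have h1 : ∀ i j, (g i * g j - g' i * g' j) ^ 2
      ≤ 2 * K ^ 2 * (g j - g' j) ^ 2 + 2 * K ^ 2 * (g i - g' i) ^ 2 := by
    intro i j
    have e1 : g i ^ 2 ≤ K ^ 2 := sq_le_sq' (abs_le.1 (hg i)).1 (abs_le.1 (hg i)).2
    have e2 : g' j ^ 2 ≤ K ^ 2 := sq_le_sq' (abs_le.1 (hg' j)).1 (abs_le.1 (hg' j)).2
    have e3 := mul_le_mul_of_nonneg_right e1 (sq_nonneg (g j - g' j))
    have e4 := mul_le_mul_of_nonneg_right e2 (sq_nonneg (g i - g' i))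
    nlinarith [sq_nonneg (g i * (g j - g' j) - (g i - g' i) * g' j)]
  refine (sum_le_sum fun i _ => sum_le_sum fun j _ => h1 i j).trans (le_of_eq ?_)
  simp only [sum_add_distrib, ← mul_sum, sum_const, card_univ, nsmul_eq_mul]
  ring

theorem expect_quad_sub_coupled_sq_le (hn : 4 ≤ n) {M : Fin n → Fin n → ℝ}
    (hs : ∀ a b, M a b = M b a) (hd : ∀ a, M a a = 0) (h0 : ∀ a, ∑ b, M a b = 0)
    {g : Fin n → ℝ} {B K : ℝ} (hK : ∀ i, |g i| ≤ K)
    (hB : 𝔼 c : Fin n → Fin n, ∑ i, (g i - g (sorted c i)) ^ 2 ≤ B) :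
    𝔼 c : Fin n → Fin n, 𝔼 π : Equiv.Perm (Fin n),
        (quad M (fun x y => g x * g y) ⇑π⁻¹ - quad M (fun x y => g x * g y) (coupled π c)) ^ 2
      ≤ 8 * K ^ 2 * (∑ a, ∑ b, M a b ^ 2) * B / ((n : ℝ) - 3) := by
  have hN : (4 : ℝ) ≤ n := by exact_mod_cast hn
  have hn0 : (n : ℝ) ≠ 0 := by linarith
  have hn3 : (n : ℝ) - 3 ≠ 0 := by linarith
  set s := ∑ a, ∑ b, M a b ^ 2 with hsdef
  have hs0 : 0 ≤ s := sum_nonneg fun _ _ => sum_nonneg fun _ _ => sq_nonneg _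
  have h1 : ∀ c : Fin n → Fin n, 𝔼 π : Equiv.Perm (Fin n),
      (quad M (fun x y => g x * g y) ⇑π⁻¹ - quad M (fun x y => g x * g y) (coupled π c)) ^ 2
      ≤ 8 * K ^ 2 * s / ((n : ℝ) - 3) * ∑ i, (g i - g (sorted c i)) ^ 2 := by
    intro c
    set g' : Fin n → ℝ := fun i => g (sorted c i) with hg'
    have h := expect_perm_sum_sum_sq_le (ι := Fin n) (M := M)
      (h := fun i j => if i = j then 0 else g i * g j - g' i * g' j)
      (by simpa using hn) hs hd h0 (fun i j => by simp only [eq_comm (a := i)]; ring_nf)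
      (fun i => by simp)
    rw [Fintype.card_fin, ← hsdef] at h
    have h2 : ∑ i, ∑ j, (if i = j then 0 else g i * g j - g' i * g' j) ^ 2
        ≤ 4 * K ^ 2 * n * ∑ i, (g i - g' i) ^ 2 := by
      have h3 := sum_sum_mul_sub_mul_sq_le (g := g) (g' := g') hK fun i => hK _
      rw [Fintype.card_fin] at h3
      refine le_trans (sum_le_sum fun i _ => sum_le_sum fun j _ => ?_) h3
      split_ifs
      · simpa using sq_nonneg _
      · exact le_rfl
    refine le_trans (le_of_eq (expect_congr rfl fun π _ => ?_)) (h.trans ?_)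
    · have e := quad_comp_inv M (fun x y => g x * g y) π id
      rw [Function.id_comp] at e
      rw [e, coupled, quad_comp_inv, ← sum_sub_distrib]
      simp only [← sum_sub_distrib]
      congr 1
      refine sum_congr rfl fun i _ => sum_congr rfl fun j _ => ?_
      split_ifs with hij
      · simp [hij, hd]
      · simp only [hg', id]
        ring
    · calc _ ≤ 2 * s * (4 * K ^ 2 * n * ∑ i, (g i - g' i) ^ 2) / (n * ((n : ℝ) - 3)) := by
            refine div_le_div_of_nonneg_right ?_ (mul_nonneg (by linarith) (by linarith))
            gcongr
        _ = _ := by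
            field_simp
            ring
  have h2 : 0 ≤ 8 * K ^ 2 * s / ((n : ℝ) - 3) :=
    div_nonneg (by positivity) (by linarith)
  calc _ ≤ 𝔼 c : Fin n → Fin n, 8 * K ^ 2 * s / ((n : ℝ) - 3)
          * ∑ i, (g i - g (sorted c i)) ^ 2 := expect_le_expect fun c _ => h1 c
    _ ≤ 8 * K ^ 2 * s / ((n : ℝ) - 3) * B := by
        rw [← mul_expect]
        exact mul_le_mul_of_nonneg_left hB h2
    _ = _ := by ring

end Coupling

section Statistics

variable {n : ℕ}

theorem pexp_eq_expect (n : ℕ) (f : Equiv.Perm (Fin n) → ℝ) : pexp n f = 𝔼 π, f π := by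
  rw [pexp, Fintype.expect_eq_sum_div_card, Fintype.card_perm, Fintype.card_fin]

theorem standardize_eq {F f : Equiv.Perm (Fin n) → ℝ} {a C : ℝ} (hF : ∀ π, F π = a * f π + C)
    (ha : 0 ≤ a) (hf : 𝔼 π, f π = 0) (hv : 0 < pvar n F) :
    0 < a ∧ 0 < 𝔼 π, f π ^ 2 ∧
      ∀ π, (F π - pexp n F) / Real.sqrt (pvar n F) = f π / Real.sqrt (𝔼 π, f π ^ 2) := by
  have : Nonempty (Equiv.Perm (Fin n)) := ⟨1⟩
  have h1 : pexp n F = C := by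
    rw [pexp_eq_expect]
    simp only [hF]
    rw [expect_add_distrib, ← mul_expect, hf, Fintype.expect_const, mul_zero, zero_add]
  have h2 : pvar n F = a ^ 2 * 𝔼 π, f π ^ 2 := by
    rw [pvar, pexp_eq_expect, h1, mul_expect]
    exact expect_congr rfl fun π _ => by rw [hF]; ring
  rw [h2] at hv
  have ha' : 0 < a := lt_of_le_of_ne ha fun h => by simp [← h] at hv
  refine ⟨ha', (pos_iff_pos_of_mul_pos hv).1 (by positivity), fun π => ?_⟩
  rw [h1, h2, hF, Real.sqrt_mul (sq_nonneg a), Real.sqrt_sq ha, add_sub_cancel_right,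
    mul_div_mul_left _ _ ha'.ne']

theorem sum_ind {t : ℕ} (ht : t ≤ n) : ∑ i : Fin n, ind t i = t := by
  unfold ind
  rw [sum_boole, Fin.card_filter_val_lt, min_eq_right ht]

/-- The indicator of the window `[t₁, t₂)`. -/
noncomputable def window (t₁ t₂ : ℕ) (i : Fin n) : ℝ := ind t₂ i - ind t₁ i

/-- The centred indicator of the window `[t₁, t₂)`. -/
noncomputable def cwindow (t₁ t₂ : ℕ) (i : Fin n) : ℝ :=
  ind t₂ i - ind t₁ i - ((t₂ : ℝ) - t₁) / n

theorem window_eq {t₁ t₂ : ℕ} (h : t₁ ≤ t₂) (i : Fin n) :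
    window t₁ t₂ i = if t₁ ≤ (i : ℕ) ∧ (i : ℕ) < t₂ then 1 else 0 := by
  unfold window ind
  split_ifs <;> first | omega | norm_num

theorem window_mul_self {t₁ t₂ : ℕ} (h : t₁ ≤ t₂) (i : Fin n) :
    window t₁ t₂ i * window t₁ t₂ i = window t₁ t₂ i := by
  rw [window_eq h]
  split_ifs <;> simp

theorem sum_window {t₁ t₂ : ℕ} (h : t₁ ≤ t₂) (h' : t₂ ≤ n) :
    ∑ i : Fin n, window t₁ t₂ i = (t₂ : ℝ) - t₁ := by
  simp only [window]
  rw [sum_sub_distrib, sum_ind h', sum_ind (h.trans h')]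

variable {R : Fin n → Fin n → ℝ} {t₁ t₂ : ℕ}

theorem U1_eq (h : t₁ ≤ t₂) (R : Fin n → Fin n → ℝ) (π : Equiv.Perm (Fin n)) :
    U1 n R π t₁ t₂ = ∑ i, ∑ j, R (π i) (π j) * (window t₁ t₂ i * window t₁ t₂ j) := by
  refine sum_congr rfl fun i _ => sum_congr rfl fun j _ => ?_
  rw [window_eq h, window_eq h]
  split_ifs <;> first | omega | simp

theorem U2_eq (h : t₁ ≤ t₂) (R : Fin n → Fin n → ℝ) (π : Equiv.Perm (Fin n)) :
    U2 n R π t₁ t₂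
      = ∑ i, ∑ j, R (π i) (π j) * ((1 - window t₁ t₂ i) * (1 - window t₁ t₂ j)) := by
  refine sum_congr rfl fun i _ => sum_congr rfl fun j _ => ?_
  rw [window_eq h, window_eq h]
  split_ifs <;> first | omega | simp

theorem sum_Rbar_sub (hn : n ≠ 0) (R : Fin n → Fin n → ℝ) : ∑ a, (Rbar n R a - r0 n R) = 0 := by
  have : (n : ℝ) ≠ 0 := by exact_mod_cast hn
  rw [sum_sub_distrib, sum_const, card_univ, Fintype.card_fin, nsmul_eq_mul, r0,
    mul_div_cancel₀ _ this, sub_self]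

theorem Udiff_eq (hn : 2 ≤ n) (hs : ∀ i j, R i j = R j i) (h : t₁ ≤ t₂)
    (π : Equiv.Perm (Fin n)) :
    Udiff n R π t₁ t₂ = 2 * ((n : ℝ) - 1) *
        lin (fun a => Rbar n R a - r0 n R) (cwindow t₁ t₂) ⇑π⁻¹
      + (2 * ((n : ℝ) - 1) * (r0 n R * ∑ i : Fin n, window t₁ t₂ i) - ∑ a, ∑ b, R a b) := by
  have hN : (2 : ℝ) ≤ n := by exact_mod_cast hn
  have hn1 : (n : ℝ) - 1 ≠ 0 := by linarith
  set x : Fin n → ℝ := window t₁ t₂ with hx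
  have e1 : Udiff n R π t₁ t₂ = 2 * ∑ i, (∑ j, R (π i) j) * x i - ∑ a, ∑ b, R a b := by
    have h1 : ∑ i, ∑ j, R (π i) (π j) * x i = ∑ i, (∑ j, R (π i) j) * x i :=
      sum_congr rfl fun i _ => by rw [← sum_mul, Equiv.sum_comp π]
    have h2 : ∑ i, ∑ j, R (π i) (π j) * x j = ∑ i, (∑ j, R (π i) j) * x i := by
      rw [sum_comm, ← h1]
      exact sum_congr rfl fun i _ => sum_congr rfl fun j _ => by rw [hs]
    have h3 : ∑ i, ∑ j, R (π i) (π j) = ∑ a, ∑ b, R a b := by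
      rw [← Equiv.sum_comp π fun a => ∑ b, R a b]
      exact sum_congr rfl fun i _ => Equiv.sum_comp π _
    rw [Udiff, U1_eq h, U2_eq h, ← hx, ← h3, two_mul]
    nth_rewrite 1 [← h1]
    rw [← h2]
    simp only [← sum_sub_distrib, ← sum_add_distrib]
    refine sum_congr rfl fun i _ => sum_congr rfl fun j _ => by ring
  have e2 : lin (fun a => Rbar n R a - r0 n R) (cwindow t₁ t₂) ⇑π⁻¹
      = ∑ i, (Rbar n R (π i) - r0 n R) * x i := by
    have e := lin_comp_inv (fun a => Rbar n R a - r0 n R) (cwindow t₁ t₂) π (id : Fin n → Fin n)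
    rw [Function.id_comp] at e
    rw [e]
    simp only [id, cwindow]
    simp only [mul_sub _ _ (_ / _), sum_sub_distrib, ← sum_mul]
    rw [← sum_sub_distrib, Equiv.sum_comp π fun a => Rbar n R a - r0 n R,
      sum_Rbar_sub (by omega), zero_mul, sub_zero]
    rfl
  rw [e1, e2, mul_sum, mul_sum, mul_sum, mul_sum, ← add_sub_assoc, ← sum_add_distrib]
  congr 1
  refine sum_congr rfl fun i _ => ?_
  rw [Rbar]
  field_simp
  ring

/-- The main effects of the matrix `R`. -/
noncomputable def mainEffect (n : ℕ) (R : Fin n → Fin n → ℝ) (a : Fin n) : ℝ :=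
  (∑ b, R a b - (∑ a, ∑ b, R a b) / (2 * ((n : ℝ) - 1))) / ((n : ℝ) - 2)

/-- The interaction part of the matrix `R`, with vanishing row sums. -/
noncomputable def interaction (n : ℕ) (R : Fin n → Fin n → ℝ) (a b : Fin n) : ℝ :=
  if a = b then 0 else R a b - (mainEffect n R a + mainEffect n R b)

theorem sum_mainEffect (hn : 3 ≤ n) (R : Fin n → Fin n → ℝ) :
    ∑ a, mainEffect n R a = (∑ a, ∑ b, R a b) / (2 * ((n : ℝ) - 1)) := by
  have hN : (3 : ℝ) ≤ n := by exact_mod_cast hn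
  have hn1 : (n : ℝ) - 1 ≠ 0 := by linarith
  have hn2 : (n : ℝ) - 2 ≠ 0 := by linarith
  simp only [mainEffect]
  rw [← sum_div, sum_sub_distrib, sum_const, card_univ, Fintype.card_fin, nsmul_eq_mul]
  field_simp
  ring

theorem interaction_self (R : Fin n → Fin n → ℝ) (a : Fin n) : interaction n R a a = 0 := by
  simp [interaction]

theorem interaction_comm (hs : ∀ i j, R i j = R j i) (a b : Fin n) :
    interaction n R a b = interaction n R b a := by
  simp only [interaction, eq_comm (a := a), hs a b, add_comm (mainEffect n R a)]

theorem eq_interaction_add (hd : ∀ i, R i i = 0) (a b : Fin n) :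
    R a b = interaction n R a b
      + if a = b then 0 else (mainEffect n R a + mainEffect n R b) := by
  unfold interaction
  split_ifs with h
  · subst h
    simp [hd]
  · ring

theorem sum_ite_eq_zero_sub {ι : Type*} [Fintype ι] [DecidableEq ι] (f : ι → ℝ) (a : ι) :
    ∑ b, (if a = b then 0 else f b) = ∑ b, f b - f a := by
  rw [eq_sub_iff_add_eq, ← Fintype.sum_ite_eq a f, ← sum_add_distrib]
  exact sum_congr rfl fun b _ => by split_ifs <;> simp

theorem sum_interaction (hn : 3 ≤ n) (hd : ∀ i, R i i = 0) (a : Fin n) :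
    ∑ b, interaction n R a b = 0 := by
  have hN : (3 : ℝ) ≤ n := by exact_mod_cast hn
  have hn2 : (n : ℝ) - 2 ≠ 0 := by linarith
  simp only [interaction]
  rw [sum_ite_eq_zero_sub, sum_sub_distrib, sum_add_distrib, sum_mainEffect hn, sum_const,
    card_univ, Fintype.card_fin, nsmul_eq_mul, hd]
  have : mainEffect n R a * ((n : ℝ) - 2)
      = ∑ b, R a b - (∑ a, ∑ b, R a b) / (2 * ((n : ℝ) - 1)) := div_mul_cancel₀ _ hn2
  linarith

theorem Uw_eq (hn : 3 ≤ n) (hs : ∀ i j, R i j = R j i) (hd : ∀ i, R i i = 0)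
    (h : t₁ ≤ t₂) (h' : t₂ ≤ n) :
    ∃ C : ℝ, ∀ π : Equiv.Perm (Fin n), Uw n R π t₁ t₂
      = quad (interaction n R) (fun x y => cwindow t₁ t₂ x * cwindow t₁ t₂ y) ⇑π⁻¹ + C := by
  have hN : (3 : ℝ) ≤ n := by exact_mod_cast hn
  have hn2 : (n : ℝ) - 2 ≠ 0 := by linarith
  set x : Fin n → ℝ := window t₁ t₂ with hx
  set k : ℝ := (t₂ : ℝ) - t₁ with hk
  set p : ℝ := (k - 1) / ((n : ℝ) - 2) with hp
  have hxsum : ∑ i, x i = k := sum_window h h'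
  set Kf : Fin n → Fin n → ℝ := fun i j => x i * x j - p * (x i + x j) + p with hKf
  set S := interaction n R with hS
  set al := mainEffect n R with hal
  refine ⟨2 * (p * (n - 1 - k)) * ∑ a, al a, fun π => ?_⟩
  have e1 : Uw n R π t₁ t₂ = ∑ i, ∑ j, R (π i) (π j) * Kf i j := by
    rw [Uw, U1_eq h, U2_eq h, ← hx, add_div, mul_div_right_comm, mul_div_right_comm, mul_sum,
      mul_sum, ← sum_add_distrib]
    refine sum_congr rfl fun i _ => ?_
    rw [mul_sum, mul_sum, ← sum_add_distrib]
    refine sum_congr rfl fun j _ => ?_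
    have hp' : ((n : ℝ) - t₂ + t₁ - 1) / ((n : ℝ) - 2) = 1 - p := by
      rw [hp, hk]
      field_simp
      ring
    have hp2 : ((t₂ : ℝ) - t₁ - 1) / ((n : ℝ) - 2) = p := by rw [hp, hk]
    rw [hp', hp2]
    simp only [hKf]
    ring
  have hcol : ∀ i, ∑ j, (if i = j then 0 else Kf i j) = p * (n - 1 - k) := by
    intro i
    rw [sum_ite_eq_zero_sub]
    simp only [hKf, sum_add_distrib, sum_sub_distrib, ← mul_sum, hxsum, sum_const, card_univ,
      Fintype.card_fin, nsmul_eq_mul]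
    rw [window_mul_self h]
    have : p * ((n : ℝ) - 2) = k - 1 := div_mul_cancel₀ _ hn2
    linear_combination (-x i) * this
  have e2 : ∑ i, ∑ j, (if i = j then 0 else (al (π i) + al (π j))) * Kf i j
      = 2 * (p * (n - 1 - k)) * ∑ a, al a := by
    have h1 : ∑ i, ∑ j, al (π i) * (if i = j then 0 else Kf i j)
        = (p * (n - 1 - k)) * ∑ a, al a := by
      simp only [← mul_sum, hcol]
      rw [← sum_mul, Equiv.sum_comp π al, mul_comm]
    have h2 : ∑ i, ∑ j, al (π j) * (if i = j then 0 else Kf i j)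
        = (p * (n - 1 - k)) * ∑ a, al a := by
      rw [sum_comm, ← h1]
      refine sum_congr rfl fun i _ => sum_congr rfl fun j _ => ?_
      simp only [eq_comm (a := j), hKf]
      ring_nf
    rw [mul_assoc, two_mul]
    nth_rewrite 1 [← h1]
    rw [← h2]
    simp only [← sum_add_distrib]
    refine sum_congr rfl fun i _ => sum_congr rfl fun j _ => ?_
    split_ifs <;> ring
  have hrow : ∀ i, ∑ j, S (π i) (π j) = 0 := fun i => by
    rw [Equiv.sum_comp π (S (π i)), hS, sum_interaction hn hd]
  have hrow' : ∀ j, ∑ i, S (π i) (π j) = 0 := fun j => by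
    rw [← hrow j]
    exact sum_congr rfl fun i _ => interaction_comm hs _ _
  have hkill : ∀ b : Fin n → ℝ, ∑ i, ∑ j, S (π i) (π j) * b i = 0 := fun b => by
    simp only [← sum_mul, hrow, zero_mul, sum_const_zero]
  have hkill' : ∀ b : Fin n → ℝ, ∑ i, ∑ j, S (π i) (π j) * b j = 0 := fun b => by
    rw [sum_comm]
    simp only [← sum_mul, hrow', zero_mul, sum_const_zero]
  have e3 : ∑ i, ∑ j, S (π i) (π j) * Kf i j
      = ∑ i, ∑ j, S (π i) (π j) * (cwindow t₁ t₂ i * cwindow t₁ t₂ j) := by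
    have e : ∀ i j, S (π i) (π j) * Kf i j
        = S (π i) (π j) * (cwindow t₁ t₂ i * cwindow t₁ t₂ j)
          + (S (π i) (π j) * (k / n * x i - p * x i)
            + S (π i) (π j) * (k / n * x j - p * x j + p - (k / n) ^ 2)) := by
      intro i j
      have hc : ∀ i : Fin n, cwindow t₁ t₂ i = x i - k / n := fun i => rfl
      rw [hc, hc]
      simp only [hKf]
      ring
    simp only [e, sum_add_distrib, hkill, hkill' fun j => k / n * x j - p * x j + p - (k / n) ^ 2,
      add_zero]
  have e4 := quad_comp_inv S (fun x y => cwindow t₁ t₂ x * cwindow t₁ t₂ y) π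
    (id : Fin n → Fin n)
  rw [Function.id_comp] at e4
  rw [e4]
  simp only [id]
  rw [← e3, ← e2, e1, ← sum_add_distrib]
  refine sum_congr rfl fun i _ => ?_
  rw [← sum_add_distrib]
  refine sum_congr rfl fun j _ => ?_
  rw [eq_interaction_add hd (π i) (π j), add_mul]
  simp only [EmbeddingLike.apply_eq_iff_eq, hS, hal]

theorem expect_lin_inv_eq_zero {ι : Type*} [Fintype ι] [DecidableEq ι] [Nonempty ι] {β : ι → ℝ}
    (hβ : ∑ a, β a = 0) (g : ι → ℝ) : 𝔼 π : Equiv.Perm ι, lin β g ⇑π⁻¹ = 0 := by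
  have h1 : ∀ a, 𝔼 π : Equiv.Perm ι, g (π⁻¹ a)
      = 𝔼 π : Equiv.Perm ι, g (π⁻¹ (Classical.arbitrary ι)) :=
    fun a => Fintype.expect_equiv (Equiv.mulLeft (Equiv.swap a (Classical.arbitrary ι))) _ _
      fun π => by simp
  simp only [lin]
  rw [expect_sum_comm]
  simp only [← mul_expect, h1]
  rw [← sum_mul, hβ, zero_mul]

theorem expect_quad_inv_eq_zero (hn : 2 ≤ n) {M : Fin n → Fin n → ℝ} (hd : ∀ a, M a a = 0)
    (h0 : ∀ a, ∑ b, M a b = 0) (w : Fin n → Fin n → ℝ) :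
    𝔼 π : Equiv.Perm (Fin n), quad M w ⇑π⁻¹ = 0 := by
  have hN : (2 : ℝ) ≤ n := by exact_mod_cast hn
  have h1 : ∀ i j, 𝔼 π : Equiv.Perm (Fin n), M (π i) (π j) = 0 := by
    intro i j
    have hs : ∑ j, 𝔼 π : Equiv.Perm (Fin n), M (π i) (π j) = 0 := by
      rw [← expect_sum_comm]
      simp only [Equiv.sum_comp _ (M _), h0, expect_const_zero]
    by_cases hij : i = j
    · subst hij
      simp [hd]
    have h2 := card_sub_mul_eq_neg_sum hs {i} (l := j) fun k hk => by
      have hki : i ≠ k := by simpa [eq_comm] using hk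
      refine Fintype.expect_equiv (Equiv.mulRight (Equiv.swap j k)) _ _ fun π => ?_
      simp [Equiv.swap_apply_of_ne_of_ne hij hki]
    simp only [Fintype.card_fin, card_singleton, Nat.cast_one, sum_singleton, hd,
      expect_const_zero, neg_zero, mul_eq_zero] at h2
    exact h2.resolve_left (by linarith)
  have e : ∀ π : Equiv.Perm (Fin n), quad M w ⇑π⁻¹ = ∑ i, ∑ j, M (π i) (π j) * w i j := fun π => by
    have e4 := quad_comp_inv M w π (id : Fin n → Fin n)
    rwa [Function.id_comp] at e4
  simp only [e]
  rw [expect_sum_comm]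
  simp only [expect_sum_comm, ← expect_mul, h1, zero_mul, sum_const_zero]

end Statistics

section MatrixBounds

theorem sum_sum_gram_le {ι : Type*} [Fintype ι] (X Y : ι → ι → ℝ) :
    ∑ b, ∑ b', (∑ a, X a b * Y a b') ^ 2 ≤ (∑ a, ∑ b, X a b ^ 2) * ∑ a, ∑ b, Y a b ^ 2 := by
  rw [sum_comm (f := fun a b => X a b ^ 2), sum_comm (f := fun a b => Y a b ^ 2), sum_mul_sum]
  exact sum_le_sum fun b _ => sum_le_sum fun b' _ => sum_mul_sq_le_sq_mul_sq _ _ _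

/-- Stability of the Schatten norm of order four under small perturbations in Frobenius norm. -/
theorem sum_sum_gram_perturb_le {ι : Type*} [Fintype ι] {X Y B : ι → ι → ℝ} {ε : ℝ} (hε : ε ≤ 1 / 4)
    (hε0 : 0 ≤ ε)
    (hX : ∀ a b, X a b = Y a b + B a b)
    (h1 : ∑ b, ∑ b', (∑ a, X a b * X a b') ^ 2 ≤ ε * (∑ a, ∑ b, X a b ^ 2) ^ 2)
    (h2 : ∑ a, ∑ b, B a b ^ 2 ≤ ε * ∑ a, ∑ b, X a b ^ 2) :
    ∑ b, ∑ b', (∑ a, Y a b * Y a b') ^ 2 ≤ 288 * ε * (∑ a, ∑ b, Y a b ^ 2) ^ 2 := by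
  have e1 := sum_sum_gram_le X B
  have e2 := sum_sum_gram_le B Y
  set F := ∑ a, ∑ b, X a b ^ 2 with hF
  set G := ∑ a, ∑ b, Y a b ^ 2 with hG
  set D := ∑ a, ∑ b, B a b ^ 2 with hD
  have hF0 : 0 ≤ F := sum_nonneg fun _ _ => sum_nonneg fun _ _ => sq_nonneg _
  have hG0 : 0 ≤ G := sum_nonneg fun _ _ => sum_nonneg fun _ _ => sq_nonneg _
  have hD0 : 0 ≤ D := sum_nonneg fun _ _ => sum_nonneg fun _ _ => sq_nonneg _
  have hGF : G ≤ 2 * F + 2 * D := by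
    rw [hF, hD, hG]
    simp only [mul_sum, ← sum_add_distrib]
    refine sum_le_sum fun a _ => sum_le_sum fun b _ => ?_
    rw [hX]
    nlinarith [sq_nonneg (Y a b + 2 * B a b)]
  have hFG : F ≤ 2 * G + 2 * D := by
    rw [hF, hD, hG]
    simp only [mul_sum, ← sum_add_distrib]
    refine sum_le_sum fun a _ => sum_le_sum fun b _ => ?_
    rw [hX]
    nlinarith [sq_nonneg (Y a b - B a b)]
  have e3 : ∑ b, ∑ b', (∑ a, Y a b * Y a b') ^ 2
      ≤ 3 * ∑ b, ∑ b', (∑ a, X a b * X a b') ^ 2 + 3 * ∑ b, ∑ b', (∑ a, X a b * B a b') ^ 2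
        + 3 * ∑ b, ∑ b', (∑ a, B a b * Y a b') ^ 2 := by
    simp only [mul_sum, ← sum_add_distrib]
    refine sum_le_sum fun b _ => sum_le_sum fun b' _ => ?_
    have : ∑ a, Y a b * Y a b'
        = ∑ a, X a b * X a b' - ∑ a, X a b * B a b' - ∑ a, B a b * Y a b' := by
      rw [← sum_sub_distrib, ← sum_sub_distrib]
      exact sum_congr rfl fun a _ => by rw [hX, hX]; ring
    rw [this]
    generalize ∑ a, X a b * X a b' = p, ∑ a, X a b * B a b' = q, ∑ a, B a b * Y a b' = r
    nlinarith [sq_nonneg (p + q), sq_nonneg (p + r), sq_nonneg (q - r)]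
  have hF4 : F ≤ 4 * G := by nlinarith
  have hG3 : G ≤ 4 * F := by nlinarith
  have h4 : F * D ≤ ε * F ^ 2 := by nlinarith
  have h5 : D * G ≤ 4 * ε * F ^ 2 := by
    calc D * G ≤ (ε * F) * (4 * F) := mul_le_mul h2 hG3 hG0 (by positivity)
      _ = _ := by ring
  have h6 : ε * F ^ 2 ≤ ε * (4 * G) ^ 2 := by gcongr
  nlinarith

variable {n : ℕ} {R : Fin n → Fin n → ℝ}

theorem sum_sum_sq_eq (hn : 2 ≤ n) (R : Fin n → Fin n → ℝ) :
    ∑ a, ∑ b, R a b ^ 2 = n * ((n : ℝ) - 1) * rdsq n R := by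
  have hN : (2 : ℝ) ≤ n := by exact_mod_cast hn
  have hn1 : (n : ℝ) - 1 ≠ 0 := by linarith
  have hn0 : (n : ℝ) ≠ 0 := by linarith
  rw [rdsq]
  field_simp

theorem sum_Rbar_sub_sq (hn : n ≠ 0) (R : Fin n → Fin n → ℝ) :
    ∑ a, (Rbar n R a - r0 n R) ^ 2 = n * (r1sq n R - r0 n R ^ 2) := by
  have hn0 : (n : ℝ) ≠ 0 := by exact_mod_cast hn
  have h1 : ∑ a, Rbar n R a = n * r0 n R := by rw [r0]; field_simp
  have h2 : ∑ a, Rbar n R a ^ 2 = n * r1sq n R := by rw [r1sq]; field_simp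
  simp only [sub_sq, sum_add_distrib, sum_sub_distrib, ← sum_mul, ← mul_sum, h1, h2, sum_const,
    card_univ, Fintype.card_fin, nsmul_eq_mul]
  ring

theorem sum_mainEffect_sq_le (hn : 4 ≤ n) (R : Fin n → Fin n → ℝ) :
    ∑ a, mainEffect n R a ^ 2 ≤ 13 / 2 * (n * r1sq n R) := by
  have hN : (4 : ℝ) ≤ n := by exact_mod_cast hn
  have hn0 : (n : ℝ) ≠ 0 := by linarith
  have hn1 : (n : ℝ) - 1 ≠ 0 := by linarith
  have hn2 : (n : ℝ) - 2 ≠ 0 := by linarith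
  have h2 : ∑ a, Rbar n R a ^ 2 = n * r1sq n R := by rw [r1sq]; field_simp
  rw [← h2]
  set x := Rbar n R with hx
  have hrow : ∀ a, ∑ b, R a b = ((n : ℝ) - 1) * x a := fun a => by rw [hx, Rbar]; field_simp
  have hcs : (∑ a, x a) ^ 2 ≤ n * ∑ a, x a ^ 2 := by
    simpa using sq_sum_le_card_mul_sum_sq (s := univ) (f := x)
  have h3 : ∀ a, mainEffect n R a ^ 2 ≤ 2 * (3 / 2) ^ 2 * x a ^ 2
      + 2 * (1 / 2) ^ 2 * ((∑ a, x a) ^ 2 * (1 / ((n : ℝ) - 2)) ^ 2) := by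
    intro a
    have e : mainEffect n R a = ((n : ℝ) - 1) / ((n : ℝ) - 2) * x a
        - 1 / 2 * ((∑ a, x a) * (1 / ((n : ℝ) - 2))) := by
      rw [mainEffect]
      simp only [hrow, ← mul_sum]
      field_simp
    rw [e]
    have e2 : (((n : ℝ) - 1) / ((n : ℝ) - 2) * x a) ^ 2 ≤ (3 / 2) ^ 2 * x a ^ 2 := by
      have hq : ((n : ℝ) - 1) / ((n : ℝ) - 2) ≤ 3 / 2 := by
        rw [div_le_iff₀ (by linarith)]
        linarith
      rw [mul_pow]
      exact mul_le_mul_of_nonneg_right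
        (pow_le_pow_left₀ (div_nonneg (by linarith) (by linarith)) hq 2) (sq_nonneg _)
    nlinarith [sq_nonneg (((n : ℝ) - 1) / ((n : ℝ) - 2) * x a
        + 1 / 2 * ((∑ a, x a) * (1 / ((n : ℝ) - 2))))]
  refine (sum_le_sum fun a _ => h3 a).trans ?_
  rw [sum_add_distrib, ← mul_sum, sum_const, card_univ, Fintype.card_fin, nsmul_eq_mul]
  have hs0 : 0 ≤ ∑ a, x a ^ 2 := sum_nonneg fun _ _ => sq_nonneg _
  have h5 : (n : ℝ) * (2 * (1 / 2) ^ 2 * ((∑ a, x a) ^ 2 * (1 / ((n : ℝ) - 2)) ^ 2))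
      ≤ 2 * ∑ a, x a ^ 2 := by
    calc (n : ℝ) * (2 * (1 / 2) ^ 2 * ((∑ a, x a) ^ 2 * (1 / ((n : ℝ) - 2)) ^ 2))
        ≤ (n : ℝ) * (2 * (1 / 2) ^ 2 * ((n * ∑ a, x a ^ 2) * (1 / ((n : ℝ) - 2)) ^ 2)) :=
        mul_le_mul_of_nonneg_left (mul_le_mul_of_nonneg_left
          (mul_le_mul_of_nonneg_right hcs (sq_nonneg _)) (by norm_num)) (by linarith)
      _ = (n / ((n : ℝ) - 2)) ^ 2 * (1 / 2) * ∑ a, x a ^ 2 := by ring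
      _ ≤ 2 ^ 2 * (1 / 2) * ∑ a, x a ^ 2 := by
          have hq : (n : ℝ) / ((n : ℝ) - 2) ≤ 2 := by
            rw [div_le_iff₀ (by linarith)]
            linarith
          have hq0 : 0 ≤ (n : ℝ) / ((n : ℝ) - 2) := div_nonneg (by linarith) (by linarith)
          exact mul_le_mul_of_nonneg_right
            (mul_le_mul_of_nonneg_right (pow_le_pow_left₀ hq0 hq 2) (by norm_num)) hs0
      _ = _ := by ring
  nlinarith

theorem sum_sum_main_sq_le (hn : 4 ≤ n) (R : Fin n → Fin n → ℝ) :
    ∑ a, ∑ b, (if a = b then 0 else (mainEffect n R a + mainEffect n R b)) ^ 2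
      ≤ 26 * ((n : ℝ) ^ 2 * r1sq n R) := by
  calc ∑ a, ∑ b, (if a = b then 0 else (mainEffect n R a + mainEffect n R b)) ^ 2
      ≤ ∑ a, ∑ b, (2 * mainEffect n R a ^ 2 + 2 * mainEffect n R b ^ 2) := by
        refine sum_le_sum fun a _ => sum_le_sum fun b _ => ?_
        split_ifs
        · rw [zero_pow two_ne_zero]
          positivity
        · nlinarith [sq_nonneg (mainEffect n R a - mainEffect n R b)]
    _ = 4 * n * ∑ a, mainEffect n R a ^ 2 := by
        simp only [sum_add_distrib, sum_const, card_univ, Fintype.card_fin, nsmul_eq_mul,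
          ← mul_sum]
        ring
    _ ≤ 4 * n * (13 / 2 * (n * r1sq n R)) := by
        gcongr
        exact sum_mainEffect_sq_le hn R
    _ = _ := by ring

theorem sum_sum_gram_le_cycles {ι : Type*} [Fintype ι] [DecidableEq ι] {R : ι → ι → ℝ}
    (hs : ∀ i j, R i j = R j i) (hd : ∀ i, R i i = 0) :
    ∑ b, ∑ b', (∑ a, R a b * R a b') ^ 2
      ≤ (∑ i, ∑ j, ∑ k, ∑ l, if k ≠ i ∧ k ≠ j ∧ l ≠ i ∧ l ≠ j then
          R i j * R k l * (R i k * R j l + R i l * R j k) else 0) / 2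
        + 2 * ∑ i, (∑ j, R i j ^ 2) ^ 2 := by
  have e1 : ∑ b, ∑ b', (∑ a, R a b * R a b') ^ 2
      = ∑ i, ∑ j, ∑ k, ∑ l, R i j * R k l * (R i k * R j l) := by
    refine sum_congr rfl fun i _ => ?_
    rw [sum_congr rfl fun l _ => by rw [sq, sum_mul_sum], sum_comm]
    refine sum_congr rfl fun j _ => ?_
    rw [sum_comm]
    refine sum_congr rfl fun k _ => sum_congr rfl fun l _ => ?_
    rw [hs i j, hs i k]
    ring
  have e2 : (∑ i, ∑ j, ∑ k, ∑ l, if k ≠ i ∧ k ≠ j ∧ l ≠ i ∧ l ≠ j then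
          R i j * R k l * (R i k * R j l + R i l * R j k) else 0)
      = 2 * ∑ i, ∑ j, ∑ k, ∑ l, if k ≠ i ∧ k ≠ j ∧ l ≠ i ∧ l ≠ j then
          R i j * R k l * (R i k * R j l) else 0 := by
    rw [mul_sum]
    refine sum_congr rfl fun i _ => ?_
    rw [mul_sum]
    refine sum_congr rfl fun j _ => ?_
    rw [two_mul]
    nth_rewrite 3 [sum_comm]
    simp only [← sum_add_distrib]
    refine sum_congr rfl fun k _ => sum_congr rfl fun l _ => ?_
    rw [hs l k]
    have hiff : (l ≠ i ∧ l ≠ j ∧ k ≠ i ∧ k ≠ j) ↔ (k ≠ i ∧ k ≠ j ∧ l ≠ i ∧ l ≠ j) := by tauto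
    simp only [hiff]
    split_ifs <;> ring
  have e3 : ∑ i, ∑ j, ∑ k, ∑ l, (if k = j then R i j ^ 2 * R j l ^ 2 else 0)
      = ∑ i, (∑ j, R i j ^ 2) ^ 2 := by
    rw [sum_comm]
    refine sum_congr rfl fun j _ => ?_
    rw [sq, sum_mul_sum]
    refine sum_congr rfl fun i _ => ?_
    rw [sum_comm]
    simp [hs i j]
  have e4 : ∑ i, ∑ j, ∑ k, ∑ l, (if l = i then R i j ^ 2 * R i k ^ 2 else 0)
      = ∑ i, (∑ j, R i j ^ 2) ^ 2 := by
    refine sum_congr rfl fun i _ => ?_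
    rw [sq, sum_mul_sum]
    simp
  rw [e2, mul_div_cancel_left₀ _ (two_ne_zero), two_mul, e1]
  nth_rewrite 1 [← e3]
  rw [← e4]
  simp only [← sum_add_distrib]
  refine sum_le_sum fun i _ => sum_le_sum fun j _ => sum_le_sum fun k _ => sum_le_sum fun l _ => ?_
  by_cases hki : k = i
  · subst hki
    simp only [hd, zero_mul, mul_zero]
    split_ifs <;> positivity
  by_cases hlj : l = j
  · subst hlj
    simp only [hd, mul_zero]
    split_ifs <;> positivity
  by_cases hkj : k = j
  · subst hkj
    have : 0 ≤ if l = i then R i k ^ 2 * R i k ^ 2 else 0 := by split_ifs <;> positivity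
    simp only [ne_eq, not_true, false_and, and_false, if_false, if_true, zero_add]
    nlinarith
  by_cases hli : l = i
  · subst hli
    simp only [ne_eq, not_true, false_and, and_false, if_false, if_true, zero_add, hkj]
    rw [hs k l, hs j l]
    nlinarith
  simp [hki, hlj, hkj, hli]

end MatrixBounds

section Asymptotic

variable {R : (n : ℕ) → Fin n → Fin n → ℝ}

theorem eventually_gram_le (hsym : ∀ n (i j : Fin n), R n i j = R n j i)
    (hdiag : ∀ n (i : Fin n), R n i i = 0) (hC1 : Cond1 R) (hC5 : Cond5 R) {ε : ℝ} (hε : 0 < ε) :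
    ∀ᶠ n in atTop, ∑ b, ∑ b', (∑ a, R n a b * R n a b') ^ 2
      ≤ ε * (∑ a, ∑ b, R n a b ^ 2) ^ 2 := by
  obtain ⟨C, hC0, hC⟩ := hC1.exists_pos
  have h5 := hC5.def (show (0 : ℝ) < ε / 4 by positivity)
  have hlarge : ∀ᶠ n : ℕ in atTop, 16 * C / ε ≤ n :=
    tendsto_natCast_atTop_atTop.eventually_ge_atTop _
  filter_upwards [hC.bound, h5, hlarge, eventually_ge_atTop 2] with n h1 h5 hl hn
  have hN : (2 : ℝ) ≤ n := by exact_mod_cast hn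
  rw [sum_sum_sq_eq hn (R n)]
  refine (sum_sum_gram_le_cycles (hsym n) (hdiag n)).trans ?_
  rw [Real.norm_of_nonneg (by positivity)] at h1
  rw [Real.norm_of_nonneg (by positivity)] at h1
  rw [Real.norm_of_nonneg (r := (n : ℝ) ^ 4 * _) (by positivity), Real.norm_eq_abs] at h5
  have h6 := (le_abs_self _).trans h5
  generalize rdsq n (R n) = r at *
  have h7 : 16 * C * n ^ 3 * r ^ 2 ≤ ε * n ^ 4 * r ^ 2 := by
    rw [div_le_iff₀ hε] at hl
    calc 16 * C * n ^ 3 * r ^ 2 ≤ (n * ε) * n ^ 3 * r ^ 2 := by gcongr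
      _ = _ := by ring
  have h8 : ε * (n ^ 4 * r ^ 2) ≤ ε * (4 * (n * ((n : ℝ) - 1) * r) ^ 2) := by
    refine mul_le_mul_of_nonneg_left ?_ hε.le
    have : (n : ℝ) ^ 2 ≤ 4 * ((n : ℝ) - 1) ^ 2 := by nlinarith
    calc (n : ℝ) ^ 4 * r ^ 2 = n ^ 2 * (n ^ 2 * r ^ 2) := by ring
      _ ≤ 4 * ((n : ℝ) - 1) ^ 2 * (n ^ 2 * r ^ 2) := by gcongr
      _ = _ := by ring
  nlinarith

theorem eventually_main_le (hC6 : Cond6 R) {ε : ℝ} (hε : 0 < ε) :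
    ∀ᶠ n in atTop,
      ∑ a, ∑ b, (if a = b then 0 else (mainEffect n (R n) a + mainEffect n (R n) b)) ^ 2
        ≤ ε * ∑ a, ∑ b, R n a b ^ 2 := by
  have h6 := hC6.def (show (0 : ℝ) < Real.sqrt (ε / 52) by positivity)
  filter_upwards [h6, eventually_ge_atTop 4] with n h6 hn
  have hN : (4 : ℝ) ≤ n := by exact_mod_cast hn
  rw [sum_sum_sq_eq (by omega) (R n)]
  refine (sum_sum_main_sq_le hn (R n)).trans ?_
  have hr : 0 ≤ rdsq n (R n) := div_nonneg
    (sum_nonneg fun _ _ => sum_nonneg fun _ _ => sq_nonneg _)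
    (mul_nonneg (by linarith) (by linarith))
  rw [Real.norm_of_nonneg (Real.sqrt_nonneg _), Real.norm_of_nonneg (Real.sqrt_nonneg _),
    ← Real.sqrt_mul (by positivity), Real.sqrt_le_sqrt_iff (by positivity)] at h6
  have h7 : (n : ℝ) ^ 2 ≤ 2 * (n * ((n : ℝ) - 1)) := by nlinarith
  calc 26 * ((n : ℝ) ^ 2 * r1sq n (R n)) ≤ 26 * (n ^ 2 * (ε / 52 * rdsq n (R n))) := by gcongr
    _ ≤ 26 * (2 * (n * ((n : ℝ) - 1)) * (ε / 52 * rdsq n (R n))) := by gcongr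
    _ = _ := by ring

theorem eventually_interaction_gram_le (hsym : ∀ n (i j : Fin n), R n i j = R n j i)
    (hdiag : ∀ n (i : Fin n), R n i i = 0) (hC1 : Cond1 R) (hC5 : Cond5 R) (hC6 : Cond6 R)
    {ε : ℝ} (hε : 0 < ε) :
    ∀ᶠ n in atTop,
      ∑ b, ∑ b', (∑ a, interaction n (R n) a b * interaction n (R n) a b') ^ 2
        ≤ ε * (∑ a, ∑ b, interaction n (R n) a b ^ 2) ^ 2 := by
  set η := min (1 / 4) (ε / 288) with hη
  have hη0 : 0 < η := by positivity
  filter_upwards [eventually_gram_le hsym hdiag hC1 hC5 hη0, eventually_main_le hC6 hη0]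
    with n h1 h2
  refine (sum_sum_gram_perturb_le (min_le_left _ _) hη0.le
    (eq_interaction_add (hdiag n)) h1 h2).trans ?_
  have : η ≤ ε / 288 := min_le_right _ _
  gcongr
  linarith

theorem eventually_abs_Rbar_sub_le (hC2 : Cond2 R) {ε : ℝ} (hε : 0 < ε) :
    ∀ᶠ n in atTop, ∀ a, |Rbar n (R n) a - r0 n (R n)|
      ≤ ε * Real.sqrt (∑ a, (Rbar n (R n) a - r0 n (R n)) ^ 2) := by
  have h2 := hC2.def (show (0 : ℝ) < ε ^ 3 by positivity)
  filter_upwards [h2, eventually_ge_atTop 1] with n h2 hn a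
  rw [← sum_Rbar_sub_sq (by omega)] at h2
  have hs : 0 ≤ ∑ a, (Rbar n (R n) a - r0 n (R n)) ^ 2 := sum_nonneg fun _ _ => sq_nonneg _
  set s := ∑ a, (Rbar n (R n) a - r0 n (R n)) ^ 2
  have e : s ^ ((3 : ℝ) / 2) = Real.sqrt s ^ 3 := by
    rw [Real.sqrt_eq_rpow, ← Real.rpow_natCast, ← Real.rpow_mul hs]
    norm_num
  rw [e, Real.norm_of_nonneg (by positivity), Real.norm_of_nonneg (by positivity), ← mul_pow] at h2
  refine le_of_pow_le_pow_left₀ (n := 3) (by norm_num) (by positivity) (le_trans ?_ h2)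
  exact single_le_sum (f := fun a => |Rbar n (R n) a - r0 n (R n)| ^ 3)
    (fun _ _ => by positivity) (mem_univ a)

end Asymptotic

section Limits

theorem norm_expect_exp_sub_le {α : Type*} [Fintype α] [Nonempty α] (X Y : α → ℝ) (t : ℝ) :
    ‖𝔼 x, Complex.exp ((t * X x : ℝ) * Complex.I) - 𝔼 x, Complex.exp ((t * Y x : ℝ) * Complex.I)‖
      ≤ |t| * 𝔼 x, |X x - Y x| := by
  rw [← expect_sub_distrib, mul_expect]
  refine (RCLike.norm_expect_le (K := ℂ)).trans (expect_le_expect fun x _ => ?_)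
  have e : Complex.exp ((t * X x : ℝ) * Complex.I) - Complex.exp ((t * Y x : ℝ) * Complex.I)
      = Complex.exp ((t * Y x : ℝ) * Complex.I)
        * (Complex.exp ((t * (X x - Y x) : ℝ) * Complex.I) - 1) := by
    rw [mul_sub, mul_one, ← Complex.exp_add]
    congr 2
    push_cast
    ring
  rw [e, norm_mul, Complex.norm_exp_ofReal_mul_I, one_mul, ← abs_mul]
  exact norm_exp_mul_I_sub_one_le _

variable {Ω : ℕ → Type*} [∀ n, Fintype (Ω n)] [∀ n, Nonempty (Ω n)]

theorem tendsto_expect_sq_of_expect_sub_sq {X Y : ∀ n, Ω n → ℝ}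
    (h : Tendsto (fun n => 𝔼 x, (X n x - Y n x) ^ 2) atTop (𝓝 0))
    (hY : Tendsto (fun n => 𝔼 x, Y n x ^ 2) atTop (𝓝 1)) :
    Tendsto (fun n => 𝔼 x, X n x ^ 2) atTop (𝓝 1) := by
  have hc : Tendsto (fun n => 𝔼 x, Y n x * (X n x - Y n x)) atTop (𝓝 0) := by
    have h2 : Tendsto (fun n => Real.sqrt ((𝔼 x, Y n x ^ 2) * 𝔼 x, (X n x - Y n x) ^ 2)) atTop
        (𝓝 0) := by
      have := (hY.mul h).sqrt
      simpa using this
    refine squeeze_zero_norm (fun n => ?_) h2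
    exact Real.abs_le_sqrt (expect_mul_sq_le_sq_mul_sq univ _ _)
  have e : ∀ n, 𝔼 x, X n x ^ 2
      = 𝔼 x, Y n x ^ 2 + 2 * 𝔼 x, Y n x * (X n x - Y n x) + 𝔼 x, (X n x - Y n x) ^ 2 := by
    intro n
    rw [mul_expect, ← expect_add_distrib, ← expect_add_distrib]
    exact expect_congr rfl fun x _ => by ring
  simp only [e]
  simpa using (hY.add (hc.const_mul 2)).add h

theorem tendsto_expect_div_sqrt_sub_sq {X Y : ∀ n, Ω n → ℝ}
    (h : Tendsto (fun n => 𝔼 x, (X n x - Y n x) ^ 2) atTop (𝓝 0))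
    (hY : Tendsto (fun n => 𝔼 x, Y n x ^ 2) atTop (𝓝 1)) :
    Tendsto (fun n => 𝔼 x, (X n x / Real.sqrt (𝔼 y, X n y ^ 2) - Y n x) ^ 2) atTop (𝓝 0) := by
  have hX := tendsto_expect_sq_of_expect_sub_sq h hY
  have h1 : Tendsto (fun n => 2 * ((1 / Real.sqrt (𝔼 y, X n y ^ 2) - 1) ^ 2 * 𝔼 x, X n x ^ 2)
      + 2 * 𝔼 x, (X n x - Y n x) ^ 2) atTop (𝓝 0) := by
    have h3 : Tendsto (fun n => 1 / Real.sqrt (𝔼 y, X n y ^ 2)) atTop (𝓝 (1 / Real.sqrt 1)) :=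
      tendsto_const_nhds.div hX.sqrt (by simp)
    have := ((((h3.sub_const 1).pow 2).mul hX).const_mul 2).add (h.const_mul 2)
    simpa using this
  refine squeeze_zero (fun n => expect_nonneg fun _ _ => sq_nonneg _) (fun n => ?_) h1
  rw [mul_expect, mul_expect, mul_expect, ← expect_add_distrib]
  refine expect_le_expect fun x _ => ?_
  generalize Real.sqrt (𝔼 y, X n y ^ 2) = s
  have : X n x / s - Y n x = (1 / s - 1) * X n x + (X n x - Y n x) := by ring
  rw [this]
  nlinarith [sq_nonneg ((1 / s - 1) * X n x - (X n x - Y n x))]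

theorem tendsto_expect_exp_sub {S : Type*} [Fintype S] {X Y : ∀ n, S → Ω n → ℝ} (a : S → ℝ)
    (t : ℝ) (h : ∀ s, Tendsto (fun n => 𝔼 x, (X n s x - Y n s x) ^ 2) atTop (𝓝 0)) :
    Tendsto (fun n => 𝔼 x, Complex.exp ((t * ∑ s, a s * X n s x : ℝ) * Complex.I)
      - 𝔼 x, Complex.exp ((t * ∑ s, a s * Y n s x : ℝ) * Complex.I)) atTop (𝓝 0) := by
  have h1 : Tendsto (fun n => |t| * ∑ s, |a s| * Real.sqrt (𝔼 x, (X n s x - Y n s x) ^ 2)) atTop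
      (𝓝 0) := by
    have := (tendsto_finsetSum univ fun s _ => ((h s).sqrt).const_mul |a s|).const_mul |t|
    simpa using this
  refine squeeze_zero_norm (fun n => ?_) h1
  refine (norm_expect_exp_sub_le (fun x => ∑ s, a s * X n s x) (fun x => ∑ s, a s * Y n s x)
    t).trans (mul_le_mul_of_nonneg_left ?_ (abs_nonneg t))
  calc 𝔼 x, |∑ s, a s * X n s x - ∑ s, a s * Y n s x|
      ≤ 𝔼 x, ∑ s, |a s| * |X n s x - Y n s x| := by
        refine expect_le_expect fun x _ => ?_
        rw [← sum_sub_distrib]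
        refine (abs_sum_le_sum_abs _ _).trans (le_of_eq (sum_congr rfl fun s _ => ?_))
        rw [← mul_sub, abs_mul]
    _ = ∑ s, |a s| * 𝔼 x, |X n s x - Y n s x| := by
        rw [expect_sum_comm]
        simp only [← mul_expect]
    _ ≤ _ := sum_le_sum fun s _ => mul_le_mul_of_nonneg_left
        (expect_abs_le_sqrt _ le_rfl) (abs_nonneg _)

end Limits

section FormArray

/-- The product kernel `g x * g y`. -/
def prodKer {κ : Type*} (g : κ → ℝ) (x y : κ) : ℝ := g x * g y

/-- A triangular array of degenerate quadratic forms with matrices `M`, linear forms with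
coefficients `β`, and score functions `g` with limiting covariances `ρ`. -/
structure FormArray {L : Type*} (M : (n : ℕ) → Fin n → Fin n → ℝ) (β : (n : ℕ) → Fin n → ℝ)
    (g : (n : ℕ) → L → Fin n → ℝ) (K B : ℝ) (ρ : L → L → ℝ) : Prop where
  symm : ∀ n a b, M n a b = M n b a
  diag : ∀ n a, M n a a = 0
  sum_row : ∀ᶠ n in atTop, ∀ a, ∑ b, M n a b = 0
  sum_coeff : ∀ᶠ n in atTop, ∑ a, β n a = 0
  sum_sum_sq : ∀ᶠ n in atTop, ∑ a, ∑ b, M n a b ^ 2 = 1 / 2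
  sum_sq : ∀ᶠ n in atTop, ∑ a, β n a ^ 2 = 1
  gram_le : ∀ ε > 0, ∀ᶠ n in atTop, ∑ b, ∑ b', (∑ a, M n a b * M n a b') ^ 2 ≤ ε
  abs_le : ∀ ε > 0, ∀ᶠ n in atTop, ∀ a, |β n a| ≤ ε
  score_le : ∀ᶠ n in atTop, ∀ l x, |g n l x| ≤ K
  expect_score : ∀ᶠ n in atTop, ∀ l, 𝔼 x, g n l x = 0
  sorted_le : ∀ᶠ n in atTop, ∀ l,
    𝔼 c : Fin n → Fin n, ∑ i, (g n l i - g n l (sorted c i)) ^ 2 ≤ B * Real.sqrt n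
  cov : ∀ l l', Tendsto (fun n => 𝔼 x, g n l x * g n l' x) atTop (𝓝 (ρ l l'))
  cov_self : ∀ l, ρ l l = 1

theorem expect_prod_eq {A B E : Type*} [Fintype A] [Fintype B] [AddCommMonoid E] [Module ℚ≥0 E]
    (f : A × B → E) : 𝔼 x, f x = 𝔼 a, 𝔼 b, f (a, b) := by
  rw [← univ_product_univ, expect_product]

instance (n : ℕ) : Nonempty (Fin n → Fin n) := ⟨id⟩

theorem tendsto_const_mul_sqrt_div (C : ℝ) :
    Tendsto (fun n : ℕ => C * (4 / Real.sqrt n)) atTop (𝓝 0) := by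
  have h : Tendsto (fun n : ℕ => Real.sqrt n) atTop atTop :=
    Real.tendsto_sqrt_atTop.comp tendsto_natCast_atTop_atTop
  simpa using (h.const_div_atTop 4).const_mul C

theorem sqrt_div_le {n : ℕ} (hn : 4 ≤ n) : Real.sqrt n / ((n : ℝ) - 3) ≤ 4 / Real.sqrt n := by
  have hN : (4 : ℝ) ≤ n := by exact_mod_cast hn
  rw [div_le_div_iff₀ (by linarith) (Real.sqrt_pos.2 (by linarith)),
    Real.mul_self_sqrt (by linarith)]
  linarith

variable {L : Type*} [Fintype L] {M : (n : ℕ) → Fin n → Fin n → ℝ} {β : (n : ℕ) → Fin n → ℝ}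
  {g : (n : ℕ) → L → Fin n → ℝ} {K B : ℝ} {ρ : L → L → ℝ}

theorem FormArray.tendsto_lin_sub (H : FormArray M β g K B ρ) (l : L) :
    Tendsto (fun n => 𝔼 x : (Fin n → Fin n) × Equiv.Perm (Fin n),
      (lin (β n) (g n l) ⇑x.2⁻¹ - lin (β n) (g n l) (coupled x.2 x.1)) ^ 2) atTop (𝓝 0) := by
  refine squeeze_zero' (Eventually.of_forall fun n => expect_nonneg fun _ _ => sq_nonneg _) ?_
    (tendsto_const_mul_sqrt_div B)
  filter_upwards [H.sum_coeff, H.sum_sq, H.sorted_le, eventually_ge_atTop 4] with n h1 h2 h3 hn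
  have hN : (4 : ℝ) ≤ n := by exact_mod_cast hn
  rw [expect_prod_eq]
  have h4 := expect_lin_sub_coupled_sq_le (by omega) h1 (g n l) (h3 l)
  rw [h2, one_mul] at h4
  have hB : 0 ≤ B * Real.sqrt n :=
    (expect_nonneg fun _ _ => sum_nonneg fun _ _ => sq_nonneg _).trans (h3 l)
  have hB0 : 0 ≤ B := nonneg_of_mul_nonneg_left hB (Real.sqrt_pos.2 (by linarith))
  calc _ ≤ B * Real.sqrt n / ((n : ℝ) - 1) := h4
    _ ≤ B * Real.sqrt n / ((n : ℝ) - 3) :=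
        div_le_div_of_nonneg_left hB (by linarith) (by linarith)
    _ = B * (Real.sqrt n / ((n : ℝ) - 3)) := by ring
    _ ≤ _ := mul_le_mul_of_nonneg_left (sqrt_div_le hn) hB0

theorem FormArray.tendsto_quad_sub (H : FormArray M β g K B ρ) (l : L) :
    Tendsto (fun n => 𝔼 x : (Fin n → Fin n) × Equiv.Perm (Fin n),
      (quad (M n) (prodKer (g n l)) ⇑x.2⁻¹ - quad (M n) (prodKer (g n l)) (coupled x.2 x.1)) ^ 2)
      atTop (𝓝 0) := by
  refine squeeze_zero' (Eventually.of_forall fun n => expect_nonneg fun _ _ => sq_nonneg _) ?_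
    (tendsto_const_mul_sqrt_div (4 * K ^ 2 * B))
  filter_upwards [H.sum_row, H.sum_sum_sq, H.sorted_le, H.score_le, eventually_ge_atTop 4]
    with n h1 h2 h3 h5 hn
  have hN : (4 : ℝ) ≤ n := by exact_mod_cast hn
  rw [expect_prod_eq]
  have h4 := expect_quad_sub_coupled_sq_le hn (H.symm n) (H.diag n) h1 (h5 l) (h3 l)
  rw [h2] at h4
  have hB : 0 ≤ B * Real.sqrt n :=
    (expect_nonneg fun _ _ => sum_nonneg fun _ _ => sq_nonneg _).trans (h3 l)
  have hB0 : 0 ≤ B := nonneg_of_mul_nonneg_left hB (Real.sqrt_pos.2 (by linarith))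
  calc _ ≤ 8 * K ^ 2 * (1 / 2) * (B * Real.sqrt n) / ((n : ℝ) - 3) := h4
    _ = 4 * K ^ 2 * B * (Real.sqrt n / ((n : ℝ) - 3)) := by ring
    _ ≤ _ := mul_le_mul_of_nonneg_left (sqrt_div_le hn) (by positivity)

theorem expect_pair_coupled {n : ℕ} {E : Type*} [AddCommGroup E] [Module ℚ≥0 E]
    (F : (Fin n → Fin n) → E) :
    𝔼 x : (Fin n → Fin n) × Equiv.Perm (Fin n), F (coupled x.2 x.1) = 𝔼 c, F c := by
  rw [expect_prod_eq]
  exact expect_coupled F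

theorem expect_pair_snd {n : ℕ} {E : Type*} [AddCommGroup E] [Module ℚ≥0 E]
    (F : Equiv.Perm (Fin n) → E) :
    𝔼 x : (Fin n → Fin n) × Equiv.Perm (Fin n), F x.2 = 𝔼 π, F π := by
  rw [expect_prod_eq]
  exact Fintype.expect_const (ι := Fin n → Fin n) (𝔼 π, F π)

theorem expect_prodKer {κ : Type*} [Fintype κ] {g : κ → ℝ} (h : 𝔼 x, g x = 0) (x : κ) :
    𝔼 y, prodKer g x y = 0 := by
  simp only [prodKer]
  rw [← mul_expect, h, mul_zero]

theorem expect_expect_mul {κ : Type*} [Fintype κ] (f h : κ → ℝ) :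
    𝔼 x, 𝔼 y, f x * h y = (𝔼 x, f x) * 𝔼 y, h y := by
  rw [expect_mul]
  exact expect_congr rfl fun x _ => (mul_expect _ _ _).symm

theorem FormArray.tendsto_lin_sq (H : FormArray M β g K B ρ) (l : L) :
    Tendsto (fun n => 𝔼 x : (Fin n → Fin n) × Equiv.Perm (Fin n),
      lin (β n) (g n l) (coupled x.2 x.1) ^ 2) atTop (𝓝 1) := by
  have h := H.cov l l
  rw [H.cov_self] at h
  refine h.congr' ?_
  filter_upwards [H.sum_sq, H.expect_score, eventually_ge_atTop 1] with n h2 h3 hn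
  have : NeZero n := ⟨by omega⟩
  rw [expect_pair_coupled fun c => lin (β n) (g n l) c ^ 2]
  simp only [lin]
  rw [expect_sum_sq univ _ (h3 l), h2, one_mul]
  simp only [sq]

theorem FormArray.tendsto_quad_sq (H : FormArray M β g K B ρ) (l : L) :
    Tendsto (fun n => 𝔼 x : (Fin n → Fin n) × Equiv.Perm (Fin n),
      quad (M n) (prodKer (g n l)) (coupled x.2 x.1) ^ 2) atTop (𝓝 1) := by
  have h := (H.cov l l).pow 2
  rw [H.cov_self, one_pow] at h
  refine h.congr' ?_
  filter_upwards [H.sum_sum_sq, H.expect_score, eventually_ge_atTop 1] with n h2 h3 hn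
  have : NeZero n := ⟨by omega⟩
  rw [expect_pair_coupled fun c => quad (M n) (prodKer (g n l)) c ^ 2,
    expect_quad_sq (w := prodKer (g n l)) (H.symm n) (H.diag n) (fun x y => mul_comm _ _)
      (expect_prodKer (h3 l)), h2]
  simp only [prodKer, mul_pow, expect_expect_mul]
  simp only [sq]
  ring

/-- The normalised quadratic and linear statistics of a permutation. -/
noncomputable def permForm {L : Type*} {n : ℕ} (M : Fin n → Fin n → ℝ) (β : Fin n → ℝ)
    (g : L → Fin n → ℝ) (s : L ⊕ L) (π : Equiv.Perm (Fin n)) : ℝ :=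
  Sum.elim
    (fun l => quad M (prodKer (g l)) ⇑π⁻¹ / Real.sqrt (𝔼 σ : Equiv.Perm (Fin n),
      quad M (prodKer (g l)) ⇑σ⁻¹ ^ 2))
    (fun l => lin β (g l) ⇑π⁻¹ / Real.sqrt (𝔼 σ : Equiv.Perm (Fin n), lin β (g l) ⇑σ⁻¹ ^ 2)) s

/-- The quadratic and linear statistics of a colouring. -/
noncomputable def colForm {L : Type*} {n : ℕ} (M : Fin n → Fin n → ℝ) (β : Fin n → ℝ)
    (g : L → Fin n → ℝ) (s : L ⊕ L) (c : Fin n → Fin n) : ℝ :=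
  Sum.elim (fun l => quad M (prodKer (g l)) c) (fun l => lin β (g l) c) s

theorem FormArray.tendsto_permForm_sub (H : FormArray M β g K B ρ) (s : L ⊕ L) :
    Tendsto (fun n => 𝔼 x : (Fin n → Fin n) × Equiv.Perm (Fin n),
      (permForm (M n) (β n) (g n) s x.2 - colForm (M n) (β n) (g n) s (coupled x.2 x.1)) ^ 2)
      atTop (𝓝 0) := by
  rcases s with l | l
  · have h := tendsto_expect_div_sqrt_sub_sq (H.tendsto_quad_sub l) (H.tendsto_quad_sq l)
    simpa only [permForm, colForm, Sum.elim_inl,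
      expect_pair_snd fun π => quad (M _) (prodKer (g _ l)) ⇑π⁻¹ ^ 2] using h
  · have h := tendsto_expect_div_sqrt_sub_sq (H.tendsto_lin_sub l) (H.tendsto_lin_sq l)
    simpa only [permForm, colForm, Sum.elim_inr,
      expect_pair_snd fun π => lin (β _) (g _ l) ⇑π⁻¹ ^ 2] using h

theorem sum_colForm {n : ℕ} (M : Fin n → Fin n → ℝ) (β : Fin n → ℝ) (g : L → Fin n → ℝ)
    (a : L ⊕ L → ℝ) (c : Fin n → Fin n) :
    ∑ s, a s * colForm M β g s c
      = quad M (fun x y => ∑ l, a (Sum.inl l) * prodKer (g l) x y) c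
        + lin β (fun x => ∑ l, a (Sum.inr l) * g l x) c := by
  simp only [Fintype.sum_sum_type, colForm, Sum.elim_inl, Sum.elim_inr, quad, lin, mul_sum]
  congr 1
  · rw [sum_comm]
    refine sum_congr rfl fun i _ => ?_
    rw [sum_comm]
    exact sum_congr rfl fun j _ => sum_congr rfl fun l _ => by ring
  · rw [sum_comm]
    exact sum_congr rfl fun j _ => sum_congr rfl fun l _ => by ring

theorem expect_expect_sum_prodKer_sq {κ : Type*} [Fintype κ] (a : L → ℝ) (g : L → κ → ℝ) :
    𝔼 x, 𝔼 y, (∑ l, a l * prodKer (g l) x y) ^ 2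
      = ∑ l, ∑ l', a l * a l' * (𝔼 x, g l x * g l' x) ^ 2 := by
  have e : ∀ x y, (∑ l, a l * prodKer (g l) x y) ^ 2
      = ∑ l, ∑ l', a l * a l' * ((g l x * g l' x) * (g l y * g l' y)) := fun x y => by
    rw [sq, sum_mul_sum]
    exact sum_congr rfl fun l _ => sum_congr rfl fun l' _ => by simp only [prodKer]; ring
  simp only [e, expect_sum_comm, ← mul_expect, ← expect_mul]
  simp only [← sq]

theorem expect_sum_score_sq {κ : Type*} [Fintype κ] (a : L → ℝ) (g : L → κ → ℝ) :
    𝔼 x, (∑ l, a l * g l x) ^ 2 = ∑ l, ∑ l', a l * a l' * 𝔼 x, g l x * g l' x := by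
  have e : ∀ x, (∑ l, a l * g l x) ^ 2 = ∑ l, ∑ l', a l * a l' * (g l x * g l' x) := fun x => by
    rw [sq, sum_mul_sum]
    exact sum_congr rfl fun l _ => sum_congr rfl fun l' _ => by ring
  simp only [e, expect_sum_comm, ← mul_expect]

/-- The limiting covariance matrix of the normalised quadratic and linear statistics. -/
def limitCov (ρ : L → L → ℝ) : Matrix (L ⊕ L) (L ⊕ L) ℝ :=
  Matrix.fromBlocks (Matrix.of fun l l' => ρ l l' ^ 2) 0 0 (Matrix.of ρ)

theorem sum_limitCov (ρ : L → L → ℝ) (a : L ⊕ L → ℝ) :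
    ∑ s, ∑ s', a s * a s' * limitCov ρ s s'
      = (∑ l, ∑ l', a (Sum.inr l) * a (Sum.inr l') * ρ l l')
        + ∑ l, ∑ l', a (Sum.inl l) * a (Sum.inl l') * ρ l l' ^ 2 := by
  simp [limitCov, Fintype.sum_sum_type, add_comm]

theorem FormArray.tendsto_variance (H : FormArray M β g K B ρ) (a : L ⊕ L → ℝ) :
    Tendsto (fun n => 𝔼 x, (∑ l, a (Sum.inr l) * g n l x) ^ 2
      + 𝔼 x, 𝔼 y, (∑ l, a (Sum.inl l) * prodKer (g n l) x y) ^ 2) atTop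
      (𝓝 (∑ s, ∑ s', a s * a s' * limitCov ρ s s')) := by
  simp only [expect_expect_sum_prodKer_sq]
  simp only [expect_sum_score_sq, sum_limitCov]
  exact (tendsto_finsetSum _ fun l _ => tendsto_finsetSum _ fun l' _ =>
    (H.cov l l').const_mul _).add (tendsto_finsetSum _ fun l _ => tendsto_finsetSum _ fun l' _ =>
    ((H.cov l l').pow 2).const_mul _)

theorem FormArray.sum_limitCov_nonneg (H : FormArray M β g K B ρ) (a : L ⊕ L → ℝ) :
    0 ≤ ∑ s, ∑ s', a s * a s' * limitCov ρ s s' :=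
  ge_of_tendsto' (H.tendsto_variance a) fun _ => add_nonneg
    (expect_nonneg fun _ _ => sq_nonneg _)
    (expect_nonneg fun _ _ => expect_nonneg fun _ _ => sq_nonneg _)

theorem FormArray.cov_comm (H : FormArray M β g K B ρ) (l l' : L) : ρ l l' = ρ l' l :=
  tendsto_nhds_unique (H.cov l l') <| by simpa only [mul_comm] using H.cov l' l

theorem FormArray.posSemidef (H : FormArray M β g K B ρ) : (limitCov ρ).PosSemidef := by
  refine Matrix.PosSemidef.of_dotProduct_mulVec_nonneg ?_ fun a => ?_
  · ext s s'
    rcases s with l | l <;> rcases s' with l' | l' <;> simp [limitCov, H.cov_comm l' l]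
  · refine (H.sum_limitCov_nonneg a).trans_eq ?_
    simp only [dotProduct, Matrix.mulVec, mul_sum]
    exact sum_congr rfl fun s _ => sum_congr rfl fun s' _ => by
      simp only [Pi.star_apply, star_trivial]
      ring

theorem FormArray.tendsto_expect_exp_colForm (H : FormArray M β g K B ρ) (a : L ⊕ L → ℝ) (t : ℝ) :
    Tendsto (fun n => 𝔼 c : Fin n → Fin n,
      Complex.exp ((t * ∑ s, a s * colForm (M n) (β n) (g n) s c : ℝ) * Complex.I)) atTop
      (𝓝 (Complex.exp (-((∑ s, ∑ s', a s * a s' * limitCov ρ s s') * t ^ 2 / 2 : ℝ)))) := by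
  have hv : Tendsto (fun n => Complex.exp (-((𝔼 x, (∑ l, a (Sum.inr l) * g n l x) ^ 2
      + 𝔼 x, 𝔼 y, (∑ l, a (Sum.inl l) * prodKer (g n l) x y) ^ 2) * t ^ 2 / 2 : ℝ))) atTop
      (𝓝 (Complex.exp (-((∑ s, ∑ s', a s * a s' * limitCov ρ s s') * t ^ 2 / 2 : ℝ)))) := by
    have hc : Continuous fun x : ℝ => Complex.exp (-(x * t ^ 2 / 2 : ℝ)) := by fun_prop
    exact (hc.tendsto _).comp (H.tendsto_variance a)
  set A := ∑ s, |a s| with hA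
  set K' := A * K ^ 2 + A * |K| with hK'
  have hA0 : 0 ≤ A := sum_nonneg fun _ _ => abs_nonneg _
  have hA1 : ∑ l, |a (Sum.inl l)| ≤ A := by
    rw [hA, Fintype.sum_sum_type]
    exact le_add_of_nonneg_right (sum_nonneg fun _ _ => abs_nonneg _)
  have hA2 : ∑ l, |a (Sum.inr l)| ≤ A := by
    rw [hA, Fintype.sum_sum_type]
    exact le_add_of_nonneg_left (sum_nonneg fun _ _ => abs_nonneg _)
  set D := (1 + 50 * K' ^ 2 + 600 * K' ^ 4) * (|t| + t ^ 2) * |t| with hD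
  have hD0 : 0 ≤ D := by positivity
  have h0 : Tendsto (fun n => 𝔼 c : Fin n → Fin n,
      Complex.exp ((t * ∑ s, a s * colForm (M n) (β n) (g n) s c : ℝ) * Complex.I)
      - Complex.exp (-((𝔼 x, (∑ l, a (Sum.inr l) * g n l x) ^ 2
      + 𝔼 x, 𝔼 y, (∑ l, a (Sum.inl l) * prodKer (g n l) x y) ^ 2) * t ^ 2 / 2 : ℝ)))
      atTop (𝓝 0) := by
    refine Metric.tendsto_nhds.2 fun ε hε => ?_
    set δ := min 1 (ε / (2 * (D + 1))) with hδ
    have hδ0 : 0 < δ := by positivity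
    filter_upwards [H.sum_sum_sq, H.sum_sq, H.gram_le (δ ^ 4) (by positivity), H.abs_le δ hδ0,
      H.score_le, H.expect_score, eventually_ge_atTop 1] with n h1 h2 h3 h4 h5 h6 hn
    have : NeZero n := ⟨by omega⟩
    have S : SmallForm (M n) (fun x y => ∑ l, a (Sum.inl l) * prodKer (g n l) x y) (β n)
        (fun x => ∑ l, a (Sum.inr l) * g n l x) K' δ :=
      { symm := H.symm n
        diag := H.diag n
        symm_ker := fun x y => sum_congr rfl fun l _ => by simp only [prodKer]; ring
        expect_ker := fun x => by
          rw [expect_sum_comm]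
          simp only [← mul_expect, expect_prodKer (h6 _), mul_zero, sum_const_zero]
        expect_fun := by
          rw [expect_sum_comm]
          simp only [← mul_expect, h6, mul_zero, sum_const_zero]
        ker_le := fun x y => by
          calc |∑ l, a (Sum.inl l) * prodKer (g n l) x y|
              ≤ ∑ l, |a (Sum.inl l)| * K ^ 2 := by
                refine (abs_sum_le_sum_abs _ _).trans (sum_le_sum fun l _ => ?_)
                rw [abs_mul, prodKer, abs_mul, sq]
                exact mul_le_mul_of_nonneg_left (mul_le_mul (h5 l x) (h5 l y) (abs_nonneg _)
                  ((abs_nonneg _).trans (h5 l x))) (abs_nonneg _)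
            _ = (∑ l, |a (Sum.inl l)|) * K ^ 2 := (sum_mul _ _ _).symm
            _ ≤ A * K ^ 2 := by gcongr
            _ ≤ K' := le_add_of_nonneg_right (by positivity)
        fun_le := fun x => by
          calc |∑ l, a (Sum.inr l) * g n l x| ≤ ∑ l, |a (Sum.inr l)| * |K| := by
                refine (abs_sum_le_sum_abs _ _).trans (sum_le_sum fun l _ => ?_)
                rw [abs_mul]
                exact mul_le_mul_of_nonneg_left ((h5 l x).trans (le_abs_self K)) (abs_nonneg _)
            _ = (∑ l, |a (Sum.inr l)|) * |K| := (sum_mul _ _ _).symm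
            _ ≤ A * |K| := by gcongr
            _ ≤ K' := le_add_of_nonneg_left (by positivity)
        sum_sq_le := h2.le
        sum_sum_sq_le := by rw [h1]; norm_num
        abs_le := h4
        gram_le := h3
        pos := hδ0
        le_one := min_le_left _ _ }
    have hmain := S.norm_charFun_sub_le t
    have hvar : formVar (M n) (fun x y => ∑ l, a (Sum.inl l) * prodKer (g n l) x y) (β n)
        (fun x => ∑ l, a (Sum.inr l) * g n l x)
        = 𝔼 x, (∑ l, a (Sum.inr l) * g n l x) ^ 2
          + 𝔼 x, 𝔼 y, (∑ l, a (Sum.inl l) * prodKer (g n l) x y) ^ 2 := by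
      rw [formVar, h1, h2]
      ring
    rw [hvar] at hmain
    simp only [sum_colForm]
    rw [dist_zero_right]
    refine hmain.trans_lt ?_
    calc (1 + 50 * K' ^ 2 + 600 * K' ^ 4) * (|t| + t ^ 2) * δ * |t| = D * δ := by rw [hD]; ring
      _ ≤ D * (ε / (2 * (D + 1))) := mul_le_mul_of_nonneg_left (min_le_right _ _) hD0
      _ < ε := by
        rw [← mul_div_assoc, div_lt_iff₀ (by positivity)]
        nlinarith
  simpa using h0.add hv

theorem FormArray.tendsto_expect_exp_permForm (H : FormArray M β g K B ρ) (a : L ⊕ L → ℝ) (t : ℝ) :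
    Tendsto (fun n => 𝔼 π : Equiv.Perm (Fin n),
      Complex.exp ((t * ∑ s, a s * permForm (M n) (β n) (g n) s π : ℝ) * Complex.I)) atTop
      (𝓝 (Complex.exp (-((∑ s, ∑ s', a s * a s' * limitCov ρ s s') * t ^ 2 / 2 : ℝ)))) := by
  have h := tendsto_expect_exp_sub (Ω := fun n => (Fin n → Fin n) × Equiv.Perm (Fin n))
    (X := fun n s x => permForm (M n) (β n) (g n) s x.2)
    (Y := fun n s x => colForm (M n) (β n) (g n) s (coupled x.2 x.1)) a t H.tendsto_permForm_sub
  have e1 : ∀ n, 𝔼 x : (Fin n → Fin n) × Equiv.Perm (Fin n),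
      Complex.exp ((t * ∑ s, a s * permForm (M n) (β n) (g n) s x.2 : ℝ) * Complex.I)
      = 𝔼 π : Equiv.Perm (Fin n),
      Complex.exp ((t * ∑ s, a s * permForm (M n) (β n) (g n) s π : ℝ) * Complex.I) := fun n =>
    expect_pair_snd fun π =>
      Complex.exp ((t * ∑ s, a s * permForm (M n) (β n) (g n) s π : ℝ) * Complex.I)
  have e2 : ∀ n, 𝔼 x : (Fin n → Fin n) × Equiv.Perm (Fin n),
      Complex.exp ((t * ∑ s, a s * colForm (M n) (β n) (g n) s (coupled x.2 x.1) : ℝ) * Complex.I)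
      = 𝔼 c : Fin n → Fin n,
      Complex.exp ((t * ∑ s, a s * colForm (M n) (β n) (g n) s c : ℝ) * Complex.I) := fun n =>
    expect_pair_coupled fun c =>
      Complex.exp ((t * ∑ s, a s * colForm (M n) (β n) (g n) s c : ℝ) * Complex.I)
  have h2 := h.add (H.tendsto_expect_exp_colForm a t)
  rw [zero_add] at h2
  refine h2.congr fun n => ?_
  rw [e1, e2, sub_add_cancel]

end FormArray

section Windows

theorem ind_mul_ind {n : ℕ} (s t : ℕ) (i : Fin n) : ind s i * ind t i = ind (min s t) i := by
  by_cases h : (i : ℕ) < s <;> by_cases h' : (i : ℕ) < t <;> simp [ind, h, h']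

/-- The normalised overlap of two windows, in centred form. -/
noncomputable def windowCov (u v u' v' : ℝ) : ℝ :=
  min v v' - min v u' - min u v' + min u u' - (v - u) * (v' - u')

theorem expect_cwindow {n t₁ t₂ : ℕ} (hn : n ≠ 0) (h : t₁ ≤ t₂) (h' : t₂ ≤ n) :
    𝔼 i : Fin n, cwindow t₁ t₂ i = 0 := by
  have hN : (n : ℝ) ≠ 0 := by exact_mod_cast hn
  have : ∑ i : Fin n, cwindow t₁ t₂ i = 0 := by
    simp only [cwindow]
    rw [sum_sub_distrib, sum_sub_distrib, sum_ind h', sum_ind (h.trans h'), sum_const, card_univ,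
      Fintype.card_fin, nsmul_eq_mul, mul_div_cancel₀ _ hN, sub_self]
  rw [Fintype.expect_eq_sum_div_card, this, zero_div]

theorem expect_cwindow_mul {n t₁ t₂ s₁ s₂ : ℕ} (hn : n ≠ 0) (h : t₁ ≤ t₂) (h' : t₂ ≤ n)
    (k : s₁ ≤ s₂) (k' : s₂ ≤ n) :
    𝔼 i : Fin n, cwindow t₁ t₂ i * cwindow s₁ s₂ i
      = windowCov ((t₁ : ℝ) / n) ((t₂ : ℝ) / n) ((s₁ : ℝ) / n) ((s₂ : ℝ) / n) := by
  have hN : (n : ℝ) ≠ 0 := by exact_mod_cast hn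
  have hN0 : (0 : ℝ) ≤ n := Nat.cast_nonneg n
  have e : ∀ i : Fin n, cwindow t₁ t₂ i * cwindow s₁ s₂ i
      = ind (min t₂ s₂) i - ind (min t₂ s₁) i - ind (min t₁ s₂) i + ind (min t₁ s₁) i
        - ((s₂ : ℝ) - s₁) / n * (ind t₂ i - ind t₁ i) - ((t₂ : ℝ) - t₁) / n * (ind s₂ i - ind s₁ i)
        + ((t₂ : ℝ) - t₁) / n * (((s₂ : ℝ) - s₁) / n) := fun i => by
    simp only [← ind_mul_ind, cwindow]
    ring
  have ht₁ := h.trans h'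
  have hs₁ := k.trans k'
  rw [Fintype.expect_eq_sum_div_card, Fintype.card_fin]
  simp only [e, sum_add_distrib, sum_sub_distrib, ← mul_sum, sum_const, card_univ,
    Fintype.card_fin, nsmul_eq_mul]
  rw [sum_ind h', sum_ind k', sum_ind ht₁, sum_ind hs₁, sum_ind (min_le_of_left_le h'),
    sum_ind (min_le_of_left_le h'), sum_ind (min_le_of_left_le ht₁),
    sum_ind (min_le_of_left_le ht₁), windowCov]
  simp only [min_div_div_right hN0, Nat.cast_min]
  field_simp
  ring

theorem abs_cwindow_le {n t₁ t₂ : ℕ} (h : t₁ ≤ t₂) (h' : t₂ ≤ n) (i : Fin n) :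
    |cwindow t₁ t₂ i| ≤ 2 := by
  have hn : (0 : ℝ) < n := by exact_mod_cast i.pos
  have h1 : ((t₂ : ℝ) - t₁) / n ≤ 1 := by
    rw [div_le_one hn]
    have : (t₂ : ℝ) ≤ n := by exact_mod_cast h'
    linarith [Nat.cast_nonneg (α := ℝ) t₁]
  have h2 : 0 ≤ ((t₂ : ℝ) - t₁) / n := by
    have : (t₁ : ℝ) ≤ t₂ := by exact_mod_cast h
    exact div_nonneg (by linarith) hn.le
  rw [cwindow, abs_le]
  rcases ind_mem t₁ i with e | e <;> rcases ind_mem t₂ i with e' | e' <;> rw [e, e'] <;>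
    constructor <;> linarith

theorem floor_mul_le {u v : ℝ} (huv : 0 < u ∧ u < v ∧ v < 1) (n : ℕ) :
    ⌊(n : ℝ) * u⌋₊ ≤ ⌊(n : ℝ) * v⌋₊ ∧ ⌊(n : ℝ) * v⌋₊ ≤ n := by
  constructor
  · exact Nat.floor_le_floor (mul_le_mul_of_nonneg_left huv.2.1.le (Nat.cast_nonneg n))
  · exact Nat.floor_le_of_le (mul_le_of_le_one_right (Nat.cast_nonneg n) huv.2.2.le)

theorem tendsto_floor_mul_div {u : ℝ} (hu : 0 ≤ u) :
    Tendsto (fun n : ℕ => (⌊(n : ℝ) * u⌋₊ : ℝ) / n) atTop (𝓝 u) := by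
  simpa only [mul_comm u, Function.comp_def] using
    (tendsto_nat_floor_mul_div_atTop hu).comp tendsto_natCast_atTop_atTop

theorem tendsto_expect_cwindow_mul {u v u' v' : ℝ} (h : 0 < u ∧ u < v ∧ v < 1)
    (h' : 0 < u' ∧ u' < v' ∧ v' < 1) :
    Tendsto (fun n : ℕ => 𝔼 i : Fin n, cwindow ⌊(n : ℝ) * u⌋₊ ⌊(n : ℝ) * v⌋₊ i
      * cwindow ⌊(n : ℝ) * u'⌋₊ ⌊(n : ℝ) * v'⌋₊ i) atTop (𝓝 (windowCov u v u' v')) := by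
  have hu := tendsto_floor_mul_div h.1.le
  have hv := tendsto_floor_mul_div (h.1.trans h.2.1).le
  have hu' := tendsto_floor_mul_div h'.1.le
  have hv' := tendsto_floor_mul_div (h'.1.trans h'.2.1).le
  have hlim := ((((hv.min hv').sub (hv.min hu')).sub (hu.min hv')).add (hu.min hu')).sub
    ((hv.sub hu).mul (hv'.sub hu'))
  refine hlim.congr' ?_
  filter_upwards [eventually_ge_atTop 1] with n hn
  obtain ⟨a1, a2⟩ := floor_mul_le h n
  obtain ⟨b1, b2⟩ := floor_mul_le h' n
  rw [expect_cwindow_mul (by omega) a1 a2 b1 b2, windowCov]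

/-- The factor standardising the window from `u` to `v`. -/
noncomputable def windowScale (u v : ℝ) : ℝ := 1 / Real.sqrt ((v - u) * (1 - (v - u)))

theorem windowScale_pos {u v : ℝ} (h : 0 < u ∧ u < v ∧ v < 1) : 0 < windowScale u v :=
  one_div_pos.2 <| Real.sqrt_pos.2 <| mul_pos (by linarith) (by linarith)

theorem windowScale_mul_windowCov_self {u v : ℝ} (h : 0 < u ∧ u < v ∧ v < 1) :
    windowScale u v * windowScale u v * windowCov u v u v = 1 := by
  have hp : 0 < (v - u) * (1 - (v - u)) := mul_pos (by linarith) (by linarith)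
  have e : windowCov u v u v = (v - u) * (1 - (v - u)) := by
    rw [windowCov, min_self, min_self, min_eq_right h.2.1.le, min_eq_left h.2.1.le]
    ring
  rw [e, windowScale, ← mul_div_mul_comm, Real.mul_self_sqrt hp.le, mul_one, one_div,
    inv_mul_cancel₀ hp.ne']

end Windows

section Standardized

theorem div_sqrt_expect_sq_eq {α : Type*} [Fintype α] {f f' : α → ℝ} {c : ℝ} (hc : 0 < c)
    (h : ∀ x, f x = c * f' x) (x : α) :
    f x / Real.sqrt (𝔼 y, f y ^ 2) = f' x / Real.sqrt (𝔼 y, f' y ^ 2) := by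
  simp only [h, mul_pow]
  rw [← mul_expect, Real.sqrt_mul (sq_nonneg c), Real.sqrt_sq hc.le, mul_div_mul_left _ _ hc.ne']

/-- The standardised row effects. -/
noncomputable def unitRow (n : ℕ) (R : Fin n → Fin n → ℝ) (a : Fin n) : ℝ :=
  (Rbar n R a - r0 n R) / Real.sqrt (∑ b, (Rbar n R b - r0 n R) ^ 2)

/-- The standardised interaction matrix. -/
noncomputable def unitInteraction (n : ℕ) (R : Fin n → Fin n → ℝ) (a b : Fin n) : ℝ :=
  interaction n R a b / Real.sqrt (2 * ∑ i, ∑ j, interaction n R i j ^ 2)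

variable {n : ℕ} {R : Fin n → Fin n → ℝ} {t₁ t₂ : ℕ}

theorem Zdiff_eq (hn : 2 ≤ n) (hs : ∀ i j, R i j = R j i) (h : t₁ ≤ t₂) {lam : ℝ} (hlam : 0 < lam)
    (hv : 0 < pvar n fun π => Udiff n R π t₁ t₂) :
    0 < ∑ a, (Rbar n R a - r0 n R) ^ 2 ∧ ∀ π, Zdiff n R π t₁ t₂
      = lin (unitRow n R) (fun i => lam * cwindow t₁ t₂ i) ⇑π⁻¹
        / Real.sqrt (𝔼 σ : Equiv.Perm (Fin n),
          lin (unitRow n R) (fun i => lam * cwindow t₁ t₂ i) ⇑σ⁻¹ ^ 2) := by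
  have hN : (2 : ℝ) ≤ n := by exact_mod_cast hn
  have : NeZero n := ⟨by omega⟩
  obtain ⟨-, h1, h2⟩ := standardize_eq (fun π => Udiff_eq hn hs h π) (by linarith)
    (expect_lin_inv_eq_zero (sum_Rbar_sub (by omega) R) _) hv
  have hpos : 0 < ∑ a, (Rbar n R a - r0 n R) ^ 2 := by
    refine (sum_nonneg fun _ _ => sq_nonneg _).lt_of_ne' fun h0 => h1.ne' ?_
    have : ∀ a, Rbar n R a - r0 n R = 0 := fun a =>
      pow_eq_zero_iff two_ne_zero |>.1 ((sum_eq_zero_iff_of_nonneg fun _ _ => sq_nonneg _).1 h0 a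
        (mem_univ a))
    simp [lin, this]
  refine ⟨hpos, fun π => ?_⟩
  have hsq := Real.sqrt_pos.2 hpos
  rw [Zdiff, h2]
  refine div_sqrt_expect_sq_eq
    (f := fun π : Equiv.Perm (Fin n) =>
      lin (fun a => Rbar n R a - r0 n R) (cwindow t₁ t₂) ⇑π⁻¹)
    (f' := fun π : Equiv.Perm (Fin n) => lin (unitRow n R) (fun i => lam * cwindow t₁ t₂ i) ⇑π⁻¹)
    (div_pos hsq hlam) (fun π => ?_) π
  simp only [lin, mul_sum, unitRow]
  refine sum_congr rfl fun a _ => ?_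
  field_simp

theorem Zw_eq (hn : 3 ≤ n) (hs : ∀ i j, R i j = R j i) (hd : ∀ i, R i i = 0) (h : t₁ ≤ t₂)
    (h' : t₂ ≤ n) {lam : ℝ} (hlam : 0 < lam) (hv : 0 < pvar n fun π => Uw n R π t₁ t₂) :
    0 < ∑ a, ∑ b, interaction n R a b ^ 2 ∧ ∀ π, Zw n R π t₁ t₂
      = quad (unitInteraction n R) (prodKer fun i => lam * cwindow t₁ t₂ i) ⇑π⁻¹
        / Real.sqrt (𝔼 σ : Equiv.Perm (Fin n),
          quad (unitInteraction n R) (prodKer fun i => lam * cwindow t₁ t₂ i) ⇑σ⁻¹ ^ 2) := by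
  obtain ⟨C, hC⟩ := Uw_eq hn hs hd h h'
  have hC' : ∀ π, Uw n R π t₁ t₂
      = 1 * quad (interaction n R) (fun x y => cwindow t₁ t₂ x * cwindow t₁ t₂ y) ⇑π⁻¹ + C :=
    fun π => by rw [hC, one_mul]
  obtain ⟨-, h1, h2⟩ := standardize_eq hC' zero_le_one
    (expect_quad_inv_eq_zero (by omega) (interaction_self R) (sum_interaction hn hd) _) hv
  have hpos : 0 < ∑ a, ∑ b, interaction n R a b ^ 2 := by
    refine (sum_nonneg fun _ _ => sum_nonneg fun _ _ => sq_nonneg _).lt_of_ne' fun h0 => h1.ne' ?_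
    have : ∀ a b, interaction n R a b = 0 := fun a b =>
      pow_eq_zero_iff two_ne_zero |>.1 <| (sum_eq_zero_iff_of_nonneg fun _ _ => sq_nonneg _).1
        ((sum_eq_zero_iff_of_nonneg fun _ _ => sum_nonneg fun _ _ => sq_nonneg _).1 h0 a
          (mem_univ a)) b (mem_univ b)
    simp [quad, this]
  refine ⟨hpos, fun π => ?_⟩
  have hsq : 0 < Real.sqrt (2 * ∑ a, ∑ b, interaction n R a b ^ 2) :=
    Real.sqrt_pos.2 (by positivity)
  rw [Zw, h2]
  refine div_sqrt_expect_sq_eq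
    (f := fun π : Equiv.Perm (Fin n) =>
      quad (interaction n R) (fun x y => cwindow t₁ t₂ x * cwindow t₁ t₂ y) ⇑π⁻¹)
    (f' := fun π : Equiv.Perm (Fin n) =>
      quad (unitInteraction n R) (prodKer fun i => lam * cwindow t₁ t₂ i) ⇑π⁻¹)
    (div_pos hsq (mul_pos hlam hlam)) (fun π => ?_) π
  simp only [quad, unitInteraction, prodKer]
  generalize Real.sqrt (2 * ∑ a, ∑ b, interaction n R a b ^ 2) = s at hsq ⊢
  simp only [mul_sum]
  refine sum_congr rfl fun a _ => sum_congr rfl fun b _ => ?_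
  field_simp

end Standardized

section Array

variable {R : (n : ℕ) → Fin n → Fin n → ℝ} {L : Type*} [Fintype L] {u v : L → ℝ}

/-- The standardised windows. -/
noncomputable def score (u v : L → ℝ) (n : ℕ) (l : L) (i : Fin n) : ℝ :=
  windowScale (u l) (v l) * cwindow ⌊(n : ℝ) * u l⌋₊ ⌊(n : ℝ) * v l⌋₊ i

/-- The limiting correlations of the standardised windows. -/
noncomputable def windowCorr (u v : L → ℝ) (l l' : L) : ℝ :=
  windowScale (u l) (v l) * windowScale (u l') (v l') * windowCov (u l) (v l) (u l') (v l')

theorem formArray (hsym : ∀ n (i j : Fin n), R n i j = R n j i)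
    (hdiag : ∀ n (i : Fin n), R n i i = 0) (hC1 : Cond1 R) (hC2 : Cond2 R) (hC5 : Cond5 R)
    (hC6 : Cond6 R) (huv : ∀ l, 0 < u l ∧ u l < v l ∧ v l < 1)
    (hrow : ∀ᶠ n in atTop, 0 < ∑ a, (Rbar n (R n) a - r0 n (R n)) ^ 2)
    (hint : ∀ᶠ n in atTop, 0 < ∑ a, ∑ b, interaction n (R n) a b ^ 2) :
    FormArray (fun n => unitInteraction n (R n)) (fun n => unitRow n (R n)) (score u v)
      (∑ l, windowScale (u l) (v l) * 2) (∑ l, 4 * windowScale (u l) (v l) ^ 2)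
      (windowCorr u v) where
  symm n a b := by rw [unitInteraction, unitInteraction, interaction_comm (hsym n)]
  diag n a := by rw [unitInteraction, interaction_self, zero_div]
  sum_row := by
    filter_upwards [eventually_ge_atTop 3] with n hn a
    simp only [unitInteraction]
    rw [← sum_div, sum_interaction hn (hdiag n), zero_div]
  sum_coeff := by
    filter_upwards [eventually_ge_atTop 1] with n hn
    simp only [unitRow]
    rw [← sum_div, sum_Rbar_sub (by omega), zero_div]
  sum_sum_sq := by
    filter_upwards [hint] with n hn
    simp only [unitInteraction, div_pow, ← sum_div]
    rw [Real.sq_sqrt (by positivity)]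
    field_simp
  sum_sq := by
    filter_upwards [hrow] with n hn
    simp only [unitRow, div_pow, ← sum_div]
    rw [Real.sq_sqrt hn.le, div_self hn.ne']
  gram_le ε hε := by
    filter_upwards [hint, eventually_interaction_gram_le hsym hdiag hC1 hC5 hC6
      (show 0 < 4 * ε by positivity)] with n hn h
    have e : ∀ b b', ∑ a, unitInteraction n (R n) a b * unitInteraction n (R n) a b'
        = (∑ a, interaction n (R n) a b * interaction n (R n) a b')
          / (2 * ∑ i, ∑ j, interaction n (R n) i j ^ 2) := fun b b' => by
      simp only [unitInteraction]
      rw [sum_div]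
      refine sum_congr rfl fun a _ => ?_
      rw [div_mul_div_comm, Real.mul_self_sqrt (by positivity)]
    simp only [e, div_pow, ← sum_div]
    rw [div_le_iff₀ (by positivity)]
    exact h.trans_eq (by ring)
  abs_le ε hε := by
    filter_upwards [hrow, eventually_abs_Rbar_sub_le hC2 hε] with n hn h a
    rw [unitRow, abs_div, abs_of_nonneg (Real.sqrt_nonneg _), div_le_iff₀ (Real.sqrt_pos.2 hn)]
    exact h a
  score_le := Eventually.of_forall fun n l i => by
    obtain ⟨h, h'⟩ := floor_mul_le (huv l) n
    rw [score, abs_mul, abs_of_pos (windowScale_pos (huv l))]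
    refine (mul_le_mul_of_nonneg_left (abs_cwindow_le h h' i) (windowScale_pos (huv l)).le).trans ?_
    exact single_le_sum (f := fun l => windowScale (u l) (v l) * 2)
      (fun l _ => mul_nonneg (windowScale_pos (huv l)).le zero_le_two) (mem_univ l)
  expect_score := by
    filter_upwards [eventually_ge_atTop 1] with n hn l
    obtain ⟨h, h'⟩ := floor_mul_le (huv l) n
    simp only [score]
    rw [← mul_expect, expect_cwindow (by omega) h h', mul_zero]
  sorted_le := by
    filter_upwards [eventually_ge_atTop 1] with n hn l
    have : NeZero n := ⟨by omega⟩
    refine (expect_sum_sub_sorted_sq_le (fun i => rfl)).trans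
      (mul_le_mul_of_nonneg_right ?_ (Real.sqrt_nonneg _))
    exact single_le_sum (f := fun l => 4 * windowScale (u l) (v l) ^ 2)
      (fun l _ => by positivity) (mem_univ l)
  cov l l' := by
    refine ((tendsto_expect_cwindow_mul (huv l) (huv l')).const_mul
      (windowScale (u l) (v l) * windowScale (u l') (v l'))).congr fun n => ?_
    rw [mul_expect]
    exact expect_congr rfl fun i _ => by simp only [score]; ring
  cov_self l := windowScale_mul_windowCov_self (huv l)

end Array

section CharFun

theorem charFun_permDist (n : ℕ) (f : Equiv.Perm (Fin n) → ℝ) (t : ℝ) :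
    charFun (permDist n f : Measure ℝ) t
      = 𝔼 π, Complex.exp ((t * f π : ℝ) * Complex.I) := by
  have hf : Measurable f := fun _ _ => trivial
  have e : (permDist n f : Measure ℝ)
      = Measure.map f (PMF.uniformOfFintype (Equiv.Perm (Fin n))).toMeasure := rfl
  have : MeasurableSingletonClass (Equiv.Perm (Fin n)) := ⟨fun _ => trivial⟩
  rw [e, charFun_apply_real, integral_map hf.aemeasurable (by fun_prop), PMF.integral_eq_sum,
    Fintype.expect_eq_sum_div_card, sum_div]
  refine sum_congr rfl fun π _ => ?_
  rw [PMF.uniformOfFintype_apply, ENNReal.toReal_inv, ENNReal.toReal_natCast, Complex.real_smul]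
  push_cast
  rw [div_eq_inv_mul]

theorem charFun_gaussLimit {s : ℝ} (hs : 0 ≤ s) (t : ℝ) :
    charFun (gaussLimit s : Measure ℝ) t = Complex.exp (-(s * t ^ 2 / 2 : ℝ)) := by
  have e : (gaussLimit s : Measure ℝ) = gaussianReal 0 (Real.toNNReal s) := rfl
  rw [e, charFun_gaussianReal]
  congr 1
  have : ((Real.toNNReal s : ℝ) : ℂ) = (s : ℂ) := by rw [Real.coe_toNNReal _ hs]
  rw [this]
  push_cast
  ring

end CharFun

end RING

/-- Under Conditions (C1)–(C6), for every `m ≥ 1` and pairs `0 < u_i < v_i < 1`,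
there is a positive semidefinite `2m×2m` matrix `C` with unit diagonal and zero
cross-block between the `Z_w`- and `Z_diff`-coordinates such that the joint
vector `(Z_w^π(⌊n·u_i⌋,⌊n·v_i⌋))_i, (Z_diff^π(⌊n·u_i⌋,⌊n·v_i⌋))_i` converges in
distribution under the permutation null to a centered Gaussian vector with
covariance `C`; in particular the limiting fields are independent. Multivariate
convergence is expressed through the Cramér–Wold device. -/
theorem stmt12 (R : (n : ℕ) → Fin n → Fin n → ℝ)
    (hsym : ∀ n (i j : Fin n), R n i j = R n j i) (hdiag : ∀ n (i : Fin n), R n i i = 0)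
    (hC1 : Cond1 R) (hC2 : Cond2 R) (hC3 : Cond3 R) (hC4 : Cond4 R)
    (hC5 : Cond5 R) (hC6 : Cond6 R)
    (m : ℕ) (hm : 1 ≤ m) (u v : Fin m → ℝ)
    (huv : ∀ i, 0 < u i ∧ u i < v i ∧ v i < 1)
    (hvar : ∀ i : Fin m, ∀ᶠ n in atTop,
      0 < pvar n (fun π => Uw n (R n) π ⌊(n : ℝ) * u i⌋₊ ⌊(n : ℝ) * v i⌋₊)
      ∧ 0 < pvar n (fun π => Udiff n (R n) π ⌊(n : ℝ) * u i⌋₊ ⌊(n : ℝ) * v i⌋₊)) :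
    ∃ C : Matrix (Fin m ⊕ Fin m) (Fin m ⊕ Fin m) ℝ,
      C.PosSemidef
      ∧ (∀ s, C s s = 1)
      ∧ (∀ i j : Fin m, C (Sum.inl i) (Sum.inr j) = 0 ∧ C (Sum.inr i) (Sum.inl j) = 0)
      ∧ ∀ a : Fin m ⊕ Fin m → ℝ,
          Tendsto
            (fun n =>
              permDist n (fun π =>
                ∑ s : Fin m ⊕ Fin m,
                  a s * Sum.elim
                    (fun i => Zw n (R n) π ⌊(n : ℝ) * u i⌋₊ ⌊(n : ℝ) * v i⌋₊)
                    (fun i => Zdiff n (R n) π ⌊(n : ℝ) * u i⌋₊ ⌊(n : ℝ) * v i⌋₊) s))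
            atTop
            (𝓝 (gaussLimit
              (∑ s : Fin m ⊕ Fin m, ∑ s' : Fin m ⊕ Fin m, a s * a s' * C s s'))) := by
  have hZ : ∀ᶠ n in atTop, ∀ i : Fin m,
      (0 < ∑ a, ∑ b, interaction n (R n) a b ^ 2 ∧ ∀ π,
        Zw n (R n) π ⌊(n : ℝ) * u i⌋₊ ⌊(n : ℝ) * v i⌋₊
          = permForm (unitInteraction n (R n)) (unitRow n (R n)) (score u v n) (Sum.inl i) π)
      ∧ (0 < ∑ a, (Rbar n (R n) a - r0 n (R n)) ^ 2 ∧ ∀ π,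
        Zdiff n (R n) π ⌊(n : ℝ) * u i⌋₊ ⌊(n : ℝ) * v i⌋₊
          = permForm (unitInteraction n (R n)) (unitRow n (R n)) (score u v n) (Sum.inr i) π) := by
    filter_upwards [eventually_all.2 hvar, eventually_ge_atTop 3] with n hv hn i
    obtain ⟨h, h'⟩ := floor_mul_le (huv i) n
    have hlam := windowScale_pos (huv i)
    exact ⟨Zw_eq hn (hsym n) (hdiag n) h h' hlam (hv i).1,
      Zdiff_eq (by omega) (hsym n) h hlam (hv i).2⟩
  have H : FormArray (fun n => unitInteraction n (R n)) (fun n => unitRow n (R n)) (score u v) _ _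
      (windowCorr u v) :=
    formArray hsym hdiag hC1 hC2 hC5 hC6 huv (hZ.mono fun n h => (h ⟨0, hm⟩).2.1)
      (hZ.mono fun n h => (h ⟨0, hm⟩).1.1)
  refine ⟨limitCov (windowCorr u v), H.posSemidef, ?_, fun i j => ⟨rfl, rfl⟩, fun a => ?_⟩
  · rintro (i | i)
    · simp [limitCov, H.cov_self]
    · simp [limitCov, H.cov_self]
  · rw [ProbabilityMeasure.tendsto_iff_tendsto_charFun]
    intro t
    rw [charFun_gaussLimit (H.sum_limitCov_nonneg a)]
    refine (H.tendsto_expect_exp_permForm a t).congr' ?_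
    filter_upwards [hZ] with n h
    rw [charFun_permDist]
    refine expect_congr rfl fun π _ => ?_
    congr 4
    refine sum_congr rfl fun s _ => ?_
    rcases s with i | i
    · rw [Sum.elim_inl, (h i).1.2]
    · rw [Sum.elim_inr, (h i).2.2]
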